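/- arXiv:math/0202174 — 2 statements merged into one kernel-verified Lean document; each statement's English description precedes it below -/
import Mathlib

section
/- Let (A_S,S) be an Artin-Tits system of spherical type, X,Y ⊆ S and g ∈ A_S. If the parabolic subgroup G = gA_Xg⁻¹ satisfies G ⊆ A_Y, then G is a parabolic subgroup of A_Y: there exist R ⊆ Y and y ∈ A_Y such that gA_Xg⁻¹ = yA_Ry⁻¹. -/
/-!
Common definitions for formalizing "Normalisateur des sous-groupes paraboliques
des groupes d'Artin-Tits" (E. Godelle).

We fix a Coxeter matrix `M` over a finite index set `B` (Mathlib's convention: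
`M s t = 0` encodes `m_{s,t} = ∞`).  The Artin-Tits group `Artin M` is the
presented group on the braid relations, the Coxeter group is Mathlib's
`M.Group`, and `proj : Artin M →* M.Group` is the canonical projection
(adding the relations `s² = 1`).
-/

namespace ArtinTitsPaper

open List

variable {B : Type*}

/-- The alternating list `[s, t, s, t, ...]` with `n` terms, starting with `s`. -/
def altList (s t : B) : ℕ → List B
  | 0 => []
  | n + 1 => s :: altList t s n

/-- The braid relators `(sts⋯)(tst⋯)⁻¹` (`m_{s,t}` letters each) for `s ≠ t`,
`m_{s,t} ≠ ∞`. -/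
def braidRels (M : CoxeterMatrix B) : Set (FreeGroup B) :=
  { r | ∃ s t : B, s ≠ t ∧ M s t ≠ 0 ∧
      r = ((altList s t (M s t)).map FreeGroup.of).prod *
          (((altList t s (M s t)).map FreeGroup.of).prod)⁻¹ }

/-- The Artin-Tits group associated to the Coxeter matrix `M`. -/
def Artin (M : CoxeterMatrix B) : Type _ := PresentedGroup (braidRels M)

instance (M : CoxeterMatrix B) : Group (Artin M) :=
  QuotientGroup.Quotient.group _

/-- The standard generator of `Artin M` indexed by `s : B` (the image of `S` in `A_S`). -/
def gen (M : CoxeterMatrix B) (s : B) : Artin M := PresentedGroup.of s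

theorem altList_eq_reverse_alternatingWord (s t : B) (n : ℕ) :
    altList s t n = (CoxeterSystem.alternatingWord t s n).reverse := by
  induction n generalizing s t with
  | zero => rfl
  | succ n ih =>
      rw [altList, CoxeterSystem.alternatingWord_succ, List.concat_eq_append,
        List.reverse_append]
      simp [ih]

theorem lift_simple_listProd (M : CoxeterMatrix B) (l : List B) :
    FreeGroup.lift M.simple ((l.map FreeGroup.of).prod) =
      M.toCoxeterSystem.wordProd l := by
  rw [CoxeterSystem.wordProd, map_list_prod, List.map_map]
  simp [Function.comp_def, CoxeterMatrix.toCoxeterSystem_simple]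

theorem braid_lift (M : CoxeterMatrix B) :
    ∀ r ∈ braidRels M, FreeGroup.lift M.simple r = 1 := by
  rintro r ⟨s, t, hst, hm, rfl⟩
  rw [map_mul, map_inv, lift_simple_listProd, lift_simple_listProd,
    altList_eq_reverse_alternatingWord, altList_eq_reverse_alternatingWord,
    CoxeterSystem.wordProd_reverse, CoxeterSystem.wordProd_reverse]
  have hsym : M s t = M t s := M.symmetric s t
  have hb := M.toCoxeterSystem.wordProd_braidWord_eq t s
  rw [CoxeterSystem.braidWord, CoxeterSystem.braidWord, ← hsym] at hb
  rw [hb]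
  simp

/-- The canonical projection from the Artin-Tits group onto the Coxeter group
(adding the relations `s² = 1`). -/
def proj (M : CoxeterMatrix B) : Artin M →* M.Group :=
  PresentedGroup.toGroup (braid_lift M)

/-- The positive monoid `A_S⁺`, the submonoid of `A_S` generated by `S`. -/
def posMon (M : CoxeterMatrix B) : Submonoid (Artin M) :=
  Submonoid.closure (Set.range (gen M))

/-- The submonoid `A_X⁺` of `A_S` generated by `X ⊆ S`. -/
def posMonOn (M : CoxeterMatrix B) (X : Set B) : Submonoid (Artin M) :=
  Submonoid.closure (gen M '' X)

/-- The standard parabolic subgroup `A_X` of `A_S` generated by `X ⊆ S`. -/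
def stdSub (M : CoxeterMatrix B) (X : Set B) : Subgroup (Artin M) :=
  Subgroup.closure (gen M '' X)

/-- The standard parabolic subgroup `W_X` of the Coxeter group `W_S`. -/
def coxSub (M : CoxeterMatrix B) (X : Set B) : Subgroup M.Group :=
  Subgroup.closure (M.simple '' X)

/-- `X ⊆ S` is of spherical type if the Coxeter group `W_X` is finite. -/
def IsSpherical (M : CoxeterMatrix B) (X : Set B) : Prop :=
  Finite (coxSub M X)

/-- `a` left-divides `b` in the positive monoid: `b = a c` with `c ∈ A_S⁺`. -/
def ldvd (M : CoxeterMatrix B) (a b : Artin M) : Prop :=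
  ∃ c ∈ posMon M, a * c = b

/-- `a` right-divides `b` in the positive monoid: `b = c a` with `c ∈ A_S⁺`. -/
def rdvd (M : CoxeterMatrix B) (a b : Artin M) : Prop :=
  ∃ c ∈ posMon M, c * a = b

/-- `d` is the least common multiple `Δ_X` of `X` in `A_X⁺` (for left-divisibility). -/
def IsDelta (M : CoxeterMatrix B) (X : Set B) (d : Artin M) : Prop :=
  d ∈ posMonOn M X ∧
  (∀ s ∈ X, ∃ c ∈ posMonOn M X, gen M s * c = d) ∧
  ∀ m ∈ posMonOn M X, (∀ s ∈ X, ∃ c ∈ posMonOn M X, gen M s * c = m) →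
    ∃ c ∈ posMonOn M X, d * c = m

/-- The subset `Xg = {σ_x g : x ∈ X}` of `A_S`. -/
def leftMul (M : CoxeterMatrix B) (X : Set B) (g : Artin M) : Set (Artin M) :=
  (fun x => gen M x * g) '' X

/-- The subset `gX = {g σ_x : x ∈ X}` of `A_S`. -/
def rightMul (M : CoxeterMatrix B) (X : Set B) (g : Artin M) : Set (Artin M) :=
  (fun x => g * gen M x) '' X

/-- `Conj(S;X,Y) = {g ∈ A_S : gX = Yg}`. -/
def conjSet (M : CoxeterMatrix B) (X Y : Set B) : Set (Artin M) :=
  { g | rightMul M X g = leftMul M Y g }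

/-- `Conj⁺(S;X,Y) = {g ∈ A_S⁺ : gX = Yg}`. -/
def conjPos (M : CoxeterMatrix B) (X Y : Set B) : Set (Artin M) :=
  { g | g ∈ posMon M ∧ rightMul M X g = leftMul M Y g }

/-- The quasi-centralizer `QZ_{A_S}(A_X) = {g ∈ A_S : gX = Xg}`. -/
def QZset (M : CoxeterMatrix B) (X : Set B) : Set (Artin M) :=
  conjSet M X X

/-- The indecomposable component of `Z` containing `t` (vertices of `Z` joined to `t`
by a path of edges `m_{a,b} ≠ 2` in the Coxeter diagram on `Z`). -/
def comp (M : CoxeterMatrix B) (Z : Set B) (t : B) : Set B :=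
  { s ∈ Z | Relation.ReflTransGen (fun a b => a ∈ Z ∧ b ∈ Z ∧ a ≠ b ∧ M a b ≠ 2) t s }

/-- `Z` is indecomposable: it admits no nontrivial partition `Z = Z₁ ∪ Z₂` with
`m_{a,b} = 2` for `a ∈ Z₁`, `b ∈ Z₂`. -/
def Indecomp (M : CoxeterMatrix B) (Z : Set B) : Prop :=
  ¬ ∃ Z₁ Z₂ : Set B, Z₁.Nonempty ∧ Z₂.Nonempty ∧ Z₁ ∪ Z₂ = Z ∧ Disjoint Z₁ Z₂ ∧
      ∀ a ∈ Z₁, ∀ b ∈ Z₂, M a b = 2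

/-- `g` is an elementary positive `Y`-ribbon-`X`: `g = d_{X,t}` for some `t ∈ S` with
`X(t)` of spherical type, where `d_{X,t} = Δ_{X(t)}` if `t ∈ X` and
`d_{X,t} = Δ_{X(t)} Δ_{X(t)∖{t}}⁻¹` otherwise, and `Y ⊆ X ∪ {t}` satisfies `Yg = gX`. -/
def IsElemRibbon (M : CoxeterMatrix B) (X Y : Set B) (g : Artin M) : Prop :=
  ∃ t : B, IsSpherical M (comp M (X ∪ {t}) t) ∧
    ((t ∈ X ∧ IsDelta M (comp M (X ∪ {t}) t) g) ∨
      (t ∉ X ∧ ∃ d₁ d₂ : Artin M, IsDelta M (comp M (X ∪ {t}) t) d₁ ∧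
        IsDelta M ((comp M (X ∪ {t}) t) \ {t}) d₂ ∧ g = d₁ * d₂⁻¹)) ∧
    Y ⊆ X ∪ {t} ∧ leftMul M Y g = rightMul M X g

/-- `g` is a positive `Y`-ribbon-`X`: a product `g = g_n ⋯ g_1` of elementary positive
`X_i`-ribbons-`X_{i-1}` with `X_0 = X`, `X_n = Y`. -/
inductive IsRibbon (M : CoxeterMatrix B) : Set B → Set B → Artin M → Prop
  | nil (X : Set B) : IsRibbon M X X 1
  | cons {X Y Z : Set B} {g h : Artin M} :
      IsRibbon M X Y g → IsElemRibbon M Y Z h → IsRibbon M X Z (h * g)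

/-- `g` is `X`-reduced: no element of `X` left-divides `g`. -/
def lreduced (M : CoxeterMatrix B) (X : Set B) (g : Artin M) : Prop :=
  ∀ s ∈ X, ¬ ldvd M (gen M s) g

/-- `g` is reduced-`X`: no element of `X` right-divides `g`. -/
def rreduced (M : CoxeterMatrix B) (X : Set B) (g : Artin M) : Prop :=
  ∀ s ∈ X, ¬ rdvd M (gen M s) g

/-- The set `H_X` of elements `g₁ g₂⁻¹` where `g₁, g₂` are `X`-reduced positive
`X`-ribbons-`X`. -/
def HXset (M : CoxeterMatrix B) (X : Set B) : Set (Artin M) :=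
  { g | ∃ g₁ g₂ : Artin M, IsRibbon M X X g₁ ∧ lreduced M X g₁ ∧
      IsRibbon M X X g₂ ∧ lreduced M X g₂ ∧ g = g₁ * g₂⁻¹ }

/-- The length of a positive element (the common length of its expressions as words
in the generators; junk value `0` outside of `A_S⁺`). -/
noncomputable def len (M : CoxeterMatrix B) (g : Artin M) : ℕ :=
  sInf { n | ∃ l : List B, l.length = n ∧ (l.map (gen M)).prod = g }

/-- The length of an element of the Coxeter group `W_S`. -/
noncomputable def wlen (M : CoxeterMatrix B) (w : M.Group) : ℕ :=
  sInf { n | ∃ l : List B, l.length = n ∧ (l.map M.simple).prod = w }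

/-- `g ∈ A_{S,red}`: `g` is positive and has the same length as its image in `W_S`. -/
def Red (M : CoxeterMatrix B) (g : Artin M) : Prop :=
  g ∈ posMon M ∧ len M g = wlen M (proj M g)

/-- `C` is a simple `s`-chain-`u`: either `C = 1` and `s = u`, or
`C = tst⋯` (`k` letters, `k < m_{s,t}`) with `u ∈ {s,t}` and `C·u = tst⋯` (`k+1` letters). -/
def IsSimpleChain (M : CoxeterMatrix B) (s u : B) (C : Artin M) : Prop :=
  (C = 1 ∧ s = u) ∨
  ∃ t : B, t ≠ s ∧ (u = s ∨ u = t) ∧ ∃ k : ℕ,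
    (M s t = 0 ∨ k < M s t) ∧
    C = ((altList t s k).map (gen M)).prod ∧
    C * gen M u = ((altList t s (k + 1)).map (gen M)).prod

/-- `C` is an `s`-chain-`t`: a product `C₁ ⋯ C_k` of simple chains composing from
origin `s` to target `t`. -/
inductive IsChain (M : CoxeterMatrix B) : B → B → Artin M → Prop
  | single {s u : B} {C : Artin M} : IsSimpleChain M s u C → IsChain M s u C
  | comp {s u v : B} {C D : Artin M} :
      IsChain M s u C → IsSimpleChain M u v D → IsChain M s v (C * D)


section AlternatingProducts

variable {G : Type*} [Monoid G]

/-- The alternating product `⋯ a t * a s * a t * a s` with `n` factors, ending with `a s`. -/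
def revAlt (a : B → G) (s t : B) : ℕ → G
  | 0 => 1
  | n + 1 => revAlt a t s n * a s

theorem revAlt_succ_left (a : B → G) (s t : B) (n : ℕ) :
    revAlt a s t (n + 1) = a (if Even n then s else t) * revAlt a s t n := by
  induction n generalizing s t with
  | zero => simp [revAlt]
  | succ n ih =>
      rw [revAlt, ih, mul_assoc]
      rcases Nat.even_or_odd n with h | h
      · simp [h, revAlt, Nat.even_add_one]
      · simp [Nat.not_even_iff_odd.2 h, revAlt, Nat.even_add_one]

theorem altList_prod_succ (a : B → G) (s t : B) (n : ℕ) :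
    ((altList s t (n + 1)).map a).prod =
      ((altList s t n).map a).prod * a (if Even n then s else t) := by
  induction n generalizing s t with
  | zero => simp [altList]
  | succ n ih =>
      rw [altList, List.map_cons, List.prod_cons, ih, ← mul_assoc]
      rcases Nat.even_or_odd n with h | h
      · simp [h, altList, Nat.even_add_one]
      · simp [Nat.not_even_iff_odd.2 h, altList, Nat.even_add_one]

theorem revAlt_eq_altList_prod (a : B → G) (s t : B) (n : ℕ) :
    revAlt a s t n =
      if Even n then ((altList t s n).map a).prod else ((altList s t n).map a).prod := by
  induction n generalizing s t with
  | zero => simp [revAlt, altList]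
  | succ n ih =>
      rw [revAlt, ih, altList_prod_succ, altList_prod_succ]
      rcases Nat.even_or_odd n with h | h
      · simp [h, Nat.even_add_one]
      · simp [Nat.not_even_iff_odd.2 h, Nat.even_add_one]

theorem revAlt_comm_iff (a : B → G) (s t : B) (n : ℕ) :
    revAlt a s t n = revAlt a t s n ↔
      ((altList s t n).map a).prod = ((altList t s n).map a).prod := by
  rw [revAlt_eq_altList_prod, revAlt_eq_altList_prod]
  split_ifs
  exacts [eq_comm, Iff.rfl]

theorem map_revAlt {H : Type*} [Monoid H] (f : G →* H) (a : B → G) (s t : B) (n : ℕ) :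
    f (revAlt a s t n) = revAlt (fun i => f (a i)) s t n := by
  induction n generalizing s t with
  | zero => simp [revAlt]
  | succ n ih => simp [revAlt, ih]

end AlternatingProducts

theorem proj_gen (M : CoxeterMatrix B) (s : B) : proj M (gen M s) = M.simple s :=
  PresentedGroup.toGroup.of (braid_lift M)

theorem revAlt_gen_comm (M : CoxeterMatrix B) (s t : B) (hst : s ≠ t) (hm : M s t ≠ 0) :
    revAlt (gen M) s t (M s t) = revAlt (gen M) t s (M s t) := by
  have key (l : List B) : PresentedGroup.mk (braidRels M) ((l.map FreeGroup.of).prod) =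
      (l.map (gen M)).prod := by
    rw [map_list_prod, List.map_map]
    rfl
  rw [revAlt_comm_iff, ← key, ← key]
  exact PresentedGroup.mk_eq_mk_of_mul_inv_mem ⟨s, t, hst, hm, rfl⟩

section Chebyshev

/-- The sequence `sin (k θ) / sin θ`, as a polynomial in `κ = cos θ`. -/
def chebSeq (κ : ℝ) : ℕ → ℝ
  | 0 => 0
  | 1 => 1
  | k + 2 => 2 * κ * chebSeq κ (k + 1) - chebSeq κ k

theorem chebSeq_cos_mul_sin (θ : ℝ) (k : ℕ) :
    chebSeq (Real.cos θ) k * Real.sin θ = Real.sin (k * θ) := by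
  induction k using Nat.twoStepInduction with
  | zero => simp [chebSeq]
  | one => simp [chebSeq]
  | more k ih₁ ih₂ =>
      have h₂ : ((k + 2 : ℕ) : ℝ) * θ = ((k + 1 : ℕ) : ℝ) * θ + θ := by push_cast; ring
      have h₀ : (k : ℝ) * θ = ((k + 1 : ℕ) : ℝ) * θ - θ := by push_cast; ring
      rw [h₀, Real.sin_sub] at ih₁
      rw [chebSeq, h₂, Real.sin_add]
      linear_combination 2 * Real.cos θ * ih₂ - ih₁

theorem chebSeq_one (k : ℕ) : chebSeq 1 k = k := by
  induction k using Nat.twoStepInduction with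
  | zero => simp [chebSeq]
  | one => simp [chebSeq]
  | more k ih₁ ih₂ =>
      rw [chebSeq, ih₁, ih₂]
      push_cast
      ring

theorem sin_pi_div_pos {m : ℕ} (hm : 2 ≤ m) : 0 < Real.sin (Real.pi / m) := by
  have h : (2 : ℝ) ≤ m := by exact_mod_cast hm
  refine Real.sin_pos_of_pos_of_lt_pi (by positivity) ?_
  rw [div_lt_iff₀ (by linarith)]
  nlinarith [Real.pi_pos]

theorem chebSeq_nonneg {m k : ℕ} (hm : m ≠ 1) (hk : m = 0 ∨ k ≤ m) :
    0 ≤ chebSeq (Real.cos (Real.pi / m)) k := by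
  rcases eq_or_ne m 0 with rfl | h0
  · simp [chebSeq_one]
  have hk : k ≤ m := by tauto
  have hs := sin_pi_div_pos (m := m) (by omega)
  refine nonneg_of_mul_nonneg_left ?_ hs
  rw [chebSeq_cos_mul_sin]
  have hm' : (0 : ℝ) < m := by positivity
  have hk' : (k : ℝ) ≤ m := by exact_mod_cast hk
  refine Real.sin_nonneg_of_nonneg_of_le_pi (by positivity) ?_
  rw [mul_div_assoc', div_le_iff₀ hm', mul_comm Real.pi]
  exact mul_le_mul_of_nonneg_right hk' Real.pi_pos.le

theorem chebSeq_pos {m k : ℕ} (hk : 0 < k) (hkm : k < m) :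
    0 < chebSeq (Real.cos (Real.pi / m)) k := by
  have hs := sin_pi_div_pos (m := m) (by omega)
  refine pos_of_mul_pos_left ?_ hs.le
  rw [chebSeq_cos_mul_sin]
  have hm' : (0 : ℝ) < m := by exact_mod_cast (by omega : 0 < m)
  have hk' : (k : ℝ) < m := by exact_mod_cast hkm
  have hk0 : (0 : ℝ) < k := by exact_mod_cast hk
  refine Real.sin_pos_of_pos_of_lt_pi (by positivity) ?_
  rw [mul_div_assoc', div_lt_iff₀ hm', mul_comm Real.pi]
  exact mul_lt_mul_of_pos_right hk' Real.pi_pos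

theorem chebSeq_sub {m k : ℕ} (hm : 2 ≤ m) (hk : k ≤ m) :
    chebSeq (Real.cos (Real.pi / m)) (m - k) = chebSeq (Real.cos (Real.pi / m)) k := by
  have hs := sin_pi_div_pos hm
  refine mul_right_cancel₀ hs.ne' ?_
  have hm' : (m : ℝ) ≠ 0 := by positivity
  rw [chebSeq_cos_mul_sin, chebSeq_cos_mul_sin, Nat.cast_sub hk, sub_mul,
    mul_div_cancel₀ _ hm', Real.sin_pi_sub]

theorem cos_pi_div_injective {m n : ℕ} (h : Real.cos (Real.pi / m) = Real.cos (Real.pi / n)) :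
    m = n := by
  have mem (k : ℕ) : Real.pi / k ∈ Set.Icc 0 Real.pi := by
    refine ⟨by positivity, ?_⟩
    rcases Nat.eq_zero_or_pos k with rfl | hk
    · simpa using Real.pi_pos.le
    · exact div_le_self Real.pi_pos.le (by exact_mod_cast hk)
  have h' := Real.injOn_cos (mem m) (mem n) h
  rw [div_eq_mul_inv, div_eq_mul_inv] at h'
  exact_mod_cast inv_injective (mul_left_cancel₀ Real.pi_ne_zero h')

end Chebyshev

section GeometricRepresentation

variable (M : CoxeterMatrix B)

/-- The simple root indexed by `s`. -/
noncomputable def root (s : B) : B →₀ ℝ := Finsupp.single s 1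

/-- The canonical bilinear form of a Coxeter matrix, `⟨e_s, e_t⟩ = -cos (π / m_{s,t})`
(the value is `-1` when `m_{s,t} = ∞`, since `π / 0 = 0`). -/
noncomputable def cosForm : (B →₀ ℝ) →ₗ[ℝ] (B →₀ ℝ) →ₗ[ℝ] ℝ :=
  Finsupp.linearCombination ℝ fun s =>
    Finsupp.linearCombination ℝ fun t => -Real.cos (Real.pi / M s t)

/-- The simple reflection of the geometric representation. -/
noncomputable def refl (s : B) : Module.End ℝ (B →₀ ℝ) :=
  LinearMap.id - (2 : ℝ) • (cosForm M (root s)).smulRight (root s)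

theorem root_injective : Function.Injective (root : B → B →₀ ℝ) :=
  Finsupp.single_left_injective one_ne_zero

theorem root_ne_zero (s : B) : root s ≠ 0 := by simp [root]

theorem cosForm_root (s t : B) : cosForm M (root s) (root t) = -Real.cos (Real.pi / M s t) := by
  simp [cosForm, root]

theorem cosForm_root_self (s : B) : cosForm M (root s) (root s) = 1 := by
  simp [cosForm_root]

theorem cosForm_comm (u v : B →₀ ℝ) : cosForm M u v = cosForm M v u := by
  suffices h : cosForm M = (cosForm M).flip by
    rw [h, LinearMap.flip_apply, ← h]
  ext s t
  change cosForm M (root s) (root t) = cosForm M (root t) (root s)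
  rw [cosForm_root, cosForm_root, M.symmetric]

theorem refl_apply (s : B) (v : B →₀ ℝ) :
    refl M s v = v - (2 * cosForm M (root s) v) • root s := by
  simp [refl, mul_smul]

theorem refl_root_self (s : B) : refl M s (root s) = -root s := by
  rw [refl_apply, cosForm_root_self, mul_one, two_smul]
  abel

theorem refl_mul_self (s : B) : refl M s * refl M s = 1 := by
  refine LinearMap.ext fun v => ?_
  rw [Module.End.mul_apply, refl_apply M s v, map_sub, map_smul, refl_root_self, refl_apply,
    Module.End.one_apply]
  module

theorem refl_refl (s : B) (v : B →₀ ℝ) : refl M s (refl M s v) = v := by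
  rw [← Module.End.mul_apply, refl_mul_self, Module.End.one_apply]

theorem refl_left (s t : B) (a b : ℝ) :
    refl M s (a • root s + b • root t) =
      (2 * Real.cos (Real.pi / M s t) * b - a) • root s + b • root t := by
  rw [refl_apply, map_add, map_smul, map_smul, cosForm_root_self, cosForm_root]
  simp only [smul_eq_mul]
  module

theorem cosForm_refl (s : B) (u v : B →₀ ℝ) :
    cosForm M (refl M s u) (refl M s v) = cosForm M u v := by
  simp only [refl_apply, map_sub, map_smul, LinearMap.sub_apply, LinearMap.smul_apply,
    smul_eq_mul, cosForm_root_self, cosForm_comm M u (root s)]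
  ring

theorem refl_mul_refl_pow_sin (s t : B) (x : ℝ) (k : ℕ) :
    ((refl M s * refl M t) ^ k)
        (Real.sin ((x + 1) * (Real.pi / M s t)) • root s +
          Real.sin (x * (Real.pi / M s t)) • root t) =
      Real.sin ((x + 2 * k + 1) * (Real.pi / M s t)) • root s +
        Real.sin ((x + 2 * k) * (Real.pi / M s t)) • root t := by
  have step (y θ : ℝ) :
      2 * Real.cos θ * Real.sin ((y + 1) * θ) - Real.sin (y * θ) = Real.sin ((y + 2) * θ) := by
    have h₂ : (y + 2) * θ = (y + 1) * θ + θ := by ring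
    have h₀ : y * θ = (y + 1) * θ - θ := by ring
    rw [h₂, h₀, Real.sin_add, Real.sin_sub]
    ring
  induction k with
  | zero => simp
  | succ k ih =>
      rw [pow_succ', Module.End.mul_apply, ih, Module.End.mul_apply, add_comm (_ • root s),
        refl_left, M.symmetric t s, step, add_comm (_ • root t), refl_left, Nat.cast_succ,
        show x + 2 * ((k : ℝ) + 1) = x + 2 * k + 2 by ring,
        show x + 2 * (k : ℝ) + 2 + 1 = x + 2 * k + 1 + 2 by ring, ← step (x + 2 * k + 1),
        show x + 2 * (k : ℝ) + 1 + 1 = x + 2 * k + 2 by ring]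

theorem refl_mul_refl_pow (s t : B) : (refl M s * refl M t) ^ M s t = 1 := by
  rcases eq_or_ne s t with rfl | hst
  · rw [refl_mul_self, one_pow]
  rcases eq_or_ne (M s t) 0 with h0 | h0
  · rw [h0, pow_zero]
  have hm2 : 2 ≤ M s t := by
    have := M.off_diagonal s t hst
    omega
  have hs := sin_pi_div_pos hm2
  have hfix (x : ℝ) := refl_mul_refl_pow_sin M s t x (M s t)
  have hm' : (M s t : ℝ) ≠ 0 := by exact_mod_cast h0
  have period (y : ℝ) : Real.sin ((y + 2 * M s t) * (Real.pi / M s t)) =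
      Real.sin (y * (Real.pi / M s t)) := by
    rw [← Real.sin_add_two_pi (y * (Real.pi / M s t))]
    congr 1
    field_simp
  have hfix' (x : ℝ) : ((refl M s * refl M t) ^ M s t)
        (Real.sin ((x + 1) * (Real.pi / M s t)) • root s +
          Real.sin (x * (Real.pi / M s t)) • root t) =
      Real.sin ((x + 1) * (Real.pi / M s t)) • root s +
        Real.sin (x * (Real.pi / M s t)) • root t := by
    rw [hfix, period, show x + 2 * (M s t : ℝ) + 1 = (x + 1) + 2 * M s t by ring, period]
  have es : ((refl M s * refl M t) ^ M s t) (root s) = root s := by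
    have h := hfix' 0
    simp only [zero_add, one_mul, zero_mul, Real.sin_zero, zero_smul, add_zero, map_smul] at h
    exact smul_right_injective _ hs.ne' h
  have et : ((refl M s * refl M t) ^ M s t) (root t) = root t := by
    have h := hfix' (-1)
    simp only [neg_add_cancel, neg_mul, one_mul, zero_mul, Real.sin_zero, zero_smul, zero_add,
      Real.sin_neg, map_smul] at h
    exact smul_right_injective _ (neg_ne_zero.2 hs.ne') h
  have fixed (v : B →₀ ℝ) (h₁ : cosForm M (root s) v = 0) (h₂ : cosForm M (root t) v = 0) :
      ((refl M s * refl M t) ^ M s t) v = v := by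
    have : (refl M s * refl M t) v = v := by
      rw [Module.End.mul_apply, refl_apply M t, h₂, mul_zero, zero_smul, sub_zero, refl_apply, h₁,
        mul_zero, zero_smul, sub_zero]
    induction M s t with
    | zero => rfl
    | succ k ih => rw [pow_succ, Module.End.mul_apply, this, ih]
  refine LinearMap.ext fun v => ?_
  set κ := Real.cos (Real.pi / M s t) with hκ
  set p := cosForm M (root s) v with hp
  set q := cosForm M (root t) v with hq
  set d := 1 - κ ^ 2 with hd
  have hd0 : d ≠ 0 := by
    have := Real.sin_sq_add_cos_sq (Real.pi / M s t)
    have : d = Real.sin (Real.pi / M s t) ^ 2 := by rw [hd, hκ]; linarith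
    rw [this]
    positivity
  set a := (p + κ * q) / d with ha
  set b := (q + κ * p) / d with hb
  have hv : v = (v - (a • root s + b • root t)) + (a • root s + b • root t) := by abel
  have h₁ : cosForm M (root s) (v - (a • root s + b • root t)) = 0 := by
    rw [map_sub, map_add, map_smul, map_smul, cosForm_root_self, cosForm_root, ← hκ, ← hp, ha, hb]
    simp only [smul_eq_mul]
    field_simp
    rw [hd]
    ring
  have h₂ : cosForm M (root t) (v - (a • root s + b • root t)) = 0 := by
    rw [map_sub, map_add, map_smul, map_smul, cosForm_root_self, cosForm_root, M.symmetric, ← hκ,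
      ← hq, ha, hb]
    simp only [smul_eq_mul]
    field_simp
    rw [hd]
    ring
  rw [hv, map_add, fixed _ h₁ h₂, map_add, map_smul, map_smul, es, et, Module.End.one_apply]

/-- The geometric representation of the Coxeter group. -/
noncomputable def geomRep : M.Group →* Module.End ℝ (B →₀ ℝ) :=
  M.toCoxeterSystem.lift ⟨refl M, refl_mul_refl_pow M⟩

theorem geomRep_simple (s : B) : geomRep M (M.simple s) = refl M s :=
  M.toCoxeterSystem.lift_apply_simple (refl_mul_refl_pow M) s

theorem revAlt_refl_comm (s t : B) (hst : s ≠ t) (hm : M s t ≠ 0) :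
    revAlt (refl M) s t (M s t) = revAlt (refl M) t s (M s t) := by
  have key (x y : B) (n : ℕ) : ((geomRep M).comp (proj M)) (revAlt (gen M) x y n) =
      revAlt (refl M) x y n := by
    simp [map_revAlt, proj_gen, geomRep_simple]
  rw [← key, ← key, revAlt_gen_comm M s t hst hm]

theorem revAlt_simple_comm (s t : B) (hst : s ≠ t) (hm : M s t ≠ 0) :
    revAlt M.simple s t (M s t) = revAlt M.simple t s (M s t) := by
  have key (x y : B) (n : ℕ) : proj M (revAlt (gen M) x y n) = revAlt M.simple x y n := by
    simp [map_revAlt, proj_gen]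
  rw [← key, ← key, revAlt_gen_comm M s t hst hm]

theorem geomRep_inv_apply (w : M.Group) (v : B →₀ ℝ) : geomRep M w⁻¹ (geomRep M w v) = v := by
  rw [← Module.End.mul_apply, ← map_mul, inv_mul_cancel, map_one, Module.End.one_apply]

theorem geomRep_injective (w : M.Group) : Function.Injective (geomRep M w) :=
  Function.LeftInverse.injective (geomRep_inv_apply M w)

theorem cosForm_geomRep (w : M.Group) (u v : B →₀ ℝ) :
    cosForm M (geomRep M w u) (geomRep M w v) = cosForm M u v := by
  induction w using M.toCoxeterSystem.simple_induction_left with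
  | one => simp
  | mul_simple_left w i ih =>
      rw [M.toCoxeterSystem_simple, map_mul, geomRep_simple, Module.End.mul_apply,
        Module.End.mul_apply, cosForm_refl, ih]

/-- If `w` maps the simple root of `p` to that of `s`, then `w` conjugates the corresponding
reflections. -/
theorem geomRep_mul_refl (w : M.Group) {p s : B} (h : geomRep M w (root p) = root s) :
    geomRep M w * refl M p = refl M s * geomRep M w := by
  refine LinearMap.ext fun v => ?_
  rw [Module.End.mul_apply, Module.End.mul_apply, refl_apply, refl_apply, map_sub, map_smul, h,
    ← h, cosForm_geomRep]

end GeometricRepresentation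

section Positivity

variable (M : CoxeterMatrix B)

theorem length_revAlt_le (s t : B) (n : ℕ) :
    M.toCoxeterSystem.length (revAlt M.simple s t n) ≤ n := by
  induction n generalizing s t with
  | zero => simp [revAlt]
  | succ n ih =>
      refine (M.toCoxeterSystem.length_mul_le _ _).trans ?_
      rw [← M.toCoxeterSystem_simple, M.toCoxeterSystem.length_simple]
      exact Nat.succ_le_succ (ih t s)

theorem exists_revAlt_add (s t : B) (n k : ℕ) :
    ∃ u : M.Group, M.toCoxeterSystem.length u ≤ n ∧
      revAlt M.simple s t (n + k) = u * revAlt M.simple s t k := by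
  induction k generalizing s t with
  | zero => exact ⟨_, length_revAlt_le M s t n, by simp [revAlt]⟩
  | succ k ih =>
      obtain ⟨u, hu, h⟩ := ih t s
      exact ⟨u, hu, by rw [← add_assoc, revAlt, revAlt, h, mul_assoc]⟩

/-- A product of two roots with consecutive coefficients in `chebSeq` moves to nonnegative
combinations under alternating products of the two reflections. -/
theorem revAlt_refl_apply (s t : B) (k j : ℕ)
    (hc : ∀ i ≤ j + k + 1, 0 ≤ chebSeq (Real.cos (Real.pi / M s t)) i) :
    ∃ a b : ℝ, 0 ≤ a ∧ 0 ≤ b ∧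
      revAlt (refl M) t s k
        (chebSeq (Real.cos (Real.pi / M s t)) (j + 1) • root s +
          chebSeq (Real.cos (Real.pi / M s t)) j • root t) = a • root s + b • root t := by
  induction k generalizing s t j with
  | zero => exact ⟨_, _, hc (j + 1) (by omega), hc j (by omega), by simp [revAlt]⟩
  | succ k ih =>
      obtain ⟨a, b, ha, hb, h⟩ := ih t s (j + 1) (by
        intro i hi
        rw [M.symmetric]
        exact hc i (by omega))
      refine ⟨b, a, hb, ha, ?_⟩
      rw [M.symmetric t s] at h
      rw [revAlt, Module.End.mul_apply, add_comm (_ • root s), refl_left, M.symmetric t s,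
        ← chebSeq, h, add_comm]

/-- If `ℓ (w s) > ℓ w` then `w` maps the simple root of `s` to a positive root. -/
theorem geomRep_root_nonneg (w : M.Group) (s : B)
    (h : M.toCoxeterSystem.length w < M.toCoxeterSystem.length (w * M.simple s)) (i : B) :
    0 ≤ geomRep M w (root s) i := by
  classical
  induction hn : M.toCoxeterSystem.length w using Nat.strong_induction_on generalizing w s with
  | _ n ih =>
  subst hn
  set cs := M.toCoxeterSystem with hcs
  have length_ne (v : M.Group) (x : B) : cs.length (v * M.simple x) ≠ cs.length v :=
    cs.length_mul_simple_ne v x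
  rcases eq_or_ne w 1 with rfl | hw
  · rw [map_one, Module.End.one_apply, root, Finsupp.single_apply]
    split_ifs <;> norm_num
  obtain ⟨t, ht⟩ := cs.exists_rightDescent_of_ne_one hw
  have ht' : cs.length (w * M.simple t) + 1 = cs.length w := cs.isRightDescent_iff.1 ht
  have hts : s ≠ t := by
    rintro rfl
    omega
  let P : ℕ → Prop := fun k =>
    ∃ v : M.Group, w = v * revAlt M.simple t s k ∧ cs.length w = cs.length v + k
  have hP1 : P 1 := by
    refine ⟨w * M.simple t, ?_, ht'.symm⟩
    rw [revAlt, revAlt, one_mul, mul_assoc]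
    exact (cs.simple_mul_simple_cancel_right t).symm.trans (mul_assoc _ _ _)
  have hPle (k : ℕ) (hk : P k) : k ≤ cs.length w := by
    obtain ⟨v, -, hv⟩ := hk
    omega
  have hPm (k : ℕ) (hk : P k) : M s t = 0 ∨ k + 1 ≤ M s t := by
    by_contra! hcon
    obtain ⟨hm0, hkm⟩ := hcon
    obtain ⟨v, hv, hlen⟩ := hk
    obtain ⟨d, rfl⟩ : ∃ d, k = d + M s t := ⟨k - M s t, by omega⟩
    obtain ⟨u, hu, hdec⟩ := exists_revAlt_add M t s d (M s t)
    obtain ⟨m, hm⟩ : ∃ m, M s t = m + 1 := ⟨M s t - 1, by omega⟩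
    have hws : w * M.simple s = v * u * revAlt M.simple t s m := by
      rw [hv, hdec, ← revAlt_simple_comm M s t hts hm0, hm, revAlt]
      simp only [mul_assoc]
      rw [show M.simple s * M.simple s = 1 from cs.simple_mul_simple_self s, mul_one]
    have h₁ := cs.length_mul_le (v * u) (revAlt M.simple t s m)
    have h₂ := cs.length_mul_le v u
    have h₃ : cs.length (revAlt M.simple t s m) ≤ m := length_revAlt_le M t s m
    have hu' : cs.length u ≤ d := hu
    rw [← hws] at h₁
    omega
  set k := Nat.findGreatest P (cs.length w) with hkdef
  have hk1 : 1 ≤ k := Nat.le_findGreatest (hPle 1 hP1) hP1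
  have hPk : P k := Nat.findGreatest_spec (hPle 1 hP1) hP1
  have hmax : ¬ P (k + 1) := fun hP => by
    have := Nat.le_findGreatest (hPle _ hP) hP
    omega
  have hkm := hPm k hPk
  obtain ⟨v, hv, hlen⟩ := hPk
  have step (x : B) (n : ℕ) (hx : x = if Even n then t else s) :
      revAlt M.simple t s (n + 1) = M.simple x * revAlt M.simple t s n := by
    rw [hx, revAlt_succ_left]
  have cancel (x : B) (g : M.Group) : v * g = v * M.simple x * (M.simple x * g) := by
    rw [mul_assoc, show M.simple x * (M.simple x * g) = g from
      cs.simple_mul_simple_cancel_left x]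
  have hnext (x : B) (hx : x = if Even k then t else s) :
      cs.length v < cs.length (v * M.simple x) := by
    have h₁ : cs.length w ≠ cs.length (v * M.simple x) + (k + 1) := fun hl =>
      hmax ⟨v * M.simple x, by rw [step x k hx, ← cancel, ← hv], hl⟩
    have h₂ : cs.length (v * M.simple x) = cs.length v + 1 ∨
      cs.length (v * M.simple x) + 1 = cs.length v := cs.length_mul_simple v x
    omega
  have hprev (x : B) (hx : x = if Even (k - 1) then t else s) :
      cs.length v < cs.length (v * M.simple x) := by
    obtain ⟨l, hl⟩ : ∃ l, k = l + 1 := ⟨k - 1, by omega⟩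
    rw [hl, Nat.add_sub_cancel] at hx
    have hw' : w = v * M.simple x * revAlt M.simple t s l := by
      rw [hv, hl, step x l hx, mul_assoc]
    have h₁ := cs.length_mul_le (v * M.simple x) (revAlt M.simple t s l)
    have h₂ : cs.length (revAlt M.simple t s l) ≤ l := length_revAlt_le M t s l
    rw [← hw'] at h₁
    have h₃ := length_ne v x
    omega
  have hboth : cs.length v < cs.length (v * M.simple s) ∧
      cs.length v < cs.length (v * M.simple t) := by
    rcases Nat.even_or_odd k with he | ho
    · have ho : ¬ Even (k - 1) := by
        rw [Nat.even_sub hk1]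
        simp [he]
      exact ⟨hprev s (by rw [if_neg ho]), hnext t (by rw [if_pos he])⟩
    · have he : Even (k - 1) := by
        rw [Nat.even_sub hk1]
        simpa using ho
      exact ⟨hnext s (by rw [if_neg (Nat.not_even_iff_odd.2 ho)]), hprev t (by rw [if_pos he])⟩
  have hs := ih _ (by omega) v s hboth.1 rfl
  have ht := ih _ (by omega) v t hboth.2 rfl
  obtain ⟨a, b, ha, hb, hab⟩ := revAlt_refl_apply M s t k 0 fun i hi =>
    chebSeq_nonneg (M.off_diagonal s t hts) (by omega)
  have hrev : geomRep M (revAlt M.simple t s k) = revAlt (refl M) t s k := by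
    simp [map_revAlt, geomRep_simple]
  simp only [chebSeq, one_smul, zero_smul, add_zero] at hab
  rw [hv, map_mul, Module.End.mul_apply, hrev, hab, map_add, map_smul, map_smul]
  simp only [Finsupp.add_apply, Finsupp.smul_apply, smul_eq_mul]
  positivity

/-- Every root is positive or negative. -/
theorem geomRep_root_nonneg_or_nonpos (w : M.Group) (s : B) :
    (∀ i, 0 ≤ geomRep M w (root s) i) ∨ ∀ i, geomRep M w (root s) i ≤ 0 := by
  rcases M.toCoxeterSystem.length_mul_simple w s with h | h
  · exact Or.inl (geomRep_root_nonneg M w s (by rw [← M.toCoxeterSystem_simple]; omega))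
  · refine Or.inr fun i => ?_
    have h' := geomRep_root_nonneg M (w * M.simple s) s (by
      rw [← M.toCoxeterSystem_simple, M.toCoxeterSystem.simple_mul_simple_cancel_right]
      omega) i
    rw [map_mul, geomRep_simple, Module.End.mul_apply, refl_root_self, map_neg,
      Finsupp.neg_apply] at h'
    linarith

/-- The reflection in `s` permutes the positive roots other than the simple root of `s`. -/
theorem refl_geomRep_root_nonneg (w : M.Group) {p s : B}
    (h : ∀ i, 0 ≤ geomRep M w (root p) i) (hne : geomRep M w (root p) ≠ root s) (i : B) :
    0 ≤ refl M s (geomRep M w (root p)) i := by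
  classical
  have hw : refl M s (geomRep M w (root p)) = geomRep M (M.simple s * w) (root p) := by
    rw [map_mul, geomRep_simple, Module.End.mul_apply]
  rcases geomRep_root_nonneg_or_nonpos M (M.simple s * w) p with h' | h'
  · rw [hw]
    exact h' i
  exfalso
  set v := geomRep M w (root p) with hv
  have hsupp (j : B) (hj : j ≠ s) : v j = 0 := by
    have hj' := h' j
    rw [← hw, refl_apply] at hj'
    simp only [root, Finsupp.sub_apply, Finsupp.smul_apply, Finsupp.single_apply, if_neg hj.symm,
      smul_zero, sub_zero] at hj'
    exact le_antisymm hj' (h j)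
  have hvs : v = v s • root s := by
    ext j
    rcases eq_or_ne j s with rfl | hj
    · simp [root]
    · rw [hsupp j hj]
      simp [root, hj]
  have hnorm : cosForm M v v = 1 := by
    rw [hv, cosForm_geomRep, cosForm_root_self]
  rw [hvs] at hnorm
  simp only [map_smul, LinearMap.smul_apply, smul_eq_mul, cosForm_root_self, mul_one] at hnorm
  have h1 : v s = 1 := by nlinarith [h s]
  rw [h1, one_smul] at hvs
  exact hne hvs

/-- If `w` sends two simple roots to positive combinations of `e_s` and `e_t`,
then it sends them to `e_s` and `e_t` themselves. -/
theorem geomRep_root_pair (w : M.Group) {p q s t : B} (hpq : p ≠ q)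
    {a b c d : ℝ} (ha : 0 ≤ a) (hb : 0 ≤ b) (hc : 0 ≤ c) (hd : 0 ≤ d)
    (hp : geomRep M w (root p) = a • root s + b • root t)
    (hq : geomRep M w (root q) = c • root s + d • root t) :
    geomRep M w (root p) = root s ∧ geomRep M w (root q) = root t ∨
      geomRep M w (root p) = root t ∧ geomRep M w (root q) = root s := by
  classical
  have norm_one {x : ℝ} {u r : B} (hx : 0 ≤ x) (h : geomRep M w (root u) = x • root r) :
      geomRep M w (root u) = root r := by
    have hnorm : cosForm M (geomRep M w (root u)) (geomRep M w (root u)) = 1 := by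
      rw [cosForm_geomRep, cosForm_root_self]
    rw [h] at hnorm
    simp only [map_smul, LinearMap.smul_apply, smul_eq_mul, cosForm_root_self, mul_one] at hnorm
    rw [h, show x = 1 by nlinarith, one_smul]
  have ne_zero (u : B) : geomRep M w (root u) ≠ 0 := fun h =>
    root_ne_zero u (geomRep_injective M w (h.trans (map_zero _).symm))
  have sign {x y D : ℝ} {r : B} (hx : 0 ≤ x) (hy : 0 ≤ y)
      (h : x • geomRep M w (root p) - y • geomRep M w (root q) = D • root r) : x * y = 0 := by
    have h' : x • root p - y • root q = D • geomRep M w⁻¹ (root r) := by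
      apply geomRep_injective M w
      rw [map_sub, map_smul, map_smul, map_smul, h]
      congr 1
      have := geomRep_inv_apply M w⁻¹ (root r)
      rwa [inv_inv, eq_comm] at this
    have hp' := DFunLike.congr_fun h' p
    have hq' := DFunLike.congr_fun h' q
    have hpr (u r : B) : root u r = if u = r then (1 : ℝ) else 0 := Finsupp.single_apply
    simp only [Finsupp.sub_apply, Finsupp.smul_apply, hpr, if_true,
      if_neg hpq, if_neg hpq.symm, smul_eq_mul, mul_one, mul_zero, sub_zero, zero_sub] at hp' hq'
    have hsign : 0 ≤ geomRep M w⁻¹ (root r) p * geomRep M w⁻¹ (root r) q := by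
      rcases geomRep_root_nonneg_or_nonpos M w⁻¹ r with h₁ | h₁
      · exact mul_nonneg (h₁ p) (h₁ q)
      · exact mul_nonneg_of_nonpos_of_nonpos (h₁ p) (h₁ q)
    have hxy : x * y = -(D ^ 2 * (geomRep M w⁻¹ (root r) p * geomRep M w⁻¹ (root r) q)) := by
      linear_combination y * hp' - D * geomRep M w⁻¹ (root r) p * hq'
    have := mul_nonneg (sq_nonneg D) hsign
    have := mul_nonneg hx hy
    linarith
  have hdb : d * b = 0 := sign hd hb (D := a * d - b * c) (r := s) (by rw [hp, hq]; module)
  have hca : c * a = 0 := sign hc ha (D := b * c - a * d) (r := t) (by rw [hp, hq]; module)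
  have hp0 : ¬ (a = 0 ∧ b = 0) := by
    rintro ⟨rfl, rfl⟩
    exact ne_zero p (by simpa using hp)
  have hq0 : ¬ (c = 0 ∧ d = 0) := by
    rintro ⟨rfl, rfl⟩
    exact ne_zero q (by simpa using hq)
  rcases mul_eq_zero.1 hdb with rfl | rfl
  · obtain rfl : a = 0 := (mul_eq_zero.1 hca).resolve_left (by tauto)
    exact Or.inr ⟨norm_one hb (by simpa using hp), norm_one hc (by simpa using hq)⟩
  · obtain rfl : c = 0 := (mul_eq_zero.1 hca).resolve_right (by tauto)
    exact Or.inl ⟨norm_one ha (by simpa using hp), norm_one hd (by simpa using hq)⟩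

end Positivity

section Retraction

variable (M : CoxeterMatrix B) (Y : Set B)

/-- The elements of the Coxeter group, viewed in the geometric representation, that keep the
simple roots of `Y` positive. They represent the cosets modulo the standard parabolic subgroup
of `Y`. -/
abbrev PosMap : Type _ :=
  { f : Module.End ℝ (B →₀ ℝ) //
    (∃ w, f = geomRep M w) ∧ ∀ p ∈ Y, ∀ i, 0 ≤ f (root p) i }

variable {M Y}

namespace PosMap

theorem apply_injective (f : PosMap M Y) : Function.Injective f.1 := by
  obtain ⟨w, hw⟩ := f.2.1
  rw [hw]
  exact geomRep_injective M w

theorem root_inj (f : PosMap M Y) {p q : B} (h : f.1 (root p) = f.1 (root q)) : p = q :=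
  root_injective (f.apply_injective h)

theorem mul_refl (f : PosMap M Y) {p s : B} (h : f.1 (root p) = root s) :
    f.1 * refl M p = refl M s * f.1 := by
  obtain ⟨w, hw⟩ := f.2.1
  rw [hw] at h ⊢
  exact geomRep_mul_refl M w h

/-- Left multiplication by the reflection in `s`, as long as it preserves positivity. -/
noncomputable def reflect (f : PosMap M Y) (s : B)
    (h : ∀ p ∈ Y, f.1 (root p) ≠ root s) : PosMap M Y :=
  ⟨refl M s * f.1, by
    obtain ⟨⟨w, hw⟩, hpos⟩ := f.2
    refine ⟨⟨M.simple s * w, by rw [map_mul, geomRep_simple, hw]⟩, fun p hp i => ?_⟩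
    have hne := h p hp
    have hp' := hpos p hp
    rw [hw] at hne hp' ⊢
    exact refl_geomRep_root_nonneg M w hp' hne i⟩

theorem reflect_ne (f : PosMap M Y) (s : B) (h : ∀ p ∈ Y, f.1 (root p) ≠ root s) :
    ∀ p ∈ Y, (f.reflect s h).1 (root p) ≠ root s := by
  intro p hp hs
  have hs' : f.1 (root p) = -root s := by
    rw [← refl_root_self M, ← hs]
    exact (refl_refl M s _).symm
  have hpos := f.2.2 p hp s
  rw [hs'] at hpos
  simp [root] at hpos
  linarith

theorem reflect_reflect (f : PosMap M Y) (s : B) (h : ∀ p ∈ Y, f.1 (root p) ≠ root s)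
    (h' : ∀ p ∈ Y, (f.reflect s h).1 (root p) ≠ root s) : (f.reflect s h).reflect s h' = f := by
  refine Subtype.ext ?_
  change refl M s * (refl M s * f.1) = f.1
  rw [← mul_assoc, refl_mul_self, one_mul]

/-- The identity preserves positivity. -/
noncomputable def id : PosMap M Y :=
  ⟨1, ⟨1, (map_one _).symm⟩, fun p _ i => by
    classical
    rw [Module.End.one_apply, root, Finsupp.single_apply]
    split_ifs <;> norm_num⟩

end PosMap

variable (M Y) in
open Classical in
/-- The action of the generator `s` of the Artin-Tits group on pairs `(f, b)`: if `f` sends the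
simple root of `p ∈ Y` to that of `s`, then `b` is multiplied by `p`; otherwise `f` is reflected
in `s`. -/
noncomputable def step (s : B) : Equiv.Perm (PosMap M Y × Artin M) where
  toFun x :=
    if h : ∃ p ∈ Y, x.1.1 (root p) = root s then (x.1, gen M h.choose * x.2)
    else (x.1.reflect s fun p hp hs => h ⟨p, hp, hs⟩, x.2)
  invFun x :=
    if h : ∃ p ∈ Y, x.1.1 (root p) = root s then (x.1, (gen M h.choose)⁻¹ * x.2)
    else (x.1.reflect s fun p hp hs => h ⟨p, hp, hs⟩, x.2)
  left_inv x := by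
    by_cases h : ∃ p ∈ Y, x.1.1 (root p) = root s
    · simp [h]
    · have h' : ∀ p ∈ Y, x.1.1 (root p) ≠ root s := fun p hp hs => h ⟨p, hp, hs⟩
      have hne := x.1.reflect_ne s h'
      simp only [dif_neg h]
      exact (dif_neg fun ⟨p, hp, hs⟩ => hne p hp hs).trans
        (Prod.ext (x.1.reflect_reflect s h' hne) rfl)
  right_inv x := by
    by_cases h : ∃ p ∈ Y, x.1.1 (root p) = root s
    · simp [h]
    · have h' : ∀ p ∈ Y, x.1.1 (root p) ≠ root s := fun p hp hs => h ⟨p, hp, hs⟩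
      have hne := x.1.reflect_ne s h'
      simp only [dif_neg h]
      exact (dif_neg fun ⟨p, hp, hs⟩ => hne p hp hs).trans
        (Prod.ext (x.1.reflect_reflect s h' hne) rfl)

theorem step_of_root {p s : B} (hp : p ∈ Y) (x : PosMap M Y × Artin M)
    (h : x.1.1 (root p) = root s) : step M Y s x = (x.1, gen M p * x.2) := by
  have hex : ∃ p ∈ Y, x.1.1 (root p) = root s := ⟨p, hp, h⟩
  have hc : hex.choose = p := x.1.root_inj (hex.choose_spec.2.trans h.symm)
  exact (dif_pos hex).trans (by rw [hc])

theorem step_of_forall_ne {s : B} (x : PosMap M Y × Artin M)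
    (h : ∀ p ∈ Y, x.1.1 (root p) ≠ root s) :
    (step M Y s x).1.1 = refl M s * x.1.1 ∧ (step M Y s x).2 = x.2 := by
  have hstep : step M Y s x = (x.1.reflect s h, x.2) := dif_neg fun ⟨p, hp, hs⟩ => h p hp hs
  rw [hstep]
  exact ⟨rfl, rfl⟩

variable (M) in
/-- The `k`-th positive root of the dihedral system of `s` and `t`, starting from the simple
root of `s`. -/
noncomputable def dihedralRoot (s t : B) (k : ℕ) : B →₀ ℝ :=
  chebSeq (Real.cos (Real.pi / M s t)) (k + 1) • root s +
    chebSeq (Real.cos (Real.pi / M s t)) k • root t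

theorem dihedralRoot_zero (s t : B) : dihedralRoot M s t 0 = root s := by
  simp [dihedralRoot, chebSeq]

theorem refl_dihedralRoot (s t : B) (k : ℕ) :
    refl M s (dihedralRoot M t s k) = dihedralRoot M s t (k + 1) := by
  rw [dihedralRoot, add_comm, refl_left, M.symmetric t s, dihedralRoot, chebSeq]

theorem dihedralRoot_eq_comm {s t : B} {k l : ℕ} (hst : s ≠ t) (h : M s t = k + l + 1) :
    dihedralRoot M s t k = dihedralRoot M t s l := by
  have hm : 2 ≤ M s t := by
    have := M.off_diagonal s t hst
    omega
  rw [dihedralRoot, dihedralRoot, M.symmetric t s, add_comm,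
    ← chebSeq_sub hm (by omega : k ≤ M s t), ← chebSeq_sub hm (by omega : k + 1 ≤ M s t),
    show M s t - k = l + 1 by omega, show M s t - (k + 1) = l by omega]

theorem dihedralRoot_ne_root {s t : B} {k : ℕ} (hst : s ≠ t) (h : k + 1 < M s t) :
    dihedralRoot M s t (k + 1) ≠ root s ∧ dihedralRoot M s t k ≠ root t := by
  classical
  have hpos (j : ℕ) (hj : 0 < j) (hjm : j < M s t) := (chebSeq_pos hj hjm).ne'
  refine ⟨fun hk => hpos (k + 1) (by omega) h ?_, fun hk => hpos (k + 1) (by omega) h ?_⟩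
  · simpa [dihedralRoot, root, hst, hst.symm] using DFunLike.congr_fun hk t
  · simpa [dihedralRoot, root, hst, hst.symm] using DFunLike.congr_fun hk s

theorem revAlt_step_of_forall_ne (s t : B) (n : ℕ) (x : PosMap M Y × Artin M)
    (h : ∀ k < n, ∀ p ∈ Y, x.1.1 (root p) ≠ dihedralRoot M s t k) :
    (revAlt (step M Y) s t n x).1.1 = revAlt (refl M) s t n * x.1.1 ∧
      (revAlt (step M Y) s t n x).2 = x.2 := by
  induction n generalizing s t x with
  | zero => simp [revAlt]
  | succ n ih =>
      obtain ⟨h₁, h₂⟩ := step_of_forall_ne (s := s) x fun p hp => by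
        rw [← dihedralRoot_zero (M := M) s t]
        exact h 0 (by omega) p hp
      obtain ⟨h₃, h₄⟩ := ih t s (step M Y s x) fun k hk p hp hroot => by
        refine h (k + 1) (by omega) p hp ?_
        rw [← refl_dihedralRoot, ← hroot, h₁, Module.End.mul_apply, refl_refl]
      rw [revAlt, Equiv.Perm.mul_apply, h₃, h₄, h₁, h₂, revAlt, mul_assoc]
      exact ⟨rfl, rfl⟩

theorem revAlt_step_of_unique {s t p : B} (hst : s ≠ t) (hp : p ∈ Y) (k l : ℕ)
    (hkl : k + l < M s t) (x : PosMap M Y × Artin M)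
    (hx : x.1.1 (root p) = dihedralRoot M s t k)
    (huniq : ∀ q ∈ Y, ∀ a b : ℝ, x.1.1 (root q) = a • root s + b • root t → q = p) :
    (revAlt (step M Y) s t (k + l + 1) x).1.1 * refl M p =
        revAlt (refl M) s t (k + l + 1) * x.1.1 ∧
      (revAlt (step M Y) s t (k + l + 1) x).2 = gen M p * x.2 := by
  induction k generalizing s t x with
  | zero =>
      rw [dihedralRoot_zero] at hx
      obtain ⟨h₁, h₂⟩ := revAlt_step_of_forall_ne t s l (x.1, gen M p * x.2)
        fun j hj q hq hroot => by
          obtain rfl := huniq q hq _ _ (hroot.trans (add_comm _ _))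
          refine (dihedralRoot_ne_root (M := M) (k := j) hst.symm ?_).2 (hroot.symm.trans hx)
          rw [M.symmetric]
          omega
      rw [zero_add, revAlt, Equiv.Perm.mul_apply, step_of_root hp x hx, h₁, h₂, revAlt,
        mul_assoc, x.1.mul_refl hx, mul_assoc]
      exact ⟨rfl, rfl⟩
  | succ k ih =>
      obtain ⟨h₁, h₂⟩ := step_of_forall_ne (s := s) x fun q hq hroot => by
        obtain rfl := huniq q hq 1 0 (by simpa using hroot)
        exact (dihedralRoot_ne_root hst (by omega)).1 (hx.symm.trans hroot)
      obtain ⟨h₃, h₄⟩ := ih hst.symm (by rw [M.symmetric]; omega) (step M Y s x)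
        (by rw [h₁, Module.End.mul_apply, hx, ← refl_dihedralRoot, refl_refl])
        fun q hq a b hroot => by
          rw [h₁, Module.End.mul_apply, add_comm] at hroot
          refine huniq q hq (2 * Real.cos (Real.pi / M s t) * a - b) a ?_
          rw [← refl_left, ← hroot, refl_refl]
      rw [show k + 1 + l + 1 = k + l + 1 + 1 by ring, revAlt, Equiv.Perm.mul_apply, h₃, h₄, h₁,
        h₂, revAlt, mul_assoc]
      exact ⟨rfl, rfl⟩

theorem revAlt_step_of_pair {s t p q : B} (hp : p ∈ Y) (hq : q ∈ Y) (n : ℕ)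
    (x : PosMap M Y × Artin M) (hs : x.1.1 (root p) = root s) (ht : x.1.1 (root q) = root t) :
    revAlt (step M Y) s t n x = (x.1, revAlt (gen M) p q n * x.2) := by
  induction n generalizing s t p q x with
  | zero => simp [revAlt]
  | succ n ih =>
      rw [revAlt, Equiv.Perm.mul_apply, step_of_root hp x hs,
        ih hq hp (x.1, gen M p * x.2) ht hs, revAlt, mul_assoc]

theorem revAlt_step_comm_of_pair {s t p q : B} (hst : s ≠ t) (hm : M s t ≠ 0) (hp : p ∈ Y)
    (hq : q ∈ Y) (x : PosMap M Y × Artin M) (hs : x.1.1 (root p) = root s)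
    (ht : x.1.1 (root q) = root t) :
    revAlt (step M Y) s t (M s t) x = revAlt (step M Y) t s (M s t) x := by
  have hpq : p ≠ q := by
    rintro rfl
    exact hst (root_injective (hs.symm.trans ht))
  have hM : M s t = M p q := by
    obtain ⟨w, hw⟩ := x.1.2.1
    apply cos_pi_div_injective
    rw [← neg_inj, ← cosForm_root, ← cosForm_root, ← hs, ← ht, hw, cosForm_geomRep]
  rw [revAlt_step_of_pair hp hq _ x hs ht, revAlt_step_of_pair hq hp _ x ht hs, hM,
    revAlt_gen_comm M p q hpq (hM ▸ hm)]

theorem revAlt_step_comm (s t : B) (hst : s ≠ t) (hm : M s t ≠ 0) :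
    revAlt (step M Y) s t (M s t) = revAlt (step M Y) t s (M s t) := by
  classical
  refine Equiv.ext fun x => ?_
  by_cases hne : ∀ k < M s t, ∀ p ∈ Y, x.1.1 (root p) ≠ dihedralRoot M s t k
  · obtain ⟨h₁, h₂⟩ := revAlt_step_of_forall_ne s t (M s t) x hne
    obtain ⟨h₃, h₄⟩ := revAlt_step_of_forall_ne t s (M s t) x fun k hk p hp => by
      rw [← dihedralRoot_eq_comm hst (k := M s t - 1 - k) (by omega)]
      exact hne _ (by omega) p hp
    refine Prod.ext (Subtype.ext ?_) (h₂.trans h₄.symm)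
    rw [h₁, h₃, revAlt_refl_comm M s t hst hm]
  push Not at hne
  obtain ⟨k, hk, p, hp, hroot⟩ := hne
  obtain ⟨l, hl⟩ : ∃ l, M s t = k + l + 1 := ⟨M s t - 1 - k, by omega⟩
  by_cases huniq : ∀ q ∈ Y, ∀ a b : ℝ, x.1.1 (root q) = a • root s + b • root t → q = p
  · obtain ⟨h₁, h₂⟩ := revAlt_step_of_unique hst hp k l (by omega) x hroot huniq
    obtain ⟨h₃, h₄⟩ := revAlt_step_of_unique hst.symm hp l k (by rw [M.symmetric]; omega) x
      (hroot.trans (dihedralRoot_eq_comm hst hl))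
      fun q hq a b h => huniq q hq b a (h.trans (add_comm _ _))
    rw [← hl] at h₁ h₂
    rw [show l + k + 1 = M s t by omega] at h₃ h₄
    refine Prod.ext (Subtype.ext ?_) (h₂.trans h₄.symm)
    rw [← revAlt_refl_comm M s t hst hm, ← h₁] at h₃
    have h := congrArg (· * refl M p) h₃
    simpa [mul_assoc, refl_mul_self] using h.symm
  push Not at huniq
  obtain ⟨q, hq, a, b, hroot', hqp⟩ := huniq
  obtain ⟨w, hw⟩ := x.1.2.1
  have nonneg (u : B) (hu : u ∈ Y) (c d : ℝ)
      (h : x.1.1 (root u) = c • root s + d • root t) : 0 ≤ c ∧ 0 ≤ d := by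
    have hpos := x.1.2.2 u hu
    rw [h] at hpos
    exact ⟨by simpa [root, hst, hst.symm] using hpos s,
      by simpa [root, hst, hst.symm] using hpos t⟩
  obtain ⟨ha, hb⟩ := nonneg p hp _ _ hroot
  obtain ⟨hc, hd⟩ := nonneg q hq _ _ hroot'
  have hpair := geomRep_root_pair M w (Ne.symm hqp) ha hb hc hd (hw ▸ hroot) (hw ▸ hroot')
  rw [← hw] at hpair
  rcases hpair with ⟨hs, ht⟩ | ⟨ht, hs⟩
  · exact revAlt_step_comm_of_pair hst hm hp hq x hs ht
  · exact revAlt_step_comm_of_pair hst hm hq hp x hs ht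

variable (M Y) in
/-- The action of the Artin-Tits group on `PosMap M Y × Artin M`. -/
noncomputable def stepHom : Artin M →* Equiv.Perm (PosMap M Y × Artin M) :=
  PresentedGroup.toGroup (f := step M Y) (rels := braidRels M) <| by
    rintro r ⟨s, t, hst, hm, rfl⟩
    rw [map_mul, map_inv, map_list_prod, map_list_prod, List.map_map, List.map_map,
      mul_inv_eq_one]
    simpa [Function.comp_def] using
      (revAlt_comm_iff (step M Y) s t (M s t)).1 (revAlt_step_comm s t hst hm)

theorem stepHom_gen (s : B) : stepHom M Y (gen M s) = step M Y s :=
  PresentedGroup.toGroup.of _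

theorem closure_range_gen : Subgroup.closure (Set.range (gen M)) = ⊤ :=
  PresentedGroup.closure_range_of _

theorem step_cases (s : B) (x : PosMap M Y × Artin M) :
    (∃ p ∈ Y, x.1.1 (root p) = root s ∧ step M Y s x = (x.1, gen M p * x.2)) ∨
      ∃ h, step M Y s x = (x.1.reflect s h, x.2) := by
  by_cases h : ∃ p ∈ Y, x.1.1 (root p) = root s
  · obtain ⟨p, hp, hroot⟩ := h
    exact Or.inl ⟨p, hp, hroot, step_of_root hp x hroot⟩
  · exact Or.inr ⟨fun p hp hs => h ⟨p, hp, hs⟩, dif_neg h⟩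

theorem stepHom_mul_right (g : Artin M) (x : PosMap M Y × Artin M) (h : Artin M) :
    stepHom M Y g (x.1, x.2 * h) = ((stepHom M Y g x).1, (stepHom M Y g x).2 * h) := by
  have hg : g ∈ Subgroup.closure (Set.range (gen M)) := by rw [closure_range_gen]; trivial
  induction hg using Subgroup.closure_induction generalizing x with
  | mem g hg =>
      obtain ⟨s, rfl⟩ := hg
      rw [stepHom_gen]
      rcases step_cases s x with ⟨p, hp, hroot, hstep⟩ | ⟨hne, hstep⟩
      · rw [hstep, step_of_root hp (x.1, x.2 * h) hroot, mul_assoc]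
      · rw [hstep]
        exact dif_neg fun ⟨p, hp, hs⟩ => hne p hp hs
  | one => simp
  | mul g₁ g₂ _ _ ih₁ ih₂ =>
      rw [map_mul, Equiv.Perm.mul_apply, Equiv.Perm.mul_apply, ih₂, ih₁]
  | inv g _ ih =>
      have := ih (stepHom M Y g⁻¹ x)
      rw [map_inv, Equiv.Perm.inv_def, Equiv.apply_symm_apply] at this
      rw [map_inv, Equiv.Perm.inv_eq_iff_eq, Equiv.Perm.inv_def, this]

theorem stepHom_snd_mem_iff (g : Artin M) (x : PosMap M Y × Artin M) :
    (stepHom M Y g x).2 ∈ stdSub M Y ↔ x.2 ∈ stdSub M Y := by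
  have hg : g ∈ Subgroup.closure (Set.range (gen M)) := by rw [closure_range_gen]; trivial
  induction hg using Subgroup.closure_induction generalizing x with
  | mem g hg =>
      obtain ⟨s, rfl⟩ := hg
      rw [stepHom_gen]
      rcases step_cases s x with ⟨p, hp, -, hstep⟩ | ⟨hne, hstep⟩
      · rw [hstep]
        exact Subgroup.mul_mem_cancel_left _ (Subgroup.subset_closure ⟨p, hp, rfl⟩)
      · rw [hstep]
  | one => simp
  | mul g₁ g₂ _ _ ih₁ ih₂ =>
      rw [map_mul, Equiv.Perm.mul_apply]
      exact (ih₁ _).trans (ih₂ _)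
  | inv g _ ih =>
      have := ih (stepHom M Y g⁻¹ x)
      rw [map_inv, Equiv.Perm.inv_def, Equiv.apply_symm_apply] at this
      rw [map_inv, Equiv.Perm.inv_def]
      exact this.symm

theorem stepHom_id {h : Artin M} (hh : h ∈ stdSub M Y) (b : Artin M) :
    stepHom M Y h (PosMap.id, b) = (PosMap.id, h * b) := by
  induction hh using Subgroup.closure_induction generalizing b with
  | mem g hg =>
      obtain ⟨p, hp, rfl⟩ := hg
      rw [stepHom_gen]
      exact step_of_root hp _ rfl
  | one => simp
  | mul g₁ g₂ _ _ ih₁ ih₂ => rw [map_mul, Equiv.Perm.mul_apply, ih₂, ih₁, mul_assoc]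
  | inv g _ ih => rw [map_inv, Equiv.Perm.inv_eq_iff_eq, ih, mul_inv_cancel_left]

/-- If `g * s * g⁻¹` lies in a standard parabolic subgroup, then it is conjugate there to a
generator, by the element into which `g⁻¹` moves the base point. -/
theorem exists_gen_conj {g : Artin M} {s : B} (h : g * gen M s * g⁻¹ ∈ stdSub M Y) :
    ∃ p ∈ Y, (stepHom M Y g⁻¹ (PosMap.id, 1)).1.1 (root p) = root s ∧
      g * gen M s * g⁻¹ = (stepHom M Y g⁻¹ (PosMap.id, 1)).2⁻¹ * gen M p *
        (stepHom M Y g⁻¹ (PosMap.id, 1)).2 := by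
  set x := stepHom M Y g⁻¹ (PosMap.id, 1) with hx
  have key : step M Y s x = (x.1, x.2 * (g * gen M s * g⁻¹)) := by
    have hmul := stepHom_mul_right g⁻¹ (PosMap.id (Y := Y), 1) (g * gen M s * g⁻¹)
    rw [one_mul, ← hx] at hmul
    rw [← hmul, ← stepHom_gen, hx, ← Equiv.Perm.mul_apply, ← map_mul,
      show gen M s * g⁻¹ = g⁻¹ * (g * gen M s * g⁻¹) by group, map_mul, Equiv.Perm.mul_apply,
      stepHom_id h, mul_one]
  rcases step_cases s x with ⟨p, hp, hroot, hstep⟩ | ⟨hne, hstep⟩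
  · refine ⟨p, hp, hroot, ?_⟩
    have := (Prod.ext_iff.1 (hstep.symm.trans key)).2
    dsimp only at this
    rw [mul_assoc _ (gen M p), this, inv_mul_cancel_left]
  · have hfix : refl M s * x.1.1 = x.1.1 :=
      congrArg Subtype.val (Prod.ext_iff.1 (hstep.symm.trans key)).1
    obtain ⟨w, hw⟩ := x.1.2.1
    have hs := LinearMap.congr_fun hfix (geomRep M w⁻¹ (root s))
    have hinv : geomRep M w (geomRep M w⁻¹ (root s)) = root s := by
      simpa only [inv_inv] using geomRep_inv_apply M w⁻¹ (root s)
    rw [Module.End.mul_apply, hw, hinv, refl_root_self] at hs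
    exact absurd (self_eq_neg.1 hs.symm) (root_ne_zero s)

end Retraction

/-- **Theorem 2 (Godelle).** In a spherical-type Artin-Tits system, a parabolic subgroup
`gA_Xg⁻¹` contained in a standard parabolic `A_Y` is a parabolic subgroup of `A_Y`. -/
theorem parabolic_subgroup_of_standard_parabolic
    [Finite B] (M : CoxeterMatrix B) (hsph : Finite M.Group) (X Y : Set B) (g : Artin M)
    (hsub : (stdSub M X).map (MulAut.conj g).toMonoidHom ≤ stdSub M Y) :
    ∃ R ⊆ Y, ∃ y ∈ stdSub M Y,
      (stdSub M X).map (MulAut.conj g).toMonoidHom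
        = (stdSub M R).map (MulAut.conj y).toMonoidHom := by
  set x := stepHom M Y g⁻¹ (PosMap.id, 1) with hx
  have hmem (s : B) (hs : s ∈ X) : g * gen M s * g⁻¹ ∈ stdSub M Y :=
    hsub ⟨gen M s, Subgroup.subset_closure ⟨s, hs, rfl⟩, by simp⟩
  refine ⟨{p ∈ Y | ∃ s ∈ X, x.1.1 (root p) = root s}, fun p hp => hp.1, x.2⁻¹,
    inv_mem ((stepHom_snd_mem_iff _ _).2 (one_mem _)), ?_⟩
  rw [stdSub, stdSub, MonoidHom.map_closure, MonoidHom.map_closure]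
  congr 1
  ext h
  simp only [Set.mem_image, exists_exists_and_eq_and, Set.mem_ofPred_eq, MulEquiv.coe_toMonoidHom,
    MulAut.conj_apply, inv_inv]
  constructor
  · rintro ⟨s, hs, rfl⟩
    obtain ⟨p, hp, hroot, heq⟩ := exists_gen_conj (hmem s hs)
    exact ⟨p, ⟨hp, s, hs, hroot⟩, heq.symm⟩
  · rintro ⟨p, ⟨-, s, hs, hroot⟩, rfl⟩
    obtain ⟨q, -, hroot', heq⟩ := exists_gen_conj (hmem s hs)
    obtain rfl := x.1.root_inj (hroot.trans hroot'.symm)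
    exact ⟨s, hs, heq⟩

end ArtinTitsPaper
end

section
/- Let (A_S,S) be an Artin-Tits system of spherical type, X,Y ⊆ S, k ∈ ℤ∖{0} and g ∈ A_S. The following are equivalent: (1) gA_Xg⁻¹ ⊆ A_Y; (2) gΔ_X^k g⁻¹ ∈ A_Y; (3) g = yx with y ∈ A_Y and x ∈ Conj(S;X,R) for some subset R ⊆ Y. -/
/-!
Common definitions for formalizing "Normalisateur des sous-groupes paraboliques
des groupes d'Artin-Tits" (E. Godelle).

We fix a Coxeter matrix `M` over a finite index set `B` (Mathlib's convention:
`M s t = 0` encodes `m_{s,t} = ∞`).  The Artin-Tits group `Artin M` is the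
presented group on the braid relations, the Coxeter group is Mathlib's
`M.Group`, and `proj : Artin M →* M.Group` is the canonical projection
(adding the relations `s² = 1`).
-/

namespace ArtinTitsPaper

open List

variable {B : Type*}

section Coxeter

variable {W : Type*} [Group W] {M : CoxeterMatrix B} (cs : CoxeterSystem M W)

open CoxeterSystem

open scoped Classical in
/-- The action of a simple reflection on pairs (group element, parity). -/
noncomputable def parityStep (i : B) : Function.End (W × ZMod 2) :=
  fun p => (cs.simple i * p.1 * cs.simple i, p.2 + if p.1 = cs.simple i then 1 else 0)

open scoped Classical in
theorem prod_parityStep (ω : List B) (p : W × ZMod 2) :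
    (ω.map (parityStep cs)).prod p =
      (cs.wordProd ω * p.1 * (cs.wordProd ω)⁻¹, p.2 + (count p.1 (cs.rightInvSeq ω) : ℕ)) := by
  induction ω with
  | nil => simp [show (1 : Function.End (W × ZMod 2)) p = p from rfl]
  | cons i ω ih =>
      have key : cs.wordProd ω * p.1 * (cs.wordProd ω)⁻¹ = cs.simple i ↔
          (cs.wordProd ω)⁻¹ * cs.simple i * cs.wordProd ω = p.1 := by
        constructor <;> intro h
        · rw [← h]; group
        · rw [← h]; group
      rw [List.map_cons, List.prod_cons]
      change parityStep cs i ((ω.map (parityStep cs)).prod p) = _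
      rw [ih]
      simp only [parityStep, cs.wordProd_cons, rightInvSeq, count_cons, key, beq_iff_eq,
        mul_inv_rev, inv_simple, Nat.cast_add, Nat.cast_ite, Nat.cast_one, Nat.cast_zero, add_assoc]
      simp [mul_assoc]

theorem reverse_alternatingWord_two_mul (i i' : B) (m : ℕ) :
    (alternatingWord i i' (2 * m)).reverse = alternatingWord i' i (2 * m) := by
  induction m with
  | zero => rfl
  | succ m ih =>
      rw [mul_add, mul_one, alternatingWord_succ, alternatingWord_succ, alternatingWord_succ',
        alternatingWord_succ', List.concat_eq_append, List.concat_eq_append]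
      simp [ih]

open scoped Classical in
theorem even_count_rightInvSeq_alternatingWord (i i' : B) (t : W) :
    Even (count t (cs.rightInvSeq (alternatingWord i i' (2 * M i i')))) := by
  rw [← count_reverse, ← cs.leftInvSeq_reverse, reverse_alternatingWord_two_mul]
  set m := M i i' with hm
  set L := cs.leftInvSeq (alternatingWord i' i (2 * m)) with hL
  have hlen : L.length = 2 * m := by simp [hL]
  have hget : ∀ k (h : k < 2 * m), L[k]'(by omega) =
      cs.wordProd (alternatingWord i i' (2 * k + 1)) := fun k h =>
    cs.getElem_leftInvSeq_alternatingWord i' i m k h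
  have hdrop : L.drop m = L.take m := by
    apply List.ext_getElem
    · simp [hlen]; omega
    · intro k h1 h2
      simp only [length_drop, length_take, hlen] at h1 h2
      rw [getElem_drop, getElem_take, hget _ (by omega), hget _ (by omega),
        prod_alternatingWord_eq_mul_pow, prod_alternatingWord_eq_mul_pow]
      have h3 : (2 * (m + k) + 1) / 2 = m + k := by omega
      have h4 : (2 * k + 1) / 2 = k := by omega
      rw [h3, h4, pow_add, hm, cs.simple_mul_simple_pow, one_mul]
      simp [parity_simps]
  rw [← take_append_drop m L, hdrop, count_append]
  exact ⟨_, rfl⟩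

theorem isLiftable_parityStep : M.IsLiftable (parityStep cs) := by
  intro i i'
  have h : ∀ m : ℕ, (parityStep cs i * parityStep cs i') ^ m =
      ((alternatingWord i i' (2 * m)).map (parityStep cs)).prod := by
    intro m
    induction m with
    | zero => rfl
    | succ m ih =>
        rw [mul_add, mul_one, alternatingWord_succ, alternatingWord_succ, pow_succ, ih,
          List.concat_eq_append, List.concat_eq_append]
        simp
  rw [h]
  funext p
  classical
  rw [prod_parityStep, prod_alternatingWord_eq_mul_pow]
  have := even_count_rightInvSeq_alternatingWord cs i i' p.1
  obtain ⟨c, hc⟩ := this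
  have h2 : ((c + c : ℕ) : ZMod 2) = 0 := by
    rw [Nat.cast_add]; exact CharTwo.add_self_eq_zero _
  rw [hc, h2]
  simp [show (1 : Function.End (W × ZMod 2)) p = p from rfl]

open scoped Classical in
/-- The parity of the number of occurrences of `t` among the right inversions of a word depends
only on the product of the word. -/
theorem count_rightInvSeq_congr {ω ω' : List B} (h : cs.wordProd ω = cs.wordProd ω') (t : W) :
    (count t (cs.rightInvSeq ω) : ZMod 2) = count t (cs.rightInvSeq ω') := by
  have key : ∀ ω : List B, (ω.map (parityStep cs)).prod =
      cs.lift ⟨_, isLiftable_parityStep cs⟩ (cs.wordProd ω) := by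
    intro ω
    rw [wordProd, map_list_prod, List.map_map]
    congr 1
    apply List.map_congr_left
    intro i _
    exact (cs.lift_apply_simple (isLiftable_parityStep cs) i).symm
  have h1 := prod_parityStep cs ω (t, 0)
  have h2 := prod_parityStep cs ω' (t, 0)
  rw [key, h, ← key, h2] at h1
  simpa using (congrArg Prod.snd h1).symm

theorem mem_rightInvSeq_of_isReduced {ω ω' : List B} (hω : cs.IsReduced ω)
    (h : cs.wordProd ω = cs.wordProd ω') {t : W} (ht : t ∈ cs.rightInvSeq ω) :
    t ∈ cs.rightInvSeq ω' := by
  classical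
  have h1 := count_rightInvSeq_congr cs h t
  rw [count_eq_one_of_mem hω.nodup_rightInvSeq ht] at h1
  by_contra h2
  rw [count_eq_zero_of_not_mem h2] at h1
  simp at h1

/-- The exchange property. -/
theorem exists_eraseIdx_of_isRightDescent {ω : List B} {i : B}
    (h : cs.IsRightDescent (cs.wordProd ω) i) :
    ∃ j < ω.length, cs.wordProd ω * cs.simple i = cs.wordProd (ω.eraseIdx j) := by
  obtain ⟨ω', hω', hw⟩ := cs.exists_isReduced (cs.wordProd ω * cs.simple i)
  have hprod : cs.wordProd (ω'.concat i) = cs.wordProd ω := by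
    rw [cs.wordProd_concat, ← hw, cs.simple_mul_simple_cancel_right]
  have hred : cs.IsReduced (ω'.concat i) := by
    rw [CoxeterSystem.IsReduced, hprod, List.concat_eq_append, length_append, length_singleton,
      ← hω'.eq, ← hw]
    exact ((cs.isRightDescent_iff).1 h).symm
  have hmem : cs.simple i ∈ cs.rightInvSeq (ω'.concat i) := by
    rw [rightInvSeq_concat]; simp
  have hmem' := mem_rightInvSeq_of_isReduced cs hred hprod hmem
  obtain ⟨j, hj, hji⟩ := List.getElem_of_mem hmem'
  refine ⟨j, by simpa using hj, ?_⟩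
  rw [← cs.wordProd_mul_getD_rightInvSeq, List.getD_eq_getElem _ _ hj, hji]

theorem isReduced_of_nodup_rightInvSeq {ω : List B} (h : (cs.rightInvSeq ω).Nodup) :
    cs.IsReduced ω := by
  classical
  obtain ⟨ω', hω', hw⟩ := cs.exists_isReduced (cs.wordProd ω)
  have hsub : (cs.rightInvSeq ω) ⊆ cs.rightInvSeq ω' := by
    intro t ht
    have h1 := count_rightInvSeq_congr cs hw t
    rw [count_eq_one_of_mem h ht] at h1
    by_contra h2
    rw [count_eq_zero_of_not_mem h2] at h1
    simp at h1
  have hle := (List.subperm_of_subset h hsub).length_le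
  rw [length_rightInvSeq, length_rightInvSeq, ← hω'.eq, ← hw] at hle
  exact le_antisymm (cs.length_wordProd_le ω) hle

end Coxeter

section GeometricRepresentation

open Polynomial.Chebyshev Module

variable (M : CoxeterMatrix B)

/-- The linear form `2⟨α_i, ·⟩` of the geometric representation. -/
noncomputable def corootForm (i : B) : Dual ℝ (B →₀ ℝ) :=
  Finsupp.linearCombination ℝ fun j => -2 * Real.cos (Real.pi / M i j)

theorem corootForm_single (i j : B) :
    corootForm M i (Finsupp.single j 1) = -2 * Real.cos (Real.pi / M i j) := by
  simp [corootForm, Finsupp.linearCombination_single]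

theorem corootForm_self (i : B) : corootForm M i (Finsupp.single i 1) = 2 := by
  simp [corootForm_single]

/-- The reflection attached to a simple root in the geometric representation. -/
noncomputable def simpleReflection (i : B) : (B →₀ ℝ) ≃ₗ[ℝ] (B →₀ ℝ) :=
  reflection (corootForm_self M i)

theorem corootForm_mul_sub_two (i i' : B) :
    corootForm M i (Finsupp.single i' 1) * corootForm M i' (Finsupp.single i 1) - 2 =
      2 * Real.cos (2 * Real.pi / M i i') := by
  rw [corootForm_single, corootForm_single, M.symmetric i' i,
    show 2 * Real.pi / (M i i' : ℝ) = 2 * (Real.pi / M i i') by ring, Real.cos_two_mul]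
  ring

theorem sin_two_pi_div_pos {m : ℕ} (hm : 3 ≤ m) : 0 < Real.sin (2 * Real.pi / m) := by
  have h : (3 : ℝ) ≤ m := by exact_mod_cast hm
  apply Real.sin_pos_of_pos_of_lt_pi
  · have := Real.pi_pos
    positivity
  · rw [div_lt_iff₀ (by linarith)]
    nlinarith [Real.pi_pos]

theorem simpleReflection_mul_pow (i i' : B) :
    (simpleReflection M i * simpleReflection M i') ^ M i i' = 1 := by
  by_cases hii : i = i'
  · subst hii
    simp only [M.diagonal, pow_one]
    exact mul_eq_one_iff_eq_inv.2 (reflection_inv _).symm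
  rcases Nat.lt_or_ge (M i i') 3 with hlt | hge
  · have h1 : M i i' ≠ 1 := M.off_diagonal i i' hii
    have h02 : M i i' = 0 ∨ M i i' = 2 := by omega
    rcases h02 with h0 | h2
    · rw [h0, pow_zero]
    · rw [h2]
      have e1 : corootForm M i (Finsupp.single i' 1) = 0 := by
        rw [corootForm_single, h2]; simp
      have e2 : corootForm M i' (Finsupp.single i 1) = 0 := by
        rw [corootForm_single, M.symmetric, h2]; simp
      apply LinearEquiv.ext
      intro z
      simp only [pow_two, LinearEquiv.mul_apply, simpleReflection, reflection_apply, map_sub,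
        map_smul, e1, e2, corootForm_self]
      simp only [LinearEquiv.coe_one, id_eq]
      module
  · apply LinearEquiv.ext
    intro z
    have hsin := (sin_two_pi_div_pos hge).ne'
    have hS (n : ℤ) := S_two_mul_real_cos (2 * Real.pi / M i i') n
    have hm0 : (M i i' : ℝ) ≠ 0 := by
      have : M i i' ≠ 0 := by omega
      exact_mod_cast this
    have hvan : (S ℝ ((M i i' - 2) / 2)).eval (2 * Real.cos (2 * Real.pi / M i i')) *
          ((S ℝ (((M i i' : ℤ) - 1) / 2)).eval (2 * Real.cos (2 * Real.pi / M i i')) +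
          (S ℝ (((M i i' : ℤ) - 3) / 2)).eval (2 * Real.cos (2 * Real.pi / M i i'))) = 0 ∧
        (S ℝ (((M i i' : ℤ) - 1) / 2)).eval (2 * Real.cos (2 * Real.pi / M i i')) *
          ((S ℝ ((M i i' : ℤ) / 2)).eval (2 * Real.cos (2 * Real.pi / M i i')) +
          (S ℝ (((M i i' : ℤ) - 2) / 2)).eval (2 * Real.cos (2 * Real.pi / M i i'))) = 0 := by
      rcases Nat.even_or_odd' (M i i') with ⟨p, hp | hp⟩
      · have e1 : ((M i i' : ℤ) - 2) / 2 = p - 1 := by omega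
        have e2 : ((M i i' : ℤ) - 1) / 2 = p - 1 := by omega
        have h0 : (S ℝ ((p : ℤ) - 1)).eval (2 * Real.cos (2 * Real.pi / M i i')) = 0 := by
          have h := hS (p - 1)
          have : (((p : ℤ) - 1 : ℤ) + 1 : ℝ) * (2 * Real.pi / M i i') = Real.pi := by
            have hc : (M i i' : ℝ) = 2 * p := by exact_mod_cast hp
            rw [hc] at hm0 ⊢
            push_cast
            have : (p : ℝ) ≠ 0 := fun h => hm0 (by rw [h]; ring)
            field_simp
            ring
          rw [this, Real.sin_pi] at h
          exact (mul_eq_zero.1 h).resolve_right hsin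
        rw [e1, e2, h0, zero_mul, zero_mul]
        exact ⟨rfl, rfl⟩
      · have e1 : ((M i i' : ℤ) - 2) / 2 = p - 1 := by omega
        have e2 : ((M i i' : ℤ) - 1) / 2 = p := by omega
        have e3 : ((M i i' : ℤ) - 3) / 2 = p - 1 := by omega
        have e4 : (M i i' : ℤ) / 2 = p := by omega
        have h0 : (S ℝ (p : ℤ)).eval (2 * Real.cos (2 * Real.pi / M i i')) +
            (S ℝ ((p : ℤ) - 1)).eval (2 * Real.cos (2 * Real.pi / M i i')) = 0 := by
          have h := hS (p - 1)
          have h' := hS p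
          have : (((p : ℤ) : ℝ) + 1) * (2 * Real.pi / M i i') =
              2 * Real.pi - (((p : ℤ) - 1 : ℤ) + 1 : ℝ) * (2 * Real.pi / M i i') := by
            have hc : (M i i' : ℝ) = 2 * p + 1 := by exact_mod_cast hp
            rw [hc] at hm0 ⊢
            push_cast
            field_simp
            ring
          rw [this, Real.sin_two_pi_sub] at h'
          have h2 := congrArg₂ (· + ·) h' h
          simp only [neg_add_cancel, ← add_mul] at h2
          exact (mul_eq_zero.1 h2).resolve_right hsin
        rw [e1, e2, e3, e4, h0, mul_zero, mul_zero]
        exact ⟨rfl, rfl⟩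
    obtain ⟨v1, v2⟩ := hvan
    rw [simpleReflection, simpleReflection, reflection_mul_reflection_pow_apply
      (corootForm_self M i) (corootForm_self M i') _ z _ (corootForm_mul_sub_two M i i').symm,
      v1, v2]
    simp

theorem simpleReflection_mul_pow_ne_one {i i' : B} (hii : i ≠ i') {k : ℕ} (hk : 0 < k)
    (hkm : k < M i i' ∨ M i i' = 0) :
    (simpleReflection M i * simpleReflection M i') ^ k ≠ 1 := by
  intro h
  have h1 := congrArg (fun e : (B →₀ ℝ) ≃ₗ[ℝ] (B →₀ ℝ) => e (Finsupp.single i 1)) h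
  simp only [simpleReflection] at h1
  rw [reflection_mul_reflection_pow_apply_self (corootForm_self M i) (corootForm_self M i') k _
    (corootForm_mul_sub_two M i i').symm] at h1
  have hi := congrArg (fun v : B →₀ ℝ => v i) h1
  have hi' := congrArg (fun v : B →₀ ℝ => v i') h1
  have z1 : (Finsupp.single i (1 : ℝ)) i' = 0 := Finsupp.single_eq_of_ne hii.symm
  have z2 : (Finsupp.single i' (1 : ℝ)) i = 0 := Finsupp.single_eq_of_ne hii
  simp only [LinearEquiv.coe_one, id_eq, Finsupp.add_apply, Finsupp.smul_apply,
    Finsupp.single_eq_same, z1, z2, smul_eq_mul, mul_one, mul_zero,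
    add_zero, zero_add, corootForm_single] at hi hi'
  rcases hkm with hkm | h0
  · rcases Nat.lt_or_ge (M i i') 3 with hlt | hge
    · have hM : M i i' = 2 := by
        have := M.off_diagonal i i' hii
        omega
      have hk1 : k = 1 := by omega
      subst hk1
      rw [hM] at hi
      norm_num at hi
    · have hsin := (sin_two_pi_div_pos hge).ne'
      have hS (n : ℤ) := S_two_mul_real_cos (2 * Real.pi / M i i') n
      have hm3 : (3 : ℝ) ≤ M i i' := by exact_mod_cast hge
      have hcos : Real.cos (Real.pi / M i' i) ≠ 0 := by
        rw [M.symmetric]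
        apply (Real.cos_pos_of_mem_Ioo ⟨_, _⟩).ne'
        · have : 0 < Real.pi / M i i' := div_pos Real.pi_pos (by linarith)
          linarith [Real.pi_pos]
        · apply div_lt_div_of_pos_left Real.pi_pos (by norm_num) (by linarith)
      have hz : (S ℝ ((k : ℤ) - 1)).eval (2 * Real.cos (2 * Real.pi / M i i')) = 0 := by
        rcases mul_eq_zero.1 hi' with h | h
        · exact h
        · exfalso; apply hcos; linarith
      rw [hz, add_zero] at hi
      have hk1 := hS (k - 1)
      have hk2 := hS k
      rw [hi, one_mul] at hk2
      rw [hz, zero_mul] at hk1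
      push_cast at hk1 hk2
      rw [sub_add_cancel] at hk1
      rw [add_mul, one_mul, Real.sin_add, ← hk1, zero_mul, zero_add] at hk2
      have hcos1 : Real.cos (k * (2 * Real.pi / M i i')) = 1 := by
        have := mul_right_cancel₀ hsin (hk2.symm.trans (one_mul _).symm)
        exact this
      have hpos : 0 < k * (2 * Real.pi / M i i') := by
        have : (0 : ℝ) < k := by exact_mod_cast hk
        have := Real.pi_pos
        positivity
      have hlt : k * (2 * Real.pi / M i i') < 2 * Real.pi := by
        have : (k : ℝ) < M i i' := by exact_mod_cast hkm
        rw [← mul_div_assoc, div_lt_iff₀ (by linarith)]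
        nlinarith [Real.pi_pos]
      have := (Real.cos_eq_one_iff_of_lt_of_lt (by linarith [Real.pi_pos]) hlt).1 hcos1
      linarith
  · have e : M i' i = 0 := by rw [M.symmetric]; exact h0
    simp only [h0, e, Nat.cast_zero, div_zero, Real.cos_zero, mul_one, S_eval_two] at hi hi'
    push_cast at hi'
    have : (0 : ℝ) < k := by exact_mod_cast hk
    linarith

theorem simple_mul_simple_pow_ne_one {W : Type*} [Group W] (cs : CoxeterSystem M W) {i i' : B}
    (hii : i ≠ i') {k : ℕ} (hk : 0 < k) (hkm : k < M i i' ∨ M i i' = 0) :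
    (cs.simple i * cs.simple i') ^ k ≠ 1 := by
  intro h
  have hl : M.IsLiftable (simpleReflection M) := fun i i' => simpleReflection_mul_pow M i i'
  have h1 := congrArg (cs.lift ⟨_, hl⟩) h
  rw [map_pow, map_mul, map_one, cs.lift_apply_simple hl, cs.lift_apply_simple hl] at h1
  exact simpleReflection_mul_pow_ne_one M hii hk hkm h1

end GeometricRepresentation

section Parabolic

variable {W : Type*} [Group W] {M : CoxeterMatrix B} (cs : CoxeterSystem M W)

open CoxeterSystem (alternatingWord alternatingWord_succ length_alternatingWord)

/-- `w` lies in the standard parabolic subgroup generated by `X`. -/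
def InParabolic (X : Set B) (w : W) : Prop :=
  ∃ ω : List B, (∀ i ∈ ω, i ∈ X) ∧ cs.wordProd ω = w

variable {cs}

theorem InParabolic.one (X : Set B) : InParabolic cs X 1 := ⟨[], by simp, by simp⟩

theorem InParabolic.simple {X : Set B} {i : B} (hi : i ∈ X) : InParabolic cs X (cs.simple i) :=
  ⟨[i], by simpa using hi, by simp⟩

theorem InParabolic.mul {X : Set B} {u v : W} (hu : InParabolic cs X u)
    (hv : InParabolic cs X v) : InParabolic cs X (u * v) := by
  obtain ⟨ω, h1, rfl⟩ := hu
  obtain ⟨ξ, h2, rfl⟩ := hv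
  refine ⟨ω ++ ξ, ?_, cs.wordProd_append _ _⟩
  intro i hi
  rcases List.mem_append.1 hi with h | h
  · exact h1 i h
  · exact h2 i h

theorem InParabolic.inv {X : Set B} {u : W} (hu : InParabolic cs X u) :
    InParabolic cs X u⁻¹ := by
  obtain ⟨ω, h1, rfl⟩ := hu
  exact ⟨ω.reverse, by simpa using h1, cs.wordProd_reverse ω⟩

theorem simple_injective : Function.Injective cs.simple := by
  intro i j hij
  by_contra hne
  apply simple_mul_simple_pow_ne_one M cs hne (k := 1) one_pos
  · have := M.off_diagonal i j hne
    omega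
  · rw [pow_one, hij, cs.simple_mul_simple_self]

theorem isReduced_append_singleton {ω : List B} {i : B} (hω : cs.IsReduced ω)
    (h : ¬ cs.IsRightDescent (cs.wordProd ω) i) : cs.IsReduced (ω ++ [i]) := by
  rw [cs.not_isRightDescent_iff] at h
  rw [CoxeterSystem.IsReduced, cs.wordProd_append, cs.wordProd_singleton, h, hω.eq]
  simp

theorem isReduced_of_append_singleton {ω : List B} {i : B} (h : cs.IsReduced (ω ++ [i])) :
    cs.IsReduced ω := by
  simpa using h.take ω.length

theorem not_isRightDescent_of_isReduced_append {ω : List B} {i : B}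
    (h : cs.IsReduced (ω ++ [i])) : ¬ cs.IsRightDescent (cs.wordProd ω) i := by
  rw [cs.not_isRightDescent_iff, ← cs.wordProd_singleton, ← cs.wordProd_append, h.eq,
    (isReduced_of_append_singleton h).eq]
  simp

theorem InParabolic.exists_isReduced {X : Set B} {w : W} (hw : InParabolic cs X w) :
    ∃ ω : List B, (∀ i ∈ ω, i ∈ X) ∧ cs.IsReduced ω ∧ cs.wordProd ω = w := by
  obtain ⟨ω, hX, rfl⟩ := hw
  induction ω using List.reverseRecOn with
  | nil => exact ⟨[], by simp, by simp [CoxeterSystem.IsReduced], rfl⟩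
  | append_singleton ω i ih =>
      obtain ⟨ξ, h1, h2, h3⟩ := ih fun j hj => hX j (by simp [hj])
      by_cases hd : cs.IsRightDescent (cs.wordProd ξ) i
      · obtain ⟨j, hj, he⟩ := exists_eraseIdx_of_isRightDescent cs hd
        refine ⟨ξ.eraseIdx j, fun k hk => h1 k (mem_of_mem_eraseIdx hk), ?_, ?_⟩
        · rw [cs.isRightDescent_iff, h2.eq, he] at hd
          rw [CoxeterSystem.IsReduced, length_eraseIdx_of_lt hj]
          omega
        · rw [← he, h3, cs.wordProd_append, cs.wordProd_singleton]
      · refine ⟨ξ ++ [i], ?_, isReduced_append_singleton h2 hd, ?_⟩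
        · intro k hk
          rcases List.mem_append.1 hk with h | h
          · exact h1 k h
          · exact hX k (by simp [List.mem_singleton.1 h])
        · rw [cs.wordProd_append, cs.wordProd_append, h3]

theorem InParabolic.simple_iff {X : Set B} {i : B} :
    InParabolic cs X (cs.simple i) ↔ i ∈ X := by
  refine ⟨fun h => ?_, InParabolic.simple⟩
  obtain ⟨ω, h1, h2, h3⟩ := h.exists_isReduced
  have hl := h2.eq
  rw [h3, cs.length_simple] at hl
  obtain ⟨j, rfl⟩ := List.length_eq_one_iff.1 hl.symm
  rw [cs.wordProd_singleton] at h3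
  rw [← simple_injective h3]
  simpa using h1

theorem InParabolic.mem_of_isReduced {X : Set B} {ω : List B} (hω : cs.IsReduced ω)
    (h : InParabolic cs X (cs.wordProd ω)) : ∀ i ∈ ω, i ∈ X := by
  induction ω using List.reverseRecOn with
  | nil => simp
  | append_singleton ω i ih =>
      obtain ⟨ξ, h1, h2, h3⟩ := h.exists_isReduced
      have hd : cs.IsRightDescent (cs.wordProd ξ) i := by
        rw [cs.isRightDescent_iff, h3, hω.eq, cs.wordProd_append, cs.wordProd_singleton,
          cs.simple_mul_simple_cancel_right, (isReduced_of_append_singleton hω).eq]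
        simp
      obtain ⟨j, hj, he⟩ := exists_eraseIdx_of_isRightDescent cs hd
      rw [h3, cs.wordProd_append, cs.wordProd_singleton, cs.simple_mul_simple_cancel_right] at he
      have hω' : InParabolic cs X (cs.wordProd ω) :=
        ⟨ξ.eraseIdx j, fun k hk => h1 k (mem_of_mem_eraseIdx hk), he.symm⟩
      have hi : i ∈ X := by
        rw [← InParabolic.simple_iff (cs := cs)]
        have := hω'.inv.mul h
        rwa [cs.wordProd_append, cs.wordProd_singleton, inv_mul_cancel_left] at this
      intro k hk
      rcases List.mem_append.1 hk with h | h
      · exact ih (isReduced_of_append_singleton hω) hω' k h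
      · rwa [List.mem_singleton.1 h]

theorem InParabolic.of_length_add {X : Set B} {u v : W} (h : InParabolic cs X (u * v))
    (hl : cs.length (u * v) = cs.length u + cs.length v) :
    InParabolic cs X u ∧ InParabolic cs X v := by
  obtain ⟨ω, hω, rfl⟩ := cs.exists_isReduced u
  obtain ⟨ξ, hξ, rfl⟩ := cs.exists_isReduced v
  rw [← cs.wordProd_append] at h
  have hr : cs.IsReduced (ω ++ ξ) := by
    rw [CoxeterSystem.IsReduced, cs.wordProd_append, hl, hω.eq, hξ.eq, length_append]
  have := h.mem_of_isReduced hr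
  exact ⟨⟨ω, fun i hi => this i (by simp [hi]), rfl⟩, ⟨ξ, fun i hi => this i (by simp [hi]), rfl⟩⟩

theorem length_mul_of_minimal {X : Set B} {d : W}
    (hd : ∀ u, InParabolic cs X u → cs.length d ≤ cs.length (d * u)) {ω : List B}
    (hω : cs.IsReduced ω) (hX : ∀ i ∈ ω, i ∈ X) :
    cs.length (d * cs.wordProd ω) = cs.length d + ω.length := by
  induction ω using List.reverseRecOn with
  | nil => simp
  | append_singleton ω i ih =>
      have hω' := isReduced_of_append_singleton hω
      have hX' : ∀ i ∈ ω, i ∈ X := fun j hj => hX j (by simp [hj])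
      have hiX : i ∈ X := hX i (by simp)
      specialize ih hω' hX'
      by_cases hdes : cs.IsRightDescent (d * cs.wordProd ω) i
      · exfalso
        obtain ⟨δ, hδ, hdδ⟩ := cs.exists_isReduced d
        rw [hdδ, ← cs.wordProd_append] at hdes
        obtain ⟨j, hj, he⟩ := exists_eraseIdx_of_isRightDescent cs hdes
        rcases Nat.lt_or_ge j δ.length with hlt | hge
        · rw [eraseIdx_append_of_lt_length hlt, cs.wordProd_append, cs.wordProd_append,
            ← hdδ] at he
          have hpar : InParabolic cs X (cs.wordProd ω * cs.simple i * (cs.wordProd ω)⁻¹) :=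
            (InParabolic.mul ⟨ω, hX', rfl⟩ (.simple hiX)).mul (InParabolic.inv ⟨ω, hX', rfl⟩)
          have h1 := hd _ hpar
          rw [← mul_assoc, ← mul_assoc, he, mul_inv_cancel_right] at h1
          have h2 := cs.length_wordProd_le (δ.eraseIdx j)
          rw [length_eraseIdx_of_lt hlt] at h2
          rw [hdδ, hδ.eq] at h1
          omega
        · rw [eraseIdx_append_of_length_le hge, cs.wordProd_append, cs.wordProd_append,
            mul_assoc, mul_left_cancel_iff] at he
          have h2 := cs.length_wordProd_le (ω.eraseIdx (j - δ.length))
          rw [← he, ← cs.wordProd_singleton, ← cs.wordProd_append, hω.eq, length_eraseIdx_of_lt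
            (by rw [length_append] at hj; omega)] at h2
          simp at h2
          omega
      · rw [cs.not_isRightDescent_iff, ih] at hdes
        rw [cs.wordProd_append, cs.wordProd_singleton, ← mul_assoc, hdes, length_append]
        simp [add_assoc]

variable (cs) in
theorem exists_minimal_decomposition (X : Set B) (w : W) :
    ∃ d u, InParabolic cs X u ∧ w = d * u ∧
      (∀ v, InParabolic cs X v → cs.length d ≤ cs.length (d * v)) := by
  classical
  have hex : ∃ n, ∃ u, InParabolic cs X u ∧ cs.length (w * u) = n := ⟨_, 1, .one X, rfl⟩
  obtain ⟨u, hu, hlen⟩ := Nat.find_spec hex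
  refine ⟨w * u, u⁻¹, hu.inv, by simp, fun v hv => ?_⟩
  rw [hlen]
  exact Nat.find_min' hex ⟨u * v, hu.mul hv, by rw [mul_assoc]⟩

theorem minimal_of_not_isRightDescent {X : Set B} {d : W}
    (hd : ∀ i ∈ X, ¬ cs.IsRightDescent d i) :
    ∀ u, InParabolic cs X u → cs.length d ≤ cs.length (d * u) := by
  obtain ⟨d', u, hu, rfl, hmin⟩ := exists_minimal_decomposition cs X d
  obtain ⟨ω, hX, hred, rfl⟩ := hu.exists_isReduced
  rcases List.eq_nil_or_concat' ω with rfl | ⟨ξ, i, rfl⟩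
  · simpa using hmin
  · exfalso
    apply hd i (hX i (by simp))
    have h1 := length_mul_of_minimal hmin hred hX
    have h2 := length_mul_of_minimal hmin (isReduced_of_append_singleton hred)
      (fun j hj => hX j (by simp [hj]))
    rw [CoxeterSystem.IsRightDescent, h1, cs.wordProd_append, cs.wordProd_singleton, mul_assoc,
      cs.simple_mul_simple_cancel_right, h2]
    simp

/-- If no element of `X` is a right descent of `d`, then lengths add in `d * u` for `u` in the
parabolic subgroup of `X`. -/
theorem length_mul_of_inParabolic {X : Set B} {d u : W}
    (hd : ∀ i ∈ X, ¬ cs.IsRightDescent d i) (hu : InParabolic cs X u) :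
    cs.length (d * u) = cs.length d + cs.length u := by
  obtain ⟨ω, hX, hred, rfl⟩ := hu.exists_isReduced
  rw [length_mul_of_minimal (minimal_of_not_isRightDescent hd) hred hX, hred.eq]

/-! ### Dihedral subgroups -/

theorem isReduced_alternatingWord {i j : B} (hij : i ≠ j) {n : ℕ} (hn : n ≤ M i j) :
    cs.IsReduced (alternatingWord i j n) := by
  have key : ∀ i j : B, i ≠ j → n ≤ M i j →
      (cs.leftInvSeq ((alternatingWord i j (2 * M i j)).take n)).Nodup := by
    intro i j hij hn
    rw [cs.leftInvSeq_take, List.nodup_iff_injective_get]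
    have aux : ∀ a b : ℕ, a < b → b < n → cs.wordProd (alternatingWord j i (2 * a + 1)) ≠
          cs.wordProd (alternatingWord j i (2 * b + 1)) := by
      intro a b hab hb he
      rw [cs.prod_alternatingWord_eq_mul_pow, cs.prod_alternatingWord_eq_mul_pow,
        show (2 * a + 1) / 2 = a by omega, show (2 * b + 1) / 2 = b by omega] at he
      simp only [Nat.not_even_bit1, if_false, mul_left_cancel_iff] at he
      have hb' : b = a + (b - a) := by omega
      rw [hb', pow_add, left_eq_mul] at he
      refine simple_mul_simple_pow_ne_one M cs hij.symm (by omega) (Or.inl ?_) he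
      rw [M.symmetric]
      omega
    rintro ⟨a, ha⟩ ⟨b, hb⟩ he
    simp only [get_eq_getElem, getElem_take, length_take, cs.length_leftInvSeq,
      length_alternatingWord] at he ha hb
    rw [cs.getElem_leftInvSeq_alternatingWord _ _ _ _ (by omega),
      cs.getElem_leftInvSeq_alternatingWord _ _ _ _ (by omega)] at he
    rcases lt_trichotomy a b with h | h | h
    · exact absurd he (aux a b h (by omega))
    · simpa using h
    · exact absurd he.symm (aux b a h (by omega))
  have key' : ∀ i j : B, i ≠ j → n ≤ M i j →
      cs.IsReduced ((alternatingWord i j (2 * M i j)).take n) := by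
    intro i j hij hn
    rw [← cs.isReduced_reverse_iff]
    apply isReduced_of_nodup_rightInvSeq
    rw [cs.rightInvSeq_reverse, nodup_reverse]
    exact key i j hij hn
  rcases Nat.eq_zero_or_pos (M i j) with h0 | hpos
  · have : n = 0 := by omega
    subst this
    simp [alternatingWord, CoxeterSystem.IsReduced]
  · rcases Nat.even_or_odd n with he | ho
    · have := key' i j hij hn
      rwa [CoxeterSystem.listTake_alternatingWord _ _ _ _ (by omega), if_pos he] at this
    · have := key' j i hij.symm (by rwa [M.symmetric])
      rwa [CoxeterSystem.listTake_alternatingWord _ _ _ _ (by rw [M.symmetric]; omega),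
        if_neg (Nat.not_even_iff_odd.2 ho)] at this

theorem eq_alternatingWord_of_isReduced {i j : B} {ω : List B} (hω : cs.IsReduced ω)
    (h : ∀ k ∈ ω, k = i ∨ k = j) :
    ω = alternatingWord i j ω.length ∨ ω = alternatingWord j i ω.length := by
  induction ω using List.reverseRecOn with
  | nil => simp [alternatingWord]
  | append_singleton ω k ih =>
      have hω' := isReduced_of_append_singleton hω
      specialize ih hω' fun l hl => h l (by simp [hl])
      have hne : ∀ ξ, ω ≠ ξ ++ [k] := by
        rintro ξ rfl
        have h1 := not_isRightDescent_of_isReduced_append hω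
        have h2 := not_isRightDescent_of_isReduced_append hω'
        rw [cs.wordProd_append, cs.wordProd_singleton] at h1
        exact h2 (cs.isRightDescent_iff_not_isRightDescent_mul.2 h1)
      have hk := h k (by simp)
      rcases List.eq_nil_or_concat' ω with rfl | ⟨ξ, l, rfl⟩
      · rcases hk with rfl | rfl <;> simp [alternatingWord]
      · have hlk : l ≠ k := by
          rintro rfl
          exact hne ξ rfl
        simp only [length_append, length_singleton] at ih ⊢
        have key : ∀ a b : B, alternatingWord a b (ξ.length + 1) =
            alternatingWord b a ξ.length ++ [b] := fun a b => by
          rw [alternatingWord_succ, List.concat_eq_append]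
        have key' : ∀ a b : B, alternatingWord a b (ξ.length + 1 + 1) =
            alternatingWord b a (ξ.length + 1) ++ [b] := fun a b => by
          rw [alternatingWord_succ, List.concat_eq_append]
        rcases ih with ih | ih
        · have hl : l = j := by simpa using (List.append_inj' (ih.trans (key _ _)) rfl).2
          have : k = i := by
            rcases hk with h | h
            · exact h
            · exact absurd (hl.trans h.symm) hlk
          right
          rw [ih, this, key']
        · have hl : l = i := by simpa using (List.append_inj' (ih.trans (key _ _)) rfl).2
          have : k = j := by
            rcases hk with h | h
            · exact absurd (hl.trans h.symm) hlk
            · exact h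
          left
          rw [ih, this, key']

theorem inParabolic_pair_alternatingWord (i j : B) (n : ℕ) :
    InParabolic cs {i, j} (cs.wordProd (alternatingWord i j n)) := by
  induction n generalizing i j with
  | zero => exact .one _
  | succ n ih =>
      rw [alternatingWord_succ, cs.wordProd_concat]
      refine .mul ?_ (.simple (by simp))
      rw [Set.pair_comm]
      exact ih j i

variable (cs) in
/-- The longest element of the dihedral subgroup generated by two simple reflections. -/
def dihedralTop (i j : B) : W := cs.wordProd (altList i j (M i j))

theorem dihedralTop_eq_inv (i j : B) :
    dihedralTop cs i j = (cs.wordProd (alternatingWord j i (M i j)))⁻¹ := by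
  rw [dihedralTop, altList_eq_reverse_alternatingWord, cs.wordProd_reverse]

theorem dihedralTop_symm (i j : B) : dihedralTop cs i j = dihedralTop cs j i := by
  rw [dihedralTop_eq_inv, dihedralTop_eq_inv, ← M.symmetric i j]
  have := cs.wordProd_braidWord_eq i j
  rw [CoxeterSystem.braidWord, CoxeterSystem.braidWord, ← M.symmetric i j] at this
  rw [this]

theorem length_dihedralTop {i j : B} (hij : i ≠ j) :
    cs.length (dihedralTop cs i j) = M i j := by
  rw [dihedralTop_eq_inv, cs.length_inv, (isReduced_alternatingWord hij.symm _).eq,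
    length_alternatingWord]
  rw [M.symmetric]

theorem inParabolic_dihedralTop (i j : B) : InParabolic cs {i, j} (dihedralTop cs i j) := by
  rw [dihedralTop_eq_inv, Set.pair_comm]
  exact (inParabolic_pair_alternatingWord j i _).inv

theorem length_mul_dihedralTop {w : W} {i j : B} (hij : i ≠ j)
    (hi : ¬ cs.IsRightDescent w i) (hj : ¬ cs.IsRightDescent w j) :
    cs.length (w * dihedralTop cs i j) = cs.length w + M i j := by
  rw [length_mul_of_inParabolic (X := {i, j}) (by rintro k (rfl | rfl) <;> assumption)
    (inParabolic_dihedralTop i j), length_dihedralTop hij]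

theorem exists_eq_mul_of_isRightDescent {w : W} {i j : B} (hij : i ≠ j) (hM : M i j ≠ 0)
    (hi : cs.IsRightDescent w i) (hj : cs.IsRightDescent w j) :
    ∃ d, w = d * cs.wordProd (alternatingWord i j (M i j)) ∧
      cs.length w = cs.length d + M i j := by
  obtain ⟨d, u, hu, rfl, hmin⟩ := exists_minimal_decomposition cs {i, j} w
  obtain ⟨ω, hX, hred, rfl⟩ := hu.exists_isReduced
  have hlen := length_mul_of_minimal hmin hred hX
  have hle : ω.length ≤ M i j := by
    by_contra hlt
    have hr := hred
    rcases eq_alternatingWord_of_isReduced hred (by simpa using hX) with h | h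
    · rw [h] at hr
      exact cs.not_isReduced_alternatingWord i j hM (by simpa using hlt) hr
    · rw [h] at hr
      exact cs.not_isReduced_alternatingWord j i (by rwa [M.symmetric])
        (by rw [M.symmetric]; simpa using hlt) hr
  have hdes : ∀ k, k = i ∨ k = j → cs.IsRightDescent (d * cs.wordProd ω) k := by
    rintro k (rfl | rfl) <;> assumption
  have hext : ∀ k, k = i ∨ k = j → ¬ cs.IsReduced (ω ++ [k]) := by
    intro k hk hr
    have h1 := length_mul_of_minimal hmin hr
      (by
        intro l hl
        rcases List.mem_append.1 hl with h | h
        · exact hX l h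
        · rw [List.mem_singleton.1 h]; simpa using hk)
    have h2 := cs.isRightDescent_iff.1 (hdes k hk)
    rw [cs.wordProd_append, cs.wordProd_singleton, ← mul_assoc] at h1
    simp only [length_append, length_singleton] at h1
    omega
  have hlen' : ω.length = M i j := by
    by_contra hne
    rcases eq_alternatingWord_of_isReduced hred (by simpa using hX) with h | h
    · apply hext i (Or.inl rfl)
      rw [h, ← List.concat_eq_append, ← alternatingWord_succ]
      exact isReduced_alternatingWord hij.symm (by rw [M.symmetric]; omega)
    · apply hext j (Or.inr rfl)
      rw [h, ← List.concat_eq_append, ← alternatingWord_succ]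
      exact isReduced_alternatingWord hij (by omega)
  refine ⟨d, ?_, by rw [hlen, hlen']⟩
  rcases eq_alternatingWord_of_isReduced hred (by simpa using hX) with h | h
  · rw [h, hlen']
  · rw [h, hlen']
    have := cs.wordProd_braidWord_eq i j
    rw [CoxeterSystem.braidWord, CoxeterSystem.braidWord, ← M.symmetric i j] at this
    rw [this]

theorem exists_eq_dihedralTop_mul {w : W} {i j : B} (hij : i ≠ j) (hM : M i j ≠ 0)
    (hi : cs.IsLeftDescent w i) (hj : cs.IsLeftDescent w j) :
    ∃ y, w = dihedralTop cs i j * y ∧ cs.length w = M i j + cs.length y := by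
  rw [← cs.isRightDescent_inv_iff] at hi hj
  obtain ⟨d, h1, h2⟩ := exists_eq_mul_of_isRightDescent hij hM hi hj
  refine ⟨d⁻¹, ?_, ?_⟩
  · rw [dihedralTop_symm, dihedralTop_eq_inv, M.symmetric j i, ← mul_inv_rev, ← h1, inv_inv]
  · rw [cs.length_inv] at h2 ⊢
    omega

theorem coxeterMatrix_ne_zero (cs : CoxeterSystem M W) [Finite W] {i j : B} (hij : i ≠ j) :
    M i j ≠ 0 := by
  intro h0
  obtain ⟨n, hn, h1⟩ := isOfFinOrder_iff_pow_eq_one.1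
    (isOfFinOrder_of_finite (cs.simple i * cs.simple j))
  exact simple_mul_simple_pow_ne_one M cs hij hn (Or.inr h0) h1

end Parabolic

section WeakOrder

variable {W : Type*} [Group W] {M : CoxeterMatrix B} (cs : CoxeterSystem M W)

/-- The right weak order: `u` is a prefix of `w`. -/
def WeakLE (u w : W) : Prop := cs.length u + cs.length (u⁻¹ * w) = cs.length w

variable {cs}

theorem weakLE_mul {u v : W} :
    WeakLE cs u (u * v) ↔ cs.length (u * v) = cs.length u + cs.length v := by
  rw [WeakLE, inv_mul_cancel_left, eq_comm]

theorem WeakLE.refl (u : W) : WeakLE cs u u := by simp [WeakLE]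

theorem WeakLE.one_le (u : W) : WeakLE cs 1 u := by simp [WeakLE]

theorem WeakLE.length_le {u w : W} (h : WeakLE cs u w) : cs.length u ≤ cs.length w := by
  rw [WeakLE] at h
  omega

theorem WeakLE.eq_of_length_le {u w : W} (h : WeakLE cs u w) (hl : cs.length w ≤ cs.length u) :
    u = w := by
  rw [WeakLE] at h
  have : cs.length (u⁻¹ * w) = 0 := by omega
  rw [cs.length_eq_zero_iff, inv_mul_eq_one] at this
  exact this

theorem WeakLE.trans {u v w : W} (h1 : WeakLE cs u v) (h2 : WeakLE cs v w) : WeakLE cs u w := by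
  rw [WeakLE] at *
  have h3 := cs.length_mul_le (u⁻¹ * v) (v⁻¹ * w)
  have h4 := cs.length_mul_le u (u⁻¹ * w)
  have e : u⁻¹ * v * (v⁻¹ * w) = u⁻¹ * w := by group
  rw [e] at h3
  rw [mul_inv_cancel_left] at h4
  omega

/-- Left translation of the weak order by a common prefix. -/
theorem WeakLE.of_mul_left {u v w : W} (hu : WeakLE cs u (u * v)) (h : WeakLE cs (u * v) (u * w)) :
    WeakLE cs v w := by
  have h2 := hu.trans h
  rw [weakLE_mul] at hu h2
  rw [WeakLE] at h ⊢
  have e : (u * v)⁻¹ * (u * w) = v⁻¹ * w := by group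
  rw [e] at h
  omega

theorem WeakLE.mul_left {u v w : W} (hu : WeakLE cs u (u * w)) (h : WeakLE cs v w) :
    WeakLE cs (u * v) (u * w) ∧ cs.length (u * v) = cs.length u + cs.length v := by
  rw [weakLE_mul] at hu
  rw [WeakLE] at h ⊢
  have e : (u * v)⁻¹ * (u * w) = v⁻¹ * w := by group
  have h3 := cs.length_mul_le u v
  have h4 := cs.length_mul_le (u * v) (v⁻¹ * w)
  rw [show u * v * (v⁻¹ * w) = u * w by group] at h4
  rw [e]
  omega

theorem weakLE_simple_iff {i : B} {w : W} : WeakLE cs (cs.simple i) w ↔ cs.IsLeftDescent w i := by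
  rw [WeakLE, cs.length_simple, cs.inv_simple, cs.isLeftDescent_iff, add_comm]

theorem not_isRightDescent_of_length {w : W} {i : B}
    (h : cs.length (w * cs.simple i) = cs.length w + 1) : ¬ cs.IsRightDescent w i :=
  cs.not_isRightDescent_iff.2 h

theorem weakLE_mul_dihedralTop {z : W} {i j : B} (hij : i ≠ j) (hM : M i j ≠ 0)
    (hi : cs.length (z * cs.simple i) = cs.length z + 1)
    (hj : cs.length (z * cs.simple j) = cs.length z + 1) :
    WeakLE cs (z * cs.simple i) (z * dihedralTop cs i j) := by
  have h1 := length_mul_dihedralTop hij (not_isRightDescent_of_length hi)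
    (not_isRightDescent_of_length hj)
  have h2 : WeakLE cs z (z * dihedralTop cs i j) := by
    rw [weakLE_mul, h1, length_dihedralTop hij]
  refine (WeakLE.mul_left h2 ?_).1
  rw [dihedralTop_eq_inv]
  obtain ⟨n, hn⟩ := Nat.exists_eq_succ_of_ne_zero hM
  have hr : cs.IsReduced (CoxeterSystem.alternatingWord j i (M i j)) :=
    isReduced_alternatingWord hij.symm (by rw [M.symmetric])
  rw [weakLE_simple_iff, cs.isLeftDescent_inv_iff, hn]
  rw [hn, Nat.succ_eq_add_one, CoxeterSystem.alternatingWord_succ, List.concat_eq_append] at hr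
  rw [Nat.succ_eq_add_one, CoxeterSystem.alternatingWord_succ, cs.wordProd_concat,
    CoxeterSystem.IsRightDescent, cs.simple_mul_simple_cancel_right, ← cs.wordProd_singleton,
    ← cs.wordProd_append, hr.eq, (isReduced_of_append_singleton hr).eq]
  simp

variable [Finite W]

/-- A prefix-closed set which is stable under completing diamonds has a greatest element. -/
theorem exists_greatest (𝒮 : Set W) (hone : 1 ∈ 𝒮)
    (hpre : ∀ u w, w ∈ 𝒮 → WeakLE cs u w → u ∈ 𝒮)
    (hdia : ∀ z i j, i ≠ j → z * cs.simple i ∈ 𝒮 → z * cs.simple j ∈ 𝒮 →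
      cs.length (z * cs.simple i) = cs.length z + 1 →
      cs.length (z * cs.simple j) = cs.length z + 1 → z * dihedralTop cs i j ∈ 𝒮) :
    ∃ m ∈ 𝒮, ∀ u ∈ 𝒮, WeakLE cs u m := by
  obtain ⟨N, hN⟩ : ∃ N, ∀ w : W, cs.length w ≤ N := by
    obtain ⟨N, hN⟩ := (Set.finite_range cs.length).bddAbove
    exact ⟨N, fun w => hN ⟨w, rfl⟩⟩
  have claim : ∀ n, ∀ z ∈ 𝒮, N - cs.length z = n →
      ∃ m ∈ 𝒮, WeakLE cs z m ∧ ∀ u ∈ 𝒮, WeakLE cs z u → WeakLE cs u m := by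
    intro n
    induction n using Nat.strong_induction_on with
    | _ n ih =>
      intro z hz hn
      have step : ∀ i, z * cs.simple i ∈ 𝒮 → cs.length (z * cs.simple i) = cs.length z + 1 →
          ∃ m ∈ 𝒮, WeakLE cs (z * cs.simple i) m ∧
            ∀ u ∈ 𝒮, WeakLE cs (z * cs.simple i) u → WeakLE cs u m := by
        intro i hi hl
        refine ih _ ?_ _ hi rfl
        have := hN (z * cs.simple i)
        omega
      have descend : ∀ u, WeakLE cs z u → u ≠ z → ∃ i, WeakLE cs (z * cs.simple i) u ∧
          cs.length (z * cs.simple i) = cs.length z + 1 := by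
        intro u hu hne
        have hy : z⁻¹ * u ≠ 1 := fun h => hne (inv_mul_eq_one.1 h).symm
        obtain ⟨i, hi⟩ := cs.exists_leftDescent_of_ne_one hy
        rw [← weakLE_simple_iff] at hi
        have := WeakLE.mul_left (u := z) (w := z⁻¹ * u) (by rwa [mul_inv_cancel_left]) hi
        rw [mul_inv_cancel_left, cs.length_simple] at this
        exact ⟨i, this⟩
      by_cases hmax : ∃ u ∈ 𝒮, WeakLE cs z u ∧ u ≠ z
      · obtain ⟨u₀, hu₀, hz₀, hne₀⟩ := hmax
        obtain ⟨i, hi, hil⟩ := descend u₀ hz₀ hne₀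
        have hi𝒮 := hpre _ _ hu₀ hi
        obtain ⟨m, hm, him, hmm⟩ := step i hi𝒮 hil
        have hzi : WeakLE cs z (z * cs.simple i) := by rw [weakLE_mul, hil, cs.length_simple]
        refine ⟨m, hm, hzi.trans him, fun u hu hzu => ?_⟩
        by_cases hne : u = z
        · subst hne
          exact hzi.trans him
        obtain ⟨j, hj, hjl⟩ := descend u hzu hne
        have hj𝒮 := hpre _ _ hu hj
        by_cases hij : i = j
        · subst hij
          exact hmm u hu hj
        obtain ⟨m', hm', hjm', hmm'⟩ := step j hj𝒮 hjl
        have htop := hdia z i j hij hi𝒮 hj𝒮 hil hjl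
        have h1 := weakLE_mul_dihedralTop hij (coxeterMatrix_ne_zero cs hij) hil hjl
        have h2 := weakLE_mul_dihedralTop (Ne.symm hij)
          (coxeterMatrix_ne_zero cs (Ne.symm hij)) hjl hil
        rw [dihedralTop_symm] at h2
        have h3 := hmm' _ htop h2
        exact (hmm' u hu hj).trans (hmm m' hm' (h1.trans h3))
      · push Not at hmax
        refine ⟨z, hz, .refl z, fun u hu hzu => ?_⟩
        rw [hmax u hu hzu]
        exact .refl z
  obtain ⟨m, hm, -, h⟩ := claim _ 1 hone rfl
  exact ⟨m, hm, fun u hu => h u hu (.one_le u)⟩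

variable (cs) in
/-- The greatest prefix `z` of `w` such that `v * z` has length `ℓ v + ℓ z` exists. -/
theorem exists_greatest_factor (v w : W) :
    ∃ z, (WeakLE cs z w ∧ WeakLE cs v (v * z)) ∧
      ∀ u, WeakLE cs u w → WeakLE cs v (v * u) → WeakLE cs u z := by
  obtain ⟨m, hm, h⟩ := exists_greatest (cs := cs) {z | WeakLE cs z w ∧ WeakLE cs v (v * z)}
    ⟨.one_le w, by rw [mul_one]; exact .refl v⟩
    (by
      rintro u z ⟨h1, h2⟩ h3
      refine ⟨h3.trans h1, ?_⟩
      rw [weakLE_mul]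
      exact (WeakLE.mul_left h2 h3).2)
    (by
      rintro z i j hij ⟨h1, h2⟩ ⟨h3, h4⟩ hi hj
      have hM := coxeterMatrix_ne_zero cs hij
      have hzi : WeakLE cs z (z * cs.simple i) := by rw [weakLE_mul, hi, cs.length_simple]
      have hzj : WeakLE cs z (z * cs.simple j) := by rw [weakLE_mul, hj, cs.length_simple]
      have hzw := hzi.trans h1
      have hl := length_mul_dihedralTop hij (not_isRightDescent_of_length hi)
        (not_isRightDescent_of_length hj)
      constructor
      · have di : cs.IsLeftDescent (z⁻¹ * w) i := by
          rw [← weakLE_simple_iff]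
          exact WeakLE.of_mul_left (u := z) hzi (by rwa [mul_inv_cancel_left])
        have dj : cs.IsLeftDescent (z⁻¹ * w) j := by
          rw [← weakLE_simple_iff]
          exact WeakLE.of_mul_left (u := z) hzj (by rwa [mul_inv_cancel_left])
        obtain ⟨y, hy, hyl⟩ := exists_eq_dihedralTop_mul hij hM di dj
        have := WeakLE.mul_left (cs := cs) (u := z) (v := dihedralTop cs i j) (w := z⁻¹ * w)
          (by rwa [mul_inv_cancel_left])
          (by rw [hy, weakLE_mul, length_dihedralTop hij, ← hy, hyl])
        rw [mul_inv_cancel_left] at this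
        exact this.1
      · have hvz := (WeakLE.mul_left h2 hzi).2
        have ei : cs.length (v * z * cs.simple i) = cs.length (v * z) + 1 := by
          rw [mul_assoc, weakLE_mul.1 h2, hi, hvz, add_assoc]
        have ej : cs.length (v * z * cs.simple j) = cs.length (v * z) + 1 := by
          rw [mul_assoc, weakLE_mul.1 h4, hj, hvz, add_assoc]
        have := length_mul_dihedralTop hij (not_isRightDescent_of_length ei)
          (not_isRightDescent_of_length ej)
        rw [weakLE_mul, ← mul_assoc, this, hl, hvz, add_assoc])
  exact ⟨m, hm, fun u h1 h2 => h u ⟨h1, h2⟩⟩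

variable (cs) in
/-- The greatest prefix `z` of `w` such that lengths add in `v * z`. -/
noncomputable def greatestFactor (v w : W) : W := (exists_greatest_factor cs v w).choose

theorem greatestFactor_weakLE (v w : W) : WeakLE cs (greatestFactor cs v w) w :=
  (exists_greatest_factor cs v w).choose_spec.1.1

theorem weakLE_mul_greatestFactor (v w : W) : WeakLE cs v (v * greatestFactor cs v w) :=
  (exists_greatest_factor cs v w).choose_spec.1.2

theorem weakLE_greatestFactor {v w u : W} (h1 : WeakLE cs u w) (h2 : WeakLE cs v (v * u)) :
    WeakLE cs u (greatestFactor cs v w) :=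
  (exists_greatest_factor cs v w).choose_spec.2 u h1 h2

variable (cs) in
theorem exists_greatest_inParabolic (X : Set B) :
    ∃ m, InParabolic cs X m ∧ ∀ u, InParabolic cs X u → WeakLE cs u m := by
  have hpre : ∀ u w, InParabolic cs X w → WeakLE cs u w → InParabolic cs X u := by
    intro u w hw huw
    have e : u * (u⁻¹ * w) = w := mul_inv_cancel_left u w
    rw [← e] at hw huw
    exact (hw.of_length_add (weakLE_mul.1 huw)).1
  obtain ⟨m, hm, h⟩ := exists_greatest (cs := cs) {w | InParabolic cs X w} (.one X) hpre
    (by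
      intro z i j hij h1 h2 hi hj
      have hz : InParabolic cs X z := hpre z _ h1 (by rw [weakLE_mul, hi, cs.length_simple])
      have hiX : i ∈ X := by
        rw [← InParabolic.simple_iff (cs := cs)]
        have h3 : InParabolic cs X (z⁻¹ * (z * cs.simple i)) := hz.inv.mul h1
        rwa [inv_mul_cancel_left] at h3
      have hjX : j ∈ X := by
        rw [← InParabolic.simple_iff (cs := cs)]
        have h3 : InParabolic cs X (z⁻¹ * (z * cs.simple j)) := hz.inv.mul h2
        rwa [inv_mul_cancel_left] at h3
      refine hz.mul ?_
      obtain ⟨ω, hω, he⟩ := inParabolic_dihedralTop (cs := cs) i j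
      refine ⟨ω, fun k hk => ?_, he⟩
      rcases hω k hk with rfl | rfl <;> assumption)
  exact ⟨m, hm, h⟩

variable (cs) in
/-- The longest element of the standard parabolic subgroup of `X`. -/
noncomputable def longest (X : Set B) : W := (exists_greatest_inParabolic cs X).choose

theorem inParabolic_longest (X : Set B) : InParabolic cs X (longest cs X) :=
  (exists_greatest_inParabolic cs X).choose_spec.1

theorem weakLE_longest {X : Set B} {u : W} (hu : InParabolic cs X u) :
    WeakLE cs u (longest cs X) :=
  (exists_greatest_inParabolic cs X).choose_spec.2 u hu

theorem eq_longest_of_isRightDescent {X : Set B} {w : W} (hw : InParabolic cs X w)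
    (h : ∀ i ∈ X, cs.IsRightDescent w i) : w = longest cs X := by
  by_contra hne
  have hy : w⁻¹ * longest cs X ≠ 1 := fun e => hne (inv_mul_eq_one.1 e)
  obtain ⟨i, hi⟩ := cs.exists_leftDescent_of_ne_one hy
  have hle := weakLE_longest hw
  rw [← weakLE_simple_iff] at hi
  have hpar : InParabolic cs X (w⁻¹ * longest cs X) := hw.inv.mul (inParabolic_longest X)
  have hiX : i ∈ X := by
    rw [← InParabolic.simple_iff (cs := cs)]
    rw [← mul_inv_cancel_left (cs.simple i) (w⁻¹ * longest cs X)] at hpar hi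
    exact (hpar.of_length_add (weakLE_mul.1 hi)).1
  have := (WeakLE.mul_left (u := w) (w := w⁻¹ * longest cs X)
    (by rwa [mul_inv_cancel_left]) hi).2
  rw [cs.length_simple] at this
  exact cs.not_isRightDescent_iff.2 this (h i hiX)

theorem isLeftDescent_longest {X : Set B} {i : B} (hi : i ∈ X) :
    cs.IsLeftDescent (longest cs X) i :=
  weakLE_simple_iff.1 (weakLE_longest (.simple hi))

theorem longest_inv (X : Set B) : (longest cs X)⁻¹ = longest cs X := by
  apply eq_longest_of_isRightDescent (inParabolic_longest X).inv
  intro i hi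
  rw [cs.isRightDescent_inv_iff]
  exact isLeftDescent_longest hi

theorem eq_longest_of_isLeftDescent {X : Set B} {w : W} (hw : InParabolic cs X w)
    (h : ∀ i ∈ X, cs.IsLeftDescent w i) : w = longest cs X := by
  rw [← longest_inv, ← inv_eq_iff_eq_inv]
  exact eq_longest_of_isRightDescent hw.inv fun i hi => cs.isRightDescent_inv_iff.2 (h i hi)

theorem isRightDescent_longest {X : Set B} {i : B} (hi : i ∈ X) :
    cs.IsRightDescent (longest cs X) i := by
  rw [← longest_inv, cs.isRightDescent_inv_iff]
  exact isLeftDescent_longest hi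

theorem longest_mul_simple {X : Set B} {i : B} (hi : i ∈ X) :
    ∃ j ∈ X, longest cs X * cs.simple i = cs.simple j * longest cs X := by
  have hpar : InParabolic cs X (cs.simple i * longest cs X) :=
    (InParabolic.simple hi).mul (inParabolic_longest X)
  have h1 := weakLE_longest hpar
  have h2 := cs.isLeftDescent_iff.1 (isLeftDescent_longest (cs := cs) hi)
  rw [WeakLE, mul_inv_rev, cs.inv_simple, longest_inv] at h1
  have h3 : cs.length (longest cs X * cs.simple i * longest cs X) = 1 := by omega
  obtain ⟨j, hj⟩ := cs.length_eq_one_iff.1 h3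
  refine ⟨j, ?_, ?_⟩
  · rw [← InParabolic.simple_iff (cs := cs), ← hj, mul_assoc]
    exact (inParabolic_longest X).mul hpar
  · rw [← hj]
    nth_rewrite 3 [← longest_inv (cs := cs)]
    group

end WeakOrder

section BraidMonoid

/-- The defining relations of the positive braid monoid. -/
def BraidRel (M : CoxeterMatrix B) (a b : FreeMonoid B) : Prop :=
  ∃ s t : B, s ≠ t ∧ M s t ≠ 0 ∧ a = FreeMonoid.ofList (altList s t (M s t)) ∧
    b = FreeMonoid.ofList (altList t s (M s t))

/-- The Artin-Tits monoid, given by the same presentation as the Artin-Tits group. -/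
abbrev BraidMonoid (M : CoxeterMatrix B) : Type _ := PresentedMonoid (BraidRel M)

/-- The generators of the Artin-Tits monoid. -/
def atom (M : CoxeterMatrix B) (s : B) : BraidMonoid M := PresentedMonoid.of _ s

/-- The element of the Artin-Tits monoid represented by a word. -/
def word (M : CoxeterMatrix B) (l : List B) : BraidMonoid M := (l.map (atom M)).prod

variable {M : CoxeterMatrix B}

@[simp] theorem word_nil : word M [] = 1 := rfl

@[simp] theorem word_cons (s : B) (l : List B) : word M (s :: l) = atom M s * word M l := by
  simp [word]

@[simp] theorem word_append (l l' : List B) : word M (l ++ l') = word M l * word M l' := by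
  simp [word]

theorem word_singleton (s : B) : word M [s] = atom M s := by simp

theorem word_eq_mk (l : List B) :
    word M l = PresentedMonoid.mk (BraidRel M) (FreeMonoid.ofList l) := by
  induction l with
  | nil => rfl
  | cons s l ih => rw [word_cons, ih, FreeMonoid.ofList_cons, map_mul]; rfl

theorem exists_word (g : BraidMonoid M) : ∃ l, word M l = g := by
  obtain ⟨l, rfl⟩ := PresentedMonoid.surjective_mk g
  exact ⟨l.toList, word_eq_mk _⟩

theorem word_altList {s t : B} (hst : s ≠ t) (h : M s t ≠ 0) :
    word M (altList s t (M s t)) = word M (altList t s (M s t)) := by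
  rw [word_eq_mk, word_eq_mk]
  exact PresentedMonoid.mk_eq_mk_of_rel ⟨s, t, hst, h, rfl, rfl⟩

/-- The universal property of the Artin-Tits monoid. -/
def BraidMonoid.lift {N : Type*} [Monoid N] (f : B → N)
    (h : ∀ s t, s ≠ t → M s t ≠ 0 → ((altList s t (M s t)).map f).prod =
      ((altList t s (M s t)).map f).prod) : BraidMonoid M →* N :=
  PresentedMonoid.lift f <| by
    rintro _ _ ⟨s, t, hst, hM, rfl, rfl⟩
    simpa [FreeMonoid.lift_apply] using h s t hst hM

theorem BraidMonoid.lift_word {N : Type*} [Monoid N] (f : B → N)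
    (h : ∀ s t, s ≠ t → M s t ≠ 0 → ((altList s t (M s t)).map f).prod =
      ((altList t s (M s t)).map f).prod) (l : List B) :
    BraidMonoid.lift f h (word M l) = (l.map f).prod := by
  rw [word, map_list_prod, List.map_map]
  rfl

theorem length_altList (s t : B) (n : ℕ) : (altList s t n).length = n := by
  rw [altList_eq_reverse_alternatingWord, List.length_reverse,
    CoxeterSystem.length_alternatingWord]

/-! ### The section of the projection to the Coxeter group -/

variable {W : Type*} [Group W] (cs : CoxeterSystem M W)

theorem isReduced_of_cons {i : B} {ω : List B} (h : cs.IsReduced (i :: ω)) : cs.IsReduced ω := by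
  simpa using CoxeterSystem.IsReduced.drop h 1

theorem word_eq_of_isReduced [Finite W] {ω ξ : List B} (hω : cs.IsReduced ω)
    (hξ : cs.IsReduced ξ) (h : cs.wordProd ω = cs.wordProd ξ) : word M ω = word M ξ := by
  induction hn : ω.length generalizing ω ξ with
  | zero =>
    have h1 : ω = [] := List.length_eq_zero_iff.1 hn
    have h2 : ξ = [] := by
      rw [← List.length_eq_zero_iff, ← hξ, ← h, hω, hn]
    rw [h1, h2]
  | succ n ih =>
    have hlen : ξ.length = n + 1 := by rw [← hξ, ← h, hω, hn]
    have key : ∀ {k : B} {ζ ζ' : List B}, cs.IsReduced (k :: ζ) → cs.IsReduced (k :: ζ') →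
        cs.wordProd (k :: ζ) = cs.wordProd (k :: ζ') → (k :: ζ).length = n + 1 →
        word M (k :: ζ) = word M (k :: ζ') := by
      intro k ζ ζ' h1 h2 h3 h4
      rw [word_cons, word_cons, ih (isReduced_of_cons cs h1) (isReduced_of_cons cs h2)
        (by simpa [cs.wordProd_cons] using h3) (by simpa using h4)]
    match ω, ξ with
    | [], _ => simp at hn
    | _, [] => simp at hlen
    | i :: ω, j :: ξ =>
      by_cases hij : i = j
      · subst hij
        exact key hω hξ h hn
      · have hM := coxeterMatrix_ne_zero cs hij
        obtain ⟨m, hm⟩ := Nat.exists_eq_succ_of_ne_zero hM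
        have hdesc : ∀ {k : B} {ζ : List B}, cs.IsReduced (k :: ζ) →
            cs.IsLeftDescent (cs.wordProd (k :: ζ)) k := by
          intro k ζ hr
          have h1 := isReduced_of_cons cs hr
          rw [CoxeterSystem.IsReduced] at hr h1
          rw [CoxeterSystem.IsLeftDescent, hr, cs.wordProd_cons, cs.simple_mul_simple_cancel_left,
            h1]
          simp
        obtain ⟨y, hy, hyl⟩ := exists_eq_dihedralTop_mul (cs := cs) hij hM (hdesc hω)
          (h ▸ hdesc hξ)
        obtain ⟨η, hη, rfl⟩ := cs.exists_isReduced y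
        have e1 : cs.wordProd (i :: ω) = cs.wordProd (altList i j (M i j) ++ η) := by
          rw [hy, cs.wordProd_append]; rfl
        have e2 : cs.wordProd (i :: ω) = cs.wordProd (altList j i (M i j) ++ η) := by
          rw [hy, cs.wordProd_append, dihedralTop_symm, M.symmetric i j]; rfl
        have r1 : cs.IsReduced (altList i j (M i j) ++ η) := by
          rw [CoxeterSystem.IsReduced, ← e1, hyl, List.length_append, length_altList, hη]
        have r2 : cs.IsReduced (altList j i (M i j) ++ η) := by
          rw [CoxeterSystem.IsReduced, ← e2, hyl, List.length_append, length_altList, hη]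
        calc word M (i :: ω) = word M (altList i j (M i j) ++ η) := by
              rw [hm] at e1 r1 ⊢
              exact key hω r1 e1 hn
          _ = word M (altList j i (M i j) ++ η) := by
              rw [word_append, word_append, word_altList hij hM]
          _ = word M (j :: ξ) := by
              symm
              rw [hm] at e2 r2 ⊢
              exact key hξ r2 (h.symm.trans e2) hlen

/-- The section of the projection from the Artin-Tits monoid to the Coxeter group: the element
represented by any reduced word of `w`. -/
noncomputable def posLift (w : W) : BraidMonoid M := word M (cs.exists_isReduced w).choose

variable {cs} [Finite W]

theorem posLift_wordProd {ω : List B} (h : cs.IsReduced ω) :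
    posLift cs (cs.wordProd ω) = word M ω :=
  have hs := (cs.exists_isReduced (cs.wordProd ω)).choose_spec
  word_eq_of_isReduced cs hs.1 h hs.2.symm

theorem posLift_mul {u v : W} (h : cs.length (u * v) = cs.length u + cs.length v) :
    posLift cs (u * v) = posLift cs u * posLift cs v := by
  obtain ⟨ω, hω, rfl⟩ := cs.exists_isReduced u
  obtain ⟨ξ, hξ, rfl⟩ := cs.exists_isReduced v
  rw [posLift_wordProd hω, posLift_wordProd hξ, ← cs.wordProd_append, posLift_wordProd,
    word_append]
  rw [CoxeterSystem.IsReduced, cs.wordProd_append, h, hω, hξ, List.length_append]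

theorem posLift_one : posLift cs 1 = 1 := by
  rw [← cs.wordProd_nil, posLift_wordProd (by simp [CoxeterSystem.IsReduced]), word_nil]

theorem posLift_simple (i : B) : posLift cs (cs.simple i) = atom M i := by
  rw [← cs.wordProd_singleton, posLift_wordProd (by simp [CoxeterSystem.IsReduced]),
    word_singleton]

theorem posLift_dihedralTop {i j : B} (hij : i ≠ j) :
    posLift cs (dihedralTop cs i j) = word M (altList i j (M i j)) := by
  rw [dihedralTop, posLift_wordProd]
  have := length_dihedralTop (cs := cs) hij
  rw [CoxeterSystem.IsReduced, length_altList]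
  exact this

end BraidMonoid

section NormalForm

variable {W : Type*} [Group W] {M : CoxeterMatrix B} {cs : CoxeterSystem M W} [Finite W]

theorem posLift_mul_of_weakLE {u v w : W} (h1 : WeakLE cs u v) (h2 : WeakLE cs v w) :
    posLift cs (u⁻¹ * v) * posLift cs (v⁻¹ * w) = posLift cs (u⁻¹ * w) := by
  have h3 := h1.trans h2
  rw [WeakLE] at h1 h2 h3
  rw [← posLift_mul]
  · congr 1; group
  · rw [show u⁻¹ * v * (v⁻¹ * w) = u⁻¹ * w by group]
    omega

theorem WeakLE.posLift_mul {u w : W} (h : WeakLE cs u w) :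
    posLift cs u * posLift cs (u⁻¹ * w) = posLift cs w := by
  simpa using posLift_mul_of_weakLE (WeakLE.one_le u) h

theorem greatestFactor_mul {u v : W} (h : cs.length (u * v) = cs.length u + cs.length v) (w : W) :
    greatestFactor cs u (v * greatestFactor cs v w) = v * greatestFactor cs (u * v) w ∧
      WeakLE cs (greatestFactor cs (u * v) w) (greatestFactor cs v w) := by
  set z := greatestFactor cs v w with hz
  set y := greatestFactor cs (u * v) w with hy
  have hzw : WeakLE cs z w := greatestFactor_weakLE v w
  have hvz : WeakLE cs v (v * z) := weakLE_mul_greatestFactor v w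
  have hyw : WeakLE cs y w := greatestFactor_weakLE _ w
  have huvy := weakLE_mul.1 (weakLE_mul_greatestFactor (cs := cs) (u * v) w)
  rw [← hy] at huvy
  have hvy : cs.length (v * y) = cs.length v + cs.length y := by
    have h1 := cs.length_mul_le u (v * y)
    have h2 := cs.length_mul_le v y
    rw [← mul_assoc] at h1
    omega
  have hyz : WeakLE cs y z := weakLE_greatestFactor hyw (weakLE_mul.2 hvy)
  refine ⟨?_, hyz⟩
  have hu := weakLE_mul_greatestFactor (cs := cs) u (v * z)
  have hle := greatestFactor_weakLE (cs := cs) u (v * z)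
  have hv : WeakLE cs v (greatestFactor cs u (v * z)) :=
    weakLE_greatestFactor hvz (weakLE_mul.2 h)
  have h1 : WeakLE cs (v * y) (greatestFactor cs u (v * z)) := by
    refine weakLE_greatestFactor (WeakLE.mul_left hvz hyz).1 (weakLE_mul.2 ?_)
    rw [← mul_assoc]
    omega
  obtain ⟨x, hx⟩ : ∃ x, greatestFactor cs u (v * z) = v * x :=
    ⟨v⁻¹ * greatestFactor cs u (v * z), by group⟩
  rw [hx] at hu hle hv h1 ⊢
  have hxz : WeakLE cs x z := WeakLE.of_mul_left hv hle
  have hxy : WeakLE cs x y := by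
    refine weakLE_greatestFactor (hxz.trans hzw) (weakLE_mul.2 ?_)
    rw [weakLE_mul] at hu hv
    rw [mul_assoc]
    omega
  exact (h1.eq_of_length_le (WeakLE.mul_left (weakLE_mul.2 hvy) hxy).1.length_le).symm

variable (cs) in
/-- Left multiplication by the lift of `v` on pairs consisting of a greatest simple prefix and a
remainder. -/
noncomputable def prefixMap (v : W) : Function.End (W × BraidMonoid M) := fun p =>
  (v * greatestFactor cs v p.1, posLift cs ((greatestFactor cs v p.1)⁻¹ * p.1) * p.2)

theorem prefixMap_mul {u v : W} (h : cs.length (u * v) = cs.length u + cs.length v) :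
    prefixMap cs u * prefixMap cs v = prefixMap cs (u * v) := by
  funext ⟨w, g⟩
  obtain ⟨h1, h2⟩ := greatestFactor_mul h w
  change prefixMap cs u (prefixMap cs v (w, g)) = _
  simp only [prefixMap]
  rw [h1, mul_assoc, ← mul_assoc (posLift cs _), mul_inv_rev, mul_assoc _ v⁻¹,
    inv_mul_cancel_left, posLift_mul_of_weakLE h2 (greatestFactor_weakLE v w)]

theorem greatestFactor_one_left (w : W) : greatestFactor cs 1 w = w :=
  ((weakLE_greatestFactor (.refl w) (.one_le _)).eq_of_length_le
    (greatestFactor_weakLE 1 w).length_le).symm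

theorem greatestFactor_one_right (v : W) : greatestFactor cs v 1 = 1 :=
  (greatestFactor_weakLE v 1).eq_of_length_le (by simp)

theorem prefixMap_one : prefixMap cs 1 = 1 := by
  funext ⟨w, g⟩
  simp only [prefixMap]
  rw [greatestFactor_one_left, one_mul, inv_mul_cancel, posLift_one, one_mul]
  rfl

theorem prod_prefixMap {ω : List B} (h : cs.IsReduced ω) :
    (ω.map fun i => prefixMap cs (cs.simple i)).prod = prefixMap cs (cs.wordProd ω) := by
  induction ω with
  | nil => rw [cs.wordProd_nil, prefixMap_one]; rfl
  | cons i ω ih =>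
    have h' := isReduced_of_cons cs h
    rw [List.map_cons, List.prod_cons, ih h', prefixMap_mul, cs.wordProd_cons]
    rw [CoxeterSystem.IsReduced] at h h'
    rw [← cs.wordProd_cons, h, h', cs.length_simple, List.length_cons, add_comm]

variable (cs) in
/-- The action of the Artin-Tits monoid on pairs given by `prefixMap`. -/
noncomputable def prefixAction : BraidMonoid M →* Function.End (W × BraidMonoid M) :=
  BraidMonoid.lift (fun i => prefixMap cs (cs.simple i)) <| by
    have hr : ∀ {s t : B}, s ≠ t → cs.IsReduced (altList s t (M s t)) := by
      intro s t hst
      have := length_dihedralTop (cs := cs) hst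
      rw [CoxeterSystem.IsReduced, length_altList]
      exact this
    intro s t hst _
    have h := hr hst.symm
    rw [M.symmetric t s] at h
    rw [prod_prefixMap (hr hst), prod_prefixMap h]
    have := dihedralTop_symm (cs := cs) s t
    rw [dihedralTop, dihedralTop, M.symmetric t s] at this
    rw [this]

theorem prefixAction_posLift (w : W) : prefixAction cs (posLift cs w) = prefixMap cs w := by
  obtain ⟨ω, hω, rfl⟩ := cs.exists_isReduced w
  rw [posLift_wordProd hω, prefixAction, BraidMonoid.lift_word, prod_prefixMap hω]

theorem braidMonoid_induction (cs : CoxeterSystem M W) {p : BraidMonoid M → Prop} (one : p 1)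
    (mul : ∀ (v : W) (g : BraidMonoid M), p g → p (posLift cs v * g)) (g : BraidMonoid M) :
    p g := by
  obtain ⟨l, rfl⟩ := exists_word g
  induction l with
  | nil => exact one
  | cons i l ih => rw [word_cons, ← posLift_simple (cs := cs)]; exact mul _ _ ih

theorem prefixAction_mul_apply (g h : BraidMonoid M) (p : W × BraidMonoid M) :
    prefixAction cs (g * h) p = prefixAction cs g (prefixAction cs h p) := by
  rw [map_mul]; rfl

theorem prefixAction_one_apply (p : W × BraidMonoid M) : prefixAction cs 1 p = p := by
  rw [map_one]; rfl

theorem prefixAction_apply (g : BraidMonoid M) (w : W) (h : BraidMonoid M) :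
    prefixAction cs g (w, h) =
      ((prefixAction cs g (w, 1)).1, (prefixAction cs g (w, 1)).2 * h) := by
  induction g using braidMonoid_induction cs with
  | one => simp [prefixAction_one_apply]
  | mul v g ih =>
    rw [prefixAction_mul_apply, ih, prefixAction_mul_apply, prefixAction_posLift]
    simp only [prefixMap, mul_assoc]

theorem posLift_prefixAction (g : BraidMonoid M) (p : W × BraidMonoid M) :
    posLift cs (prefixAction cs g p).1 * (prefixAction cs g p).2 = g * (posLift cs p.1 * p.2) := by
  induction g using braidMonoid_induction cs with
  | one => simp [prefixAction_one_apply]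
  | mul v g ih =>
    rw [prefixAction_mul_apply, prefixAction_posLift, mul_assoc, ← ih]
    simp only [prefixMap]
    rw [posLift_mul (weakLE_mul.1 (weakLE_mul_greatestFactor v _)), mul_assoc,
      ← mul_assoc (posLift cs (greatestFactor _ _ _)), (greatestFactor_weakLE v _).posLift_mul]

variable (cs) in
/-- The greatest simple prefix of an element of the Artin-Tits monoid. -/
noncomputable def head (g : BraidMonoid M) : W := (prefixAction cs g (1, 1)).1

variable (cs) in
/-- The quotient of an element by its greatest simple prefix. -/
noncomputable def rest (g : BraidMonoid M) : BraidMonoid M := (prefixAction cs g (1, 1)).2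

theorem posLift_head_mul_rest (g : BraidMonoid M) : posLift cs (head cs g) * rest cs g = g := by
  rw [head, rest, posLift_prefixAction, posLift_one, one_mul, mul_one]

theorem head_mul (g h : BraidMonoid M) :
    head cs (g * h) = (prefixAction cs g (head cs h, 1)).1 := by
  rw [head, prefixAction_mul_apply, ← Prod.mk.eta (p := prefixAction cs h (1, 1)),
    prefixAction_apply]
  rfl

theorem head_posLift_mul (v : W) (g : BraidMonoid M) :
    head cs (posLift cs v * g) = v * greatestFactor cs v (head cs g) := by
  rw [head_mul, prefixAction_posLift, prefixMap]

theorem rest_posLift_mul (v : W) (g : BraidMonoid M) : rest cs (posLift cs v * g) =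
    posLift cs ((greatestFactor cs v (head cs g))⁻¹ * head cs g) * rest cs g := by
  rw [rest, prefixAction_mul_apply, prefixAction_posLift]
  rfl

theorem head_one : head cs (1 : BraidMonoid M) = 1 := by
  rw [head, prefixAction_one_apply]

theorem head_posLift (w : W) : head cs (posLift cs w) = w := by
  rw [← mul_one (posLift cs w), head_posLift_mul, head_one, greatestFactor_one_right, mul_one]

theorem head_mul_head (g h : BraidMonoid M) :
    head cs (g * posLift cs (head cs h)) = head cs (g * h) := by
  rw [head_mul, head_mul, head_posLift]

theorem posLift_dvd_iff {w : W} {g : BraidMonoid M} :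
    posLift cs w ∣ g ↔ WeakLE cs w (head cs g) := by
  constructor
  · rintro ⟨c, rfl⟩
    rw [head_posLift_mul]
    exact weakLE_mul_greatestFactor _ _
  · intro h
    rw [← posLift_head_mul_rest (cs := cs) g, ← h.posLift_mul, mul_assoc]
    exact dvd_mul_right _ _

theorem atom_dvd_iff {i : B} {g : BraidMonoid M} :
    atom M i ∣ g ↔ cs.IsLeftDescent (head cs g) i := by
  rw [← posLift_simple (cs := cs), posLift_dvd_iff, weakLE_simple_iff]

theorem posLift_dihedralTop_dvd {i j : B} (hij : i ≠ j) {g : BraidMonoid M} (hi : atom M i ∣ g)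
    (hj : atom M j ∣ g) : posLift cs (dihedralTop cs i j) ∣ g := by
  rw [atom_dvd_iff (cs := cs)] at hi hj
  obtain ⟨y, hy, hl⟩ := exists_eq_dihedralTop_mul hij (coxeterMatrix_ne_zero cs hij) hi hj
  rw [posLift_dvd_iff, hy, weakLE_mul, ← hy, hl, length_dihedralTop hij]

theorem posLift_mul_left_cancel (v : W) {g h : BraidMonoid M}
    (e : posLift cs v * g = posLift cs v * h) : g = h := by
  have key : ∀ k : BraidMonoid M, k =
      posLift cs (v⁻¹ * head cs (posLift cs v * k)) * rest cs (posLift cs v * k) := by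
    intro k
    rw [head_posLift_mul, rest_posLift_mul, inv_mul_cancel_left, ← mul_assoc,
      (greatestFactor_weakLE v _).posLift_mul, posLift_head_mul_rest]
  rw [key g, key h, e]

theorem braidMonoid_mul_left_cancel (cs : CoxeterSystem M W) (a : BraidMonoid M)
    {g h : BraidMonoid M} (e : a * g = a * h) : g = h := by
  induction a using braidMonoid_induction cs with
  | one => simpa using e
  | mul v a ih =>
    rw [mul_assoc, mul_assoc] at e
    exact ih (posLift_mul_left_cancel v e)

/-! ### Reversal -/

theorem altList_succ_eq_append (s t : B) (n : ℕ) :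
    altList s t (n + 1) = altList s t n ++ [if Even n then s else t] := by
  induction n generalizing s t with
  | zero => simp [altList]
  | succ n ih =>
    rw [altList, ih, altList, List.cons_append]
    by_cases h : Even n <;> simp [h, Nat.even_add_one]

theorem reverse_altList (s t : B) (n : ℕ) :
    (altList s t n).reverse = if Even n then altList t s n else altList s t n := by
  induction n with
  | zero => simp [altList]
  | succ n ih =>
    rw [altList_succ_eq_append, List.reverse_append, ih, ← altList_succ_eq_append]
    by_cases h : Even n <;> simp [h, Nat.even_add_one, altList]

theorem prod_map_op_atom (l : List B) :
    (l.map fun i => MulOpposite.op (atom M i)).prod = MulOpposite.op (word M l.reverse) := by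
  induction l with
  | nil => rfl
  | cons i l ih => rw [List.map_cons, List.prod_cons, ih, List.reverse_cons, word_append,
      word_singleton, MulOpposite.op_mul]

/-- The anti-automorphism of the Artin-Tits monoid fixing the generators, as a morphism to the
opposite monoid. -/
def reverseHom (M : CoxeterMatrix B) : BraidMonoid M →* (BraidMonoid M)ᵐᵒᵖ :=
  BraidMonoid.lift (fun i => MulOpposite.op (atom M i)) <| by
    intro s t hst hM
    rw [prod_map_op_atom, prod_map_op_atom, reverse_altList, reverse_altList]
    split_ifs
    · rw [word_altList hst hM]
    · rw [word_altList hst hM]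

/-- The anti-automorphism of the Artin-Tits monoid fixing the generators. -/
def rev (g : BraidMonoid M) : BraidMonoid M := (reverseHom M g).unop

theorem rev_word (l : List B) : rev (word M l) = word M l.reverse := by
  rw [rev, reverseHom, BraidMonoid.lift_word, prod_map_op_atom, MulOpposite.unop_op]

theorem rev_mul (g h : BraidMonoid M) : rev (g * h) = rev h * rev g := by
  simp [rev]

theorem rev_rev (g : BraidMonoid M) : rev (rev g) = g := by
  obtain ⟨l, rfl⟩ := exists_word g
  rw [rev_word, rev_word, List.reverse_reverse]

theorem rev_posLift (w : W) : rev (posLift cs w) = posLift cs w⁻¹ := by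
  obtain ⟨ω, hω, rfl⟩ := cs.exists_isReduced w
  rw [posLift_wordProd hω, rev_word, ← cs.wordProd_reverse, posLift_wordProd hω.reverse]

theorem isCancelMul (cs : CoxeterSystem M W) : IsCancelMul (BraidMonoid M) where
  mul_left_cancel a _ _ h := braidMonoid_mul_left_cancel cs a h
  mul_right_cancel a b c h := by
    rw [← rev_rev b, ← rev_rev c]
    congr 1
    apply braidMonoid_mul_left_cancel cs (rev a)
    rw [← rev_mul, ← rev_mul]
    exact congrArg rev h

variable (cs) in
/-- The greatest simple suffix of an element of the Artin-Tits monoid. -/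
noncomputable def last (g : BraidMonoid M) : W := (head cs (rev g))⁻¹

theorem exists_eq_mul_posLift_iff {w : W} {g : BraidMonoid M} :
    (∃ c, g = c * posLift cs w) ↔ WeakLE cs w⁻¹ (last cs g)⁻¹ := by
  rw [last, inv_inv, ← posLift_dvd_iff, ← rev_posLift]
  constructor
  · rintro ⟨c, rfl⟩
    rw [rev_mul]
    exact dvd_mul_right _ _
  · rintro ⟨c, hc⟩
    refine ⟨rev c, ?_⟩
    rw [← rev_rev (posLift cs w), ← rev_mul, ← hc, rev_rev]

theorem exists_eq_mul_posLift_last (g : BraidMonoid M) : ∃ c, g = c * posLift cs (last cs g) :=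
  exists_eq_mul_posLift_iff.2 (.refl _)

theorem last_last_mul (g h : BraidMonoid M) :
    last cs (posLift cs (last cs g) * h) = last cs (g * h) := by
  rw [last, last, last, rev_mul, rev_mul, rev_posLift, inv_inv, head_mul_head]

end NormalForm

section Garside

variable {M : CoxeterMatrix B}

/-- The length of an element of the Artin-Tits monoid, as a morphism. -/
def lengthHom (M : CoxeterMatrix B) : BraidMonoid M →* Multiplicative ℕ :=
  BraidMonoid.lift (fun _ => Multiplicative.ofAdd 1) <| by
    intro s t _ _
    simp [List.map_const', length_altList]

/-- The length of an element of the Artin-Tits monoid. -/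
def posLength (g : BraidMonoid M) : ℕ := (lengthHom M g).toAdd

theorem posLength_word (l : List B) : posLength (word M l) = l.length := by
  rw [posLength, lengthHom, BraidMonoid.lift_word]
  simp [List.map_const']

theorem posLength_mul (g h : BraidMonoid M) : posLength (g * h) = posLength g + posLength h := by
  simp [posLength]

theorem posLength_atom (i : B) : posLength (atom M i) = 1 := by
  rw [← word_singleton, posLength_word]; rfl

theorem posLength_eq_zero_iff {g : BraidMonoid M} : posLength g = 0 ↔ g = 1 := by
  obtain ⟨l, rfl⟩ := exists_word g
  rw [posLength_word, List.length_eq_zero_iff]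
  constructor
  · rintro rfl; rfl
  · intro h
    rw [← List.length_eq_zero_iff, ← posLength_word (M := M), h, ← word_nil, posLength_word]
    rfl

theorem eq_or_eq_of_mem_altList {s t b : B} {n : ℕ} (h : b ∈ altList s t n) : b = s ∨ b = t := by
  induction n generalizing s t with
  | zero => simp [altList] at h
  | succ n ih =>
    rw [altList, List.mem_cons] at h
    exact h.elim .inl fun h => (ih h).symm

theorem mem_altList_swap {s t b : B} {n : ℕ} (hn : n ≠ 1) (h : b ∈ altList s t n) :
    b ∈ altList t s n := by
  match n with
  | 0 => simp [altList] at h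
  | 1 => exact absurd rfl hn
  | n + 2 =>
    rw [altList, altList]
    rcases eq_or_eq_of_mem_altList h with rfl | rfl <;> simp

open Classical in
theorem prod_map_ite (b : B) (l : List B) :
    (l.map fun i => if i = b then 0 else 1).prod = if b ∈ l then 0 else 1 := by
  induction l with
  | nil => simp
  | cons i l ih =>
    rw [List.map_cons, List.prod_cons, ih]
    by_cases h : i = b
    · simp [h]
    · simp [h, Ne.symm h]

open Classical in
/-- The morphism detecting whether a generator occurs in an element. -/
noncomputable def occursHom (M : CoxeterMatrix B) (b : B) : BraidMonoid M →* ℕ :=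
  BraidMonoid.lift (fun i => if i = b then 0 else 1) <| by
    intro s t hst _
    rw [prod_map_ite, prod_map_ite]
    have : b ∈ altList s t (M s t) ↔ b ∈ altList t s (M s t) :=
      ⟨mem_altList_swap (M.off_diagonal s t hst), mem_altList_swap (M.off_diagonal s t hst)⟩
    simp [this]

/-- The set of generators occurring in an element of the Artin-Tits monoid. -/
def support (g : BraidMonoid M) : Set B := {b | occursHom M b g = 0}

theorem support_word (l : List B) : support (word M l) = {b | b ∈ l} := by
  ext b
  rw [support, Set.mem_ofPred_eq, occursHom, BraidMonoid.lift_word, prod_map_ite]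
  simp

theorem support_mul (g h : BraidMonoid M) : support (g * h) = support g ∪ support h := by
  ext b
  simp [support]

theorem support_one : support (1 : BraidMonoid M) = ∅ := by
  rw [← word_nil, support_word]; simp

theorem support_atom (i : B) : support (atom M i) = {i} := by
  rw [← word_singleton, support_word]; simp

theorem support_subset_of_mul_left {g h : BraidMonoid M} {X : Set B} (H : support (g * h) ⊆ X) :
    support g ⊆ X := by
  rw [support_mul] at H
  exact Set.subset_union_left.trans H

theorem support_subset_of_mul_right {g h : BraidMonoid M} {X : Set B} (H : support (g * h) ⊆ X) :
    support h ⊆ X := by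
  rw [support_mul] at H
  exact Set.subset_union_right.trans H

theorem exists_eq_atom_mul {g : BraidMonoid M} (h : g ≠ 1) :
    ∃ i h, i ∈ support g ∧ g = atom M i * h := by
  obtain ⟨l, rfl⟩ := exists_word g
  match l with
  | [] => exact absurd rfl h
  | i :: l => exact ⟨i, word M l, by simp [support_mul, support_atom], word_cons i l⟩

/-- Induction on the elements supported in `X`. -/
theorem support_induction {X : Set B} {p : BraidMonoid M → Prop} (one : p 1)
    (mul : ∀ i ∈ X, ∀ g, support g ⊆ X → p g → p (atom M i * g)) (g : BraidMonoid M)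
    (hg : support g ⊆ X) : p g := by
  obtain ⟨l, rfl⟩ := exists_word g
  induction l with
  | nil => exact one
  | cons i l ih =>
    rw [word_cons] at hg ⊢
    have h1 := support_subset_of_mul_right hg
    refine mul i ?_ _ h1 (ih h1)
    rw [support_mul, support_atom] at hg
    exact hg (.inl rfl)

variable {W : Type*} [Group W] {cs : CoxeterSystem M W} [Finite W]

theorem posLength_posLift (w : W) : posLength (posLift cs w) = cs.length w := by
  obtain ⟨ω, hω, rfl⟩ := cs.exists_isReduced w
  rw [posLift_wordProd hω, posLength_word, hω]

theorem support_posLift_subset_iff {w : W} {X : Set B} :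
    support (posLift cs w) ⊆ X ↔ InParabolic cs X w := by
  obtain ⟨ω, hω, rfl⟩ := cs.exists_isReduced w
  rw [posLift_wordProd hω, support_word]
  exact ⟨fun h => ⟨ω, h, rfl⟩, fun h => h.mem_of_isReduced hω⟩

theorem inParabolic_head {g : BraidMonoid M} {X : Set B} (h : support g ⊆ X) :
    InParabolic cs X (head cs g) := by
  rw [← posLift_head_mul_rest (cs := cs) g] at h
  exact support_posLift_subset_iff.1 (support_subset_of_mul_left h)

variable (cs) in
/-- The Garside element of the parabolic submonoid generated by `X`. -/
noncomputable def garside (X : Set B) : BraidMonoid M := posLift cs (longest cs X)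

theorem atom_dvd_garside {X : Set B} {i : B} (hi : i ∈ X) : atom M i ∣ garside cs X := by
  rw [atom_dvd_iff (cs := cs), garside, head_posLift]
  exact isLeftDescent_longest hi

theorem support_garside (X : Set B) : support (garside cs X) = X := by
  apply (support_posLift_subset_iff.2 (inParabolic_longest X)).antisymm
  intro i hi
  obtain ⟨c, hc⟩ := atom_dvd_garside (cs := cs) hi
  change i ∈ support (garside cs X)
  rw [hc, support_mul, support_atom]
  exact .inl rfl

theorem garside_dvd {X : Set B} {g : BraidMonoid M} (hg : support g ⊆ X)
    (h : ∀ i ∈ X, atom M i ∣ g) : garside cs X ∣ g := by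
  rw [garside, ← eq_longest_of_isLeftDescent (inParabolic_head hg)
    fun i hi => atom_dvd_iff.1 (h i hi), posLift_dvd_iff]
  exact .refl _

theorem garside_mul_atom_of_longest {X : Set B} {i j : B} (hi : i ∈ X) (hj : j ∈ X)
    (h : longest cs X * cs.simple i = cs.simple j * longest cs X) :
    garside cs X * atom M i = atom M j * garside cs X := by
  have h1 := cs.isLeftDescent_iff.1 (isLeftDescent_longest (cs := cs) hj)
  have h2 := cs.isRightDescent_iff.1 (isRightDescent_longest (cs := cs) hi)
  have e1 : garside cs X = atom M j * posLift cs (cs.simple j * longest cs X) := by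
    rw [garside, ← posLift_simple (cs := cs), ← posLift_mul, cs.simple_mul_simple_cancel_left]
    rw [cs.simple_mul_simple_cancel_left, cs.length_simple]
    omega
  have e2 : garside cs X = posLift cs (longest cs X * cs.simple i) * atom M i := by
    rw [garside, ← posLift_simple (cs := cs), ← posLift_mul, cs.simple_mul_simple_cancel_right]
    rw [cs.simple_mul_simple_cancel_right, cs.length_simple]
    omega
  rw [h] at e2
  nth_rewrite 1 [e1]
  rw [e2, mul_assoc]

theorem garside_mul_atom {X : Set B} {i : B} (hi : i ∈ X) :
    ∃ j ∈ X, garside cs X * atom M i = atom M j * garside cs X ∧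
      garside cs X * atom M j = atom M i * garside cs X := by
  obtain ⟨j, hj, h⟩ := longest_mul_simple (cs := cs) hi
  refine ⟨j, hj, garside_mul_atom_of_longest hi hj h, garside_mul_atom_of_longest hj hi ?_⟩
  have h2 : longest cs X * longest cs X = 1 := by
    rw [mul_eq_one_iff_eq_inv, longest_inv]
  rw [eq_comm, ← mul_right_inj (longest cs X), ← mul_assoc, h, mul_assoc, h2, ← mul_assoc, h2]
  simp

theorem commute_garside_sq {X : Set B} {g : BraidMonoid M} (hg : support g ⊆ X) :
    Commute (garside cs X ^ 2) g := by
  refine support_induction (.one_right _) (fun i hi g _ ih => Commute.mul_right ?_ ih) g hg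
  obtain ⟨j, -, h1, h2⟩ := garside_mul_atom (cs := cs) hi
  rw [Commute, SemiconjBy, sq, mul_assoc, h1, ← mul_assoc, h2, mul_assoc]

theorem exists_mul_eq_garside_sq {X : Set B} {i : B} (hi : i ∈ X) :
    ∃ c : BraidMonoid M, support c ⊆ X ∧ atom M i * c = garside cs X ^ 2 ∧
      c * atom M i = garside cs X ^ 2 := by
  have := isCancelMul cs
  obtain ⟨c, hc⟩ := atom_dvd_garside (cs := cs) hi
  have h1 : support (garside cs X ^ 2) ⊆ X := by
    rw [sq, support_mul, support_garside, Set.union_self]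
  have e : atom M i * (c * garside cs X) = garside cs X ^ 2 := by rw [← mul_assoc, ← hc, sq]
  refine ⟨c * garside cs X, ?_, e, ?_⟩
  · rw [← e] at h1
    exact support_subset_of_mul_right h1
  · apply mul_left_cancel (a := atom M i)
    rw [← mul_assoc, e, (commute_garside_sq (cs := cs) (X := X) _).eq]
    rw [support_atom]
    simpa using hi

/-! ### Embedding into the group -/

/-- The canonical morphism from the Artin-Tits monoid to the Artin-Tits group. -/
def toArtin (M : CoxeterMatrix B) : BraidMonoid M →* Artin M :=
  BraidMonoid.lift (gen M) <| by
    intro s t hst hM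
    have h : PresentedGroup.mk (braidRels M) _ = 1 :=
      PresentedGroup.one_of_mem (rels := braidRels M) ⟨s, t, hst, hM, rfl⟩
    rw [map_mul, map_inv, mul_inv_eq_one, map_list_prod, map_list_prod, List.map_map,
      List.map_map] at h
    exact h

theorem toArtin_word (l : List B) : toArtin M (word M l) = (l.map (gen M)).prod :=
  BraidMonoid.lift_word _ _ l

theorem toArtin_atom (i : B) : toArtin M (atom M i) = gen M i := rfl

theorem toArtin_injective (cs : CoxeterSystem M W) : Function.Injective (toArtin M) := by
  have := isCancelMul cs
  set δ : BraidMonoid M := garside cs Set.univ ^ 2 with hδ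
  have hcomm : ∀ (s : Submonoid.powers δ) (g : BraidMonoid M), (s : BraidMonoid M) * g = g * s := by
    rintro ⟨_, n, rfl⟩ g
    exact (commute_garside_sq (Set.subset_univ _)).pow_left n
  let _ : OreLocalization.OreSet (Submonoid.powers δ) :=
    { ore_right_cancel := fun r₁ r₂ s h => ⟨s, by rw [mul_right_cancel h]⟩
      oreNum := fun r _ => r
      oreDenom := fun _ s => s
      ore_eq := fun r s => hcomm s r }
  let ι : BraidMonoid M →* OreLocalization (Submonoid.powers δ) (BraidMonoid M) :=
    OreLocalization.numeratorHom
  have hι : Function.Injective ι := by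
    intro g h e
    obtain ⟨u, v, h1, h2⟩ := OreLocalization.oreDiv_eq_iff.1 e
    rw [Submonoid.coe_one, mul_one, mul_one] at h2
    rw [Submonoid.smul_def, smul_eq_mul, smul_eq_mul, ← h2] at h1
    exact (mul_left_cancel h1).symm
  have hu : ∀ i, IsUnit (ι (atom M i)) := by
    intro i
    obtain ⟨c, -, h1, h2⟩ := exists_mul_eq_garside_sq (cs := cs) (Set.mem_univ i)
    have hc : Commute (ι (atom M i)) (ι c) := by
      rw [Commute, SemiconjBy, ← map_mul, ← map_mul, h1, h2]
    refine (hc.isUnit_mul_iff.1 ?_).1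
    rw [← map_mul, h1]
    exact OreLocalization.numerator_isUnit (S := Submonoid.powers δ)
      ⟨δ, Submonoid.mem_powers δ⟩
  let f : B → (OreLocalization (Submonoid.powers δ) (BraidMonoid M))ˣ := fun i => (hu i).unit
  have hf : ∀ l : List B, (((l.map f).prod : _ˣ) : OreLocalization _ _) = ι (word M l) := by
    intro l
    induction l with
    | nil => simp
    | cons i l ih => rw [List.map_cons, List.prod_cons, Units.val_mul, ih, word_cons, map_mul]; rfl
  have hrel : ∀ r ∈ braidRels M, FreeGroup.lift f r = 1 := by
    rintro r ⟨s, t, hst, hM, rfl⟩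
    rw [map_mul, map_inv, mul_inv_eq_one, map_list_prod, map_list_prod, List.map_map,
      List.map_map]
    have e : (FreeGroup.lift f : _ → _) ∘ FreeGroup.of = f := by
      funext i
      simp
    rw [e]
    apply Units.ext
    rw [hf, hf, word_altList hst hM]
  let ψ : Artin M →* (OreLocalization (Submonoid.powers δ) (BraidMonoid M))ˣ :=
    PresentedGroup.toGroup hrel
  have hψ : ∀ g, ((ψ (toArtin M g) : _ˣ) : OreLocalization _ _) = ι g := by
    intro g
    obtain ⟨l, rfl⟩ := exists_word g
    rw [toArtin_word, ← hf, map_list_prod, List.map_map]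
    congr 3
    funext i
    exact PresentedGroup.toGroup.of hrel
  intro g h e
  apply hι
  rw [← hψ, ← hψ, e]

end Garside

section Conjugation

variable {W : Type*} [Group W] {M : CoxeterMatrix B} {cs : CoxeterSystem M W}

theorem simple_mul_eq_mul_simple {d : W} {x y : B} (hy : ¬ cs.IsLeftDescent d y)
    (hx : ¬ cs.IsRightDescent d x) (h : cs.IsRightDescent (cs.simple y * d) x) :
    cs.simple y * d = d * cs.simple x := by
  obtain ⟨ω, hω, rfl⟩ := cs.exists_isReduced d
  rw [← cs.wordProd_cons] at h
  obtain ⟨j, hj, e⟩ := exists_eraseIdx_of_isRightDescent cs h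
  match j with
  | 0 =>
    rw [List.eraseIdx_cons_zero, cs.wordProd_cons] at e
    nth_rewrite 2 [← e]
    rw [cs.simple_mul_simple_cancel_right]
  | j + 1 =>
    rw [List.eraseIdx_cons_succ, cs.wordProd_cons, cs.wordProd_cons, mul_assoc,
      mul_right_inj] at e
    rw [cs.not_isRightDescent_iff, e] at hx
    have h1 := cs.length_wordProd_le (ω.eraseIdx j)
    rw [List.length_cons] at hj
    rw [List.length_eraseIdx_of_lt (by omega)] at h1
    rw [CoxeterSystem.IsReduced] at hω
    omega

theorem exists_conj_eq {g v : BraidMonoid M}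
    (h : ∀ x ∈ support v, ∃ y, g * atom M x = atom M y * g) :
    ∃ c, g * v = c * g ∧ (∀ y ∈ support c, ∃ x ∈ support v, g * atom M x = atom M y * g) ∧
      ∀ x ∈ support v, ∃ y ∈ support c, g * atom M x = atom M y * g := by
  obtain ⟨l, rfl⟩ := exists_word v
  induction l with
  | nil => exact ⟨1, by simp, by simp [support_one], by simp [support_one]⟩
  | cons i l ih =>
    rw [word_cons, support_mul, support_atom] at h ⊢
    obtain ⟨c, h1, h2, h3⟩ := ih fun x hx => h x (.inr hx)
    obtain ⟨y, hy⟩ := h i (.inl rfl)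
    refine ⟨atom M y * c, ?_, ?_, ?_⟩
    · rw [← mul_assoc, hy, mul_assoc, h1, mul_assoc]
    · rw [support_mul, support_atom]
      rintro z (rfl | hz)
      · exact ⟨i, .inl rfl, hy⟩
      · obtain ⟨x, hx, e⟩ := h2 z hz
        exact ⟨x, .inr hx, e⟩
    · rw [support_mul, support_atom]
      rintro z (rfl | hz)
      · exact ⟨y, .inl rfl, hy⟩
      · obtain ⟨x, hx, e⟩ := h3 z hz
        exact ⟨x, .inr hx, e⟩

variable [Finite W]

theorem posLift_injective : Function.Injective (posLift cs) :=
  Function.LeftInverse.injective (g := head cs) head_posLift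

theorem posLift_simple_mul {d : W} {y : B} (h : ¬ cs.IsLeftDescent d y) :
    posLift cs (cs.simple y * d) = atom M y * posLift cs d := by
  rw [posLift_mul, posLift_simple]
  rw [cs.not_isLeftDescent_iff] at h
  rw [h, cs.length_simple, add_comm]

theorem posLift_mul_simple {d : W} {x : B} (h : ¬ cs.IsRightDescent d x) :
    posLift cs (d * cs.simple x) = posLift cs d * atom M x := by
  rw [posLift_mul, posLift_simple]
  rw [cs.not_isRightDescent_iff] at h
  rw [h, cs.length_simple]

theorem exists_eq_mul_atom_of_isRightDescent {d : W} {x : B} (h : cs.IsRightDescent d x) :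
    ∃ c, posLift cs d = c * atom M x := by
  refine ⟨posLift cs (d * cs.simple x), ?_⟩
  rw [← posLift_mul_simple, cs.simple_mul_simple_cancel_right]
  rw [CoxeterSystem.IsRightDescent] at h ⊢
  rw [cs.simple_mul_simple_cancel_right]
  omega

/-- If a simple element `d`, minimal in its coset of the parabolic generated by the support of `v`,
conjugates `v` to a positive element, then it conjugates each generator in the support of `v` to a
generator. -/
theorem posLift_conj_atom {d : W} {v c : BraidMonoid M}
    (hd : ∀ x ∈ support v, ¬ cs.IsRightDescent d x) (h : posLift cs d * v = c * posLift cs d) :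
    ∀ x ∈ support v, ∃ y, posLift cs d * atom M x = atom M y * posLift cs d := by
  have hcancel := isCancelMul cs
  induction hn : cs.length d + posLength v using Nat.strong_induction_on generalizing d v c with
  | _ n ih =>
  by_cases hc : c = 1
  · have hv : v = 1 := by
      have := congrArg posLength h
      rw [posLength_mul, posLength_mul, posLength_eq_zero_iff.2 hc] at this
      rw [← posLength_eq_zero_iff]
      omega
    simp [hv, support_one]
  obtain ⟨y, c, -, rfl⟩ := exists_eq_atom_mul hc
  have hw : InParabolic cs (support v) (head cs v) := inParabolic_head subset_rfl
  have hlen := length_mul_of_inParabolic hd hw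
  have hy : cs.IsLeftDescent (d * head cs v) y := by
    have e : greatestFactor cs d (head cs v) = head cs v :=
      (greatestFactor_weakLE _ _).eq_of_length_le
        (weakLE_greatestFactor (.refl _) (weakLE_mul.2 hlen)).length_le
    rw [← e, ← head_posLift_mul, ← atom_dvd_iff, h, mul_assoc]
    exact dvd_mul_right _ _
  by_cases hyd : cs.IsLeftDescent d y
  · obtain ⟨d, rfl⟩ : ∃ d', d = cs.simple y * d' :=
      ⟨cs.simple y * d, by rw [cs.simple_mul_simple_cancel_left]⟩
    have hy' : ¬ cs.IsLeftDescent d y := by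
      rw [CoxeterSystem.IsLeftDescent, cs.simple_mul_simple_cancel_left] at hyd
      rw [CoxeterSystem.IsLeftDescent]
      omega
    have hl := cs.not_isLeftDescent_iff.1 hy'
    have hd' : ∀ x ∈ support v, ¬ cs.IsRightDescent d x := by
      intro x hx hdx
      apply hd x hx
      rw [CoxeterSystem.IsRightDescent] at hdx ⊢
      have := cs.length_mul_le (cs.simple y) (d * cs.simple x)
      rw [cs.length_simple] at this
      rw [mul_assoc]
      omega
    rw [posLift_simple_mul hy', mul_assoc, mul_assoc, mul_right_inj, ← mul_assoc] at h
    have key := ih _ (by omega) hd' h rfl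
    obtain ⟨c', e, h1, -⟩ := exists_conj_eq key
    rw [h, mul_left_inj] at e
    obtain ⟨x, hx, hxy⟩ := h1 y (by rw [← e, support_mul, support_atom]; exact .inr rfl)
    rw [← posLift_mul_simple (hd' x hx), ← posLift_simple_mul hy'] at hxy
    have := posLift_injective hxy
    exfalso
    apply hd x hx
    rw [← this, CoxeterSystem.IsRightDescent, cs.simple_mul_simple_cancel_right,
      cs.not_isRightDescent_iff.1 (hd' x hx)]
    omega
  · obtain ⟨x, hx, hxd⟩ : ∃ x ∈ support v, cs.IsRightDescent (cs.simple y * d) x := by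
      by_contra! hno
      have h1 := length_mul_of_inParabolic hno hw
      rw [CoxeterSystem.IsLeftDescent, ← mul_assoc, h1, cs.not_isLeftDescent_iff.1 hyd, hlen] at hy
      omega
    have e := simple_mul_eq_mul_simple hyd (hd x hx) hxd
    have hxv : atom M x ∣ v := by
      rw [atom_dvd_iff (cs := cs), CoxeterSystem.IsLeftDescent]
      rw [CoxeterSystem.IsLeftDescent, ← mul_assoc, e, mul_assoc, hlen,
        length_mul_of_inParabolic hd ((InParabolic.simple hx).mul hw)] at hy
      omega
    have e' : posLift cs d * atom M x = atom M y * posLift cs d := by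
      rw [← posLift_mul_simple (hd x hx), ← posLift_simple_mul hyd, e]
    obtain ⟨v, rfl⟩ := hxv
    rw [← mul_assoc, e', mul_assoc, mul_assoc, mul_right_inj] at h
    rw [support_mul, support_atom] at hd ⊢
    rw [posLength_mul, posLength_atom] at hn
    rintro z (rfl | hz)
    · exact ⟨y, e'⟩
    · exact ih _ (by omega) (fun x hx => hd x (.inr hx)) h rfl z hz

theorem last_eq_one_iff {g : BraidMonoid M} : last cs g = 1 ↔ g = 1 := by
  constructor
  · intro h
    by_contra hne
    have hne' : rev g ≠ 1 := fun e => hne (by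
      rw [← rev_rev g, e, ← word_nil, rev_word, List.reverse_nil])
    obtain ⟨i, k, -, hk⟩ := exists_eq_atom_mul hne'
    have : cs.IsLeftDescent (head cs (rev g)) i := atom_dvd_iff.1 ⟨k, hk⟩
    rw [last, inv_eq_one] at h
    rw [h] at this
    exact absurd this (by simp [CoxeterSystem.IsLeftDescent])
  · rintro rfl
    rw [last, ← word_nil, rev_word, List.reverse_nil, word_nil, head_one, inv_one]

/-- An element with no right divisor in the support of `v` which conjugates `v` to a positive
element conjugates each generator in the support of `v` to a generator. -/
theorem conj_atom (cs : CoxeterSystem M W) {g v a : BraidMonoid M}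
    (hg : ∀ x ∈ support v, ∀ c, g ≠ c * atom M x) (h : g * v = a * g) :
    ∀ x ∈ support v, ∃ y, g * atom M x = atom M y * g := by
  have hcancel := isCancelMul cs
  induction hn : posLength g using Nat.strong_induction_on generalizing g v with
  | _ n ih =>
  by_cases hg1 : g = 1
  · intro x _
    exact ⟨x, by simp [hg1]⟩
  have hd1 : last cs g ≠ 1 := fun e => hg1 (last_eq_one_iff.1 e)
  obtain ⟨g₁, hg₁⟩ := exists_eq_mul_posLift_last (cs := cs) g
  have hll : ∃ c, posLift cs (last cs g) * v = c * posLift cs (last cs g) := by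
    rw [exists_eq_mul_posLift_iff, last_last_mul, h, ← exists_eq_mul_posLift_iff]
    exact ⟨a * g₁, by rw [mul_assoc, ← hg₁]⟩
  set d := last cs g with hd
  clear_value d
  obtain ⟨c₀, hc₀⟩ := hll
  subst hg₁
  have key := posLift_conj_atom (fun x hx hdx => by
    obtain ⟨c, hc⟩ := exists_eq_mul_atom_of_isRightDescent hdx
    exact hg x hx (g₁ * c) (by rw [hc, mul_assoc])) hc₀
  obtain ⟨c, hc, h1, h2⟩ := exists_conj_eq key
  have hlen : 0 < cs.length d := Nat.pos_of_ne_zero fun e => hd1 (cs.length_eq_zero_iff.1 e)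
  rw [posLength_mul, posLength_posLift] at hn
  rw [mul_assoc, hc, ← mul_assoc, ← mul_assoc, mul_left_inj] at h
  have hrec := ih _ (by omega) (fun y hy c' e => by
    obtain ⟨x, hx, hxy⟩ := h1 y hy
    exact hg x hx (c' * posLift cs d) (by rw [e, mul_assoc, ← hxy, mul_assoc])) h rfl
  intro x hx
  obtain ⟨y, hy, hxy⟩ := h2 x hx
  obtain ⟨z, hz⟩ := hrec y hy
  exact ⟨z, by rw [mul_assoc, hxy, ← mul_assoc, hz, mul_assoc]⟩

theorem dvd_of_dvd_mul {Y : Set B} (cs : CoxeterSystem M W) {a b g : BraidMonoid M}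
    (ha : support a ⊆ Y) (hb : support b ⊆ Y) (hg : ∀ i ∈ Y, ¬ atom M i ∣ g) (h : b ∣ a * g) :
    b ∣ a := by
  have hcancel := isCancelMul cs
  induction hn : posLength a using Nat.strong_induction_on generalizing a b with
  | _ n ih =>
  by_cases hb1 : b = 1
  · rw [hb1]; exact one_dvd a
  obtain ⟨i, b, hi, rfl⟩ := exists_eq_atom_mul hb1
  have hiY := hb hi
  have hia : atom M i ∣ a := by
    have hiag : atom M i ∣ a * g := (dvd_mul_right _ _).trans h
    by_cases ha1 : a = 1
    · rw [ha1, one_mul] at hiag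
      exact absurd hiag (hg i hiY)
    obtain ⟨j, a, hj, rfl⟩ := exists_eq_atom_mul ha1
    have hjY := ha hj
    by_cases hij : j = i
    · rw [hij]; exact dvd_mul_right _ _
    have htop := posLift_dihedralTop_dvd (cs := cs) hij
      (by rw [mul_assoc]; exact dvd_mul_right _ _) hiag
    have hM := coxeterMatrix_ne_zero cs hij
    obtain ⟨m, hm⟩ := Nat.exists_eq_succ_of_ne_zero hM
    have e := posLift_dihedralTop (cs := cs) hij
    have e' := e.trans (word_altList hij hM)
    rw [hm, altList, word_cons] at e e'
    rw [e, mul_assoc] at htop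
    obtain ⟨k, hk⟩ := htop
    rw [mul_assoc, mul_right_inj] at hk
    rw [posLength_mul, posLength_atom] at hn
    have hsub : support (word M (altList i j m)) ⊆ Y := by
      rw [support_word]
      intro z hz
      rcases eq_or_eq_of_mem_altList hz with rfl | rfl
      · exact hiY
      · exact hjY
    obtain ⟨q, hq⟩ := ih _ (by omega) (support_subset_of_mul_right ha) hsub ⟨k, hk⟩ rfl
    rw [hq, ← mul_assoc, ← e, e', mul_assoc]
    exact dvd_mul_right _ _
  obtain ⟨a, rfl⟩ := hia
  obtain ⟨k, hk⟩ := h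
  rw [mul_assoc, mul_assoc, mul_right_inj] at hk
  rw [posLength_mul, posLength_atom] at hn
  exact mul_dvd_mul_left _ (ih _ (by omega) (support_subset_of_mul_right ha)
    (support_subset_of_mul_right hb) ⟨k, hk⟩ rfl)

end Conjugation

section Parabolics

variable {M : CoxeterMatrix B}

theorem toArtin_mem_posMonOn {X : Set B} {g : BraidMonoid M} (hg : support g ⊆ X) :
    toArtin M g ∈ posMonOn M X := by
  refine support_induction (p := fun g => toArtin M g ∈ posMonOn M X) ?_ ?_ g hg
  · rw [map_one]
    exact one_mem _
  · intro i hi g _ ih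
    rw [map_mul, toArtin_atom]
    exact mul_mem (Submonoid.subset_closure ⟨i, hi, rfl⟩) ih

theorem exists_toArtin_eq {X : Set B} {z : Artin M} (hz : z ∈ posMonOn M X) :
    ∃ g : BraidMonoid M, support g ⊆ X ∧ toArtin M g = z := by
  induction hz using Submonoid.closure_induction with
  | mem z hz =>
    obtain ⟨i, hi, rfl⟩ := hz
    exact ⟨atom M i, by simpa [support_atom] using hi, rfl⟩
  | one => exact ⟨1, by simp [support_one], map_one _⟩
  | mul z z' _ _ h h' =>
    obtain ⟨g, hg, rfl⟩ := h
    obtain ⟨g', hg', rfl⟩ := h'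
    exact ⟨g * g', by rw [support_mul]; exact Set.union_subset hg hg', map_mul _ _ _⟩

theorem posMonOn_le_stdSub (X : Set B) {z : Artin M} (hz : z ∈ posMonOn M X) : z ∈ stdSub M X := by
  have : posMonOn M X ≤ (stdSub M X).toSubmonoid :=
    Submonoid.closure_le.2 Subgroup.subset_closure
  exact this hz

theorem toArtin_mem_stdSub {X : Set B} {g : BraidMonoid M} (hg : support g ⊆ X) :
    toArtin M g ∈ stdSub M X :=
  posMonOn_le_stdSub X (toArtin_mem_posMonOn hg)

theorem support_pow {g : BraidMonoid M} {n : ℕ} (hn : n ≠ 0) : support (g ^ n) = support g := by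
  induction n with
  | zero => exact absurd rfl hn
  | succ n ih =>
    rw [pow_succ, support_mul]
    by_cases h : n = 0
    · rw [h, pow_zero, support_one, Set.empty_union]
    · rw [ih h, Set.union_self]

theorem exists_reduced_decomposition (X Y : Set B) (p : BraidMonoid M) :
    ∃ a q u, p = a * q * u ∧ support a ⊆ Y ∧ support u ⊆ X ∧ (∀ i ∈ Y, ¬ atom M i ∣ q) ∧
      ∀ i ∈ X, ∀ c, q ≠ c * atom M i := by
  induction hn : posLength p using Nat.strong_induction_on generalizing p with
  | _ n ih =>
  by_cases hY : ∃ i ∈ Y, atom M i ∣ p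
  · obtain ⟨i, hi, p, rfl⟩ := hY
    rw [posLength_mul, posLength_atom] at hn
    obtain ⟨a, q, u, rfl, ha, h⟩ := ih _ (by omega) p rfl
    refine ⟨atom M i * a, q, u, by simp only [mul_assoc], ?_, h⟩
    rw [support_mul, support_atom]
    exact Set.union_subset (by simpa using hi) ha
  by_cases hX : ∃ i ∈ X, ∃ c, p = c * atom M i
  · obtain ⟨i, hi, p, rfl⟩ := hX
    rw [posLength_mul, posLength_atom] at hn
    obtain ⟨a, q, u, rfl, ha, hu, h⟩ := ih _ (by omega) p rfl
    refine ⟨a, q, u * atom M i, by simp only [mul_assoc], ha, ?_, h⟩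
    rw [support_mul, support_atom]
    exact Set.union_subset hu (by simpa using hi)
  push Not at hY hX
  exact ⟨1, p, 1, by simp, by simp [support_one], by simp [support_one], hY, hX⟩

theorem atom_injective : Function.Injective (atom M) := by
  intro i j h
  have := congrArg support h
  rwa [support_atom, support_atom, Set.singleton_eq_singleton_iff] at this

variable {W : Type*} [Group W] {cs : CoxeterSystem M W} [Finite W]

theorem IsDelta.eq_toArtin_garside (cs : CoxeterSystem M W) {X : Set B} {Δ : Artin M}
    (h : IsDelta M X Δ) : Δ = toArtin M (garside cs X) := by
  obtain ⟨h1, h2, h3⟩ := h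
  obtain ⟨g, hg, rfl⟩ := exists_toArtin_eq h1
  have hinj := toArtin_injective cs
  obtain ⟨c, hc⟩ : garside cs X ∣ g := by
    refine garside_dvd hg fun i hi => ?_
    obtain ⟨c, hc, e⟩ := h2 i hi
    obtain ⟨c, -, rfl⟩ := exists_toArtin_eq hc
    rw [← toArtin_atom, ← map_mul] at e
    exact ⟨c, (hinj e).symm⟩
  have hsupp : support (garside cs X) ⊆ X := (support_garside X).subset
  obtain ⟨c', hc', e⟩ := h3 (toArtin M (garside cs X)) (toArtin_mem_posMonOn hsupp) <| by
    intro i hi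
    obtain ⟨c, hc⟩ := atom_dvd_garside (cs := cs) hi
    refine ⟨toArtin M c, toArtin_mem_posMonOn ?_, by rw [hc, map_mul, toArtin_atom]⟩
    rw [hc] at hsupp
    exact support_subset_of_mul_right hsupp
  obtain ⟨c', -, rfl⟩ := exists_toArtin_eq hc'
  rw [← map_mul] at e
  have h4 := congrArg posLength (hinj e)
  have h5 := congrArg posLength hc
  rw [posLength_mul] at h4 h5
  have hc1 : c = 1 := posLength_eq_zero_iff.1 (by omega)
  rw [hc, hc1, mul_one]

theorem commute_toArtin_garside_sq {Y : Set B} {h : Artin M} (hh : h ∈ stdSub M Y) :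
    Commute (toArtin M (garside cs Y ^ 2)) h := by
  have : stdSub M Y ≤ Subgroup.centralizer {toArtin M (garside cs Y ^ 2)} := by
    refine (Subgroup.closure_le _).2 ?_
    rintro _ ⟨i, hi, rfl⟩
    rw [SetLike.mem_coe, Subgroup.mem_centralizer_singleton_iff, ← toArtin_atom, ← map_mul,
      ← map_mul, (commute_garside_sq (X := Y) _).eq]
    simpa [support_atom] using hi
  exact (Subgroup.mem_centralizer_singleton_iff.1 (this hh)).symm

theorem exists_toArtin_eq_pow_mul (cs : CoxeterSystem M W) {Y : Set B} {h : Artin M}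
    (hh : h ∈ stdSub M Y) : ∃ (a : BraidMonoid M) (n : ℕ), support a ⊆ Y ∧
      toArtin M ((garside cs Y ^ 2) ^ n) * h = toArtin M a := by
  induction hh using Subgroup.closure_induction_left with
  | one => exact ⟨1, 0, by simp [support_one], by simp⟩
  | mul_left z hz h hh ih =>
    obtain ⟨i, hi, rfl⟩ := hz
    obtain ⟨a, n, ha, e⟩ := ih
    refine ⟨atom M i * a, n, ?_, ?_⟩
    · rw [support_mul, support_atom]
      exact Set.union_subset (by simpa using hi) ha
    · have hc : Commute (toArtin M ((garside cs Y ^ 2) ^ n)) (gen M i) := by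
        rw [map_pow]
        exact (commute_toArtin_garside_sq (Subgroup.subset_closure ⟨i, hi, rfl⟩)).pow_left n
      rw [← mul_assoc, hc.eq, mul_assoc, e, map_mul, toArtin_atom]
  | inv_mul_cancel z hz h hh ih =>
    obtain ⟨i, hi, rfl⟩ := hz
    obtain ⟨a, n, ha, e⟩ := ih
    obtain ⟨c, hcY, -, hc⟩ := exists_mul_eq_garside_sq (cs := cs) hi
    refine ⟨c * a, n + 1, ?_, ?_⟩
    · rw [support_mul]
      exact Set.union_subset hcY ha
    · have hcomm : Commute (toArtin M ((garside cs Y ^ 2) ^ n)) (gen M i) := by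
        rw [map_pow]
        exact (commute_toArtin_garside_sq (Subgroup.subset_closure ⟨i, hi, rfl⟩)).pow_left n
      rw [pow_succ', map_mul, mul_assoc, ← mul_assoc _ (gen M i)⁻¹ h, hcomm.inv_right.eq,
        mul_assoc _ _ h, e, ← hc, map_mul, map_mul, toArtin_atom]
      group

theorem stdSub_univ : stdSub M Set.univ = ⊤ := by
  rw [stdSub, Set.image_univ]
  exact PresentedGroup.closure_range_of _

theorem exists_conj_of_mem (cs : CoxeterSystem M W) {X Y : Set B} {n : ℕ} (hn : n ≠ 0)
    {q : BraidMonoid M} (hqY : ∀ i ∈ Y, ¬ atom M i ∣ q) (hqX : ∀ i ∈ X, ∀ c, q ≠ c * atom M i)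
    (h : toArtin M q * toArtin M ((garside cs X ^ 2) ^ n) * (toArtin M q)⁻¹ ∈ stdSub M Y) :
    ∀ x ∈ X, ∃ y ∈ Y, q * atom M x = atom M y * q := by
  have hcancel := isCancelMul cs
  have hv : support ((garside cs X ^ 2) ^ n) = X := by
    rw [support_pow hn, support_pow two_ne_zero, support_garside]
  obtain ⟨a, m, ha, e⟩ := exists_toArtin_eq_pow_mul cs h
  rw [← mul_assoc, mul_inv_eq_iff_eq_mul, ← map_mul, ← map_mul, ← map_mul] at e
  replace e := toArtin_injective cs e
  have hb : support ((garside cs Y ^ 2) ^ m) ⊆ Y := by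
    by_cases hm : m = 0
    · simp [hm, support_one]
    · rw [support_pow hm, support_pow two_ne_zero, support_garside]
  obtain ⟨a, rfl⟩ := dvd_of_dvd_mul cs ha hb hqY ⟨_, e.symm⟩
  rw [mul_assoc, mul_right_inj] at e
  obtain ⟨c, h1, -, h2⟩ := exists_conj_eq (conj_atom cs (by rwa [hv]) e)
  rw [e, mul_left_inj] at h1
  intro x hx
  obtain ⟨y, hy, hxy⟩ := h2 x (by rwa [hv])
  rw [← h1] at hy
  exact ⟨y, support_subset_of_mul_right ha hy, hxy⟩

theorem exists_factorization (cs : CoxeterSystem M W) {X Y : Set B} {n : ℕ} (hn : n ≠ 0)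
    {g : Artin M} (h : g * toArtin M ((garside cs X ^ 2) ^ n) * g⁻¹ ∈ stdSub M Y) :
    ∃ R ⊆ Y, ∃ y ∈ stdSub M Y, ∃ x ∈ conjSet M X R, g = y * x := by
  have hcancel := isCancelMul cs
  obtain ⟨p, m, -, e⟩ := exists_toArtin_eq_pow_mul cs (Y := Set.univ) (h := g)
    (by rw [stdSub_univ]; trivial)
  set z := toArtin M ((garside cs Set.univ ^ 2) ^ m) with hz
  have hzc : ∀ h, Commute z h := by
    intro h
    rw [hz, map_pow]
    exact (commute_toArtin_garside_sq (Y := Set.univ) (by rw [stdSub_univ]; trivial)).pow_left m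
  obtain ⟨a, q, u, rfl, ha, hu, hqY, hqX⟩ := exists_reduced_decomposition X Y p
  have hg : g = toArtin M (a * q * u) * z⁻¹ := by
    rw [← e, (hzc g).eq, mul_inv_cancel_right]
  have huv : Commute (toArtin M u) (toArtin M ((garside cs X ^ 2) ^ n)) := by
    rw [Commute, SemiconjBy, ← map_mul, ← map_mul]
    exact congrArg _ ((commute_garside_sq hu).pow_left n).symm.eq
  have hq : toArtin M q * toArtin M ((garside cs X ^ 2) ^ n) * (toArtin M q)⁻¹ ∈ stdSub M Y := by
    have e1 : toArtin M q * toArtin M ((garside cs X ^ 2) ^ n) * (toArtin M q)⁻¹ =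
        (toArtin M a)⁻¹ * (g * toArtin M ((garside cs X ^ 2) ^ n) * g⁻¹) * toArtin M a := by
      rw [hg, mul_assoc _ z⁻¹, (hzc _).inv_left.eq, map_mul, map_mul, mul_assoc _ (toArtin M u),
        ← mul_assoc (toArtin M u), huv.eq]
      group
    rw [e1]
    exact mul_mem (mul_mem (inv_mem (toArtin_mem_stdSub ha)) h) (toArtin_mem_stdSub ha)
  have hconj := exists_conj_of_mem cs hn hqY hqX hq
  obtain ⟨c, hc, hcs, -⟩ := exists_conj_eq (g := q) (v := u) fun x hx =>
    (hconj x (hu hx)).imp fun _ h => h.2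
  have hcY : support c ⊆ Y := by
    intro y hy
    obtain ⟨x, hx, hxy⟩ := hcs y hy
    obtain ⟨y', hy', hxy'⟩ := hconj x (hu hx)
    rw [hxy, mul_left_inj] at hxy'
    rwa [atom_injective hxy']
  refine ⟨{y ∈ Y | ∃ x ∈ X, q * atom M x = atom M y * q}, Set.sep_subset _ _,
    toArtin M (a * c), toArtin_mem_stdSub ?_, toArtin M q * z⁻¹, ?_, ?_⟩
  · rw [support_mul]
    exact Set.union_subset ha hcY
  · have key : ∀ {x y}, q * atom M x = atom M y * q →
        gen M y * (toArtin M q * z⁻¹) = toArtin M q * z⁻¹ * gen M x := by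
      intro x y hxy
      rw [mul_assoc, (hzc _).inv_left.eq, ← mul_assoc, ← mul_assoc, ← toArtin_atom, ← toArtin_atom,
        ← map_mul, ← map_mul, hxy]
    apply Set.Subset.antisymm
    · rintro _ ⟨x, hx, rfl⟩
      obtain ⟨y, hy, hxy⟩ := hconj x hx
      exact ⟨y, ⟨hy, x, hx, hxy⟩, key hxy⟩
    · rintro _ ⟨y, ⟨-, x, hx, hxy⟩, rfl⟩
      exact ⟨x, hx, (key hxy).symm⟩
  · rw [hg, mul_assoc a, hc, map_mul, map_mul, map_mul]
    simp only [mul_assoc]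

end Parabolics

/-- **Key Proposition (Godelle).** For a spherical-type Artin-Tits system, `X, Y ⊆ S`,
`k ∈ ℤ∖{0}` and `g ∈ A_S`: (1) `gA_Xg⁻¹ ⊆ A_Y` ⟺ (2) `gΔ_X^kg⁻¹ ∈ A_Y`
⟺ (3) `g = yx` with `y ∈ A_Y` and `x ∈ Conj(S;X,R)` for some `R ⊆ Y`. -/
theorem key_proposition
    [Finite B] (M : CoxeterMatrix B) (hsph : Finite M.Group) (X Y : Set B)
    (Δ : Artin M) (hΔ : IsDelta M X Δ) (k : ℤ) (hk : k ≠ 0) (g : Artin M) :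
    ((stdSub M X).map (MulAut.conj g).toMonoidHom ≤ stdSub M Y
      ↔ g * Δ ^ k * g⁻¹ ∈ stdSub M Y) ∧
    ((stdSub M X).map (MulAut.conj g).toMonoidHom ≤ stdSub M Y
      ↔ ∃ R ⊆ Y, ∃ y ∈ stdSub M Y, ∃ x ∈ conjSet M X R, g = y * x) := by
  have h12 : (stdSub M X).map (MulAut.conj g).toMonoidHom ≤ stdSub M Y →
      g * Δ ^ k * g⁻¹ ∈ stdSub M Y := fun h =>
    h ⟨Δ ^ k, zpow_mem (posMonOn_le_stdSub X hΔ.1) k, rfl⟩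
  have h23 : g * Δ ^ k * g⁻¹ ∈ stdSub M Y →
      ∃ R ⊆ Y, ∃ y ∈ stdSub M Y, ∃ x ∈ conjSet M X R, g = y * x := by
    intro h
    refine exists_factorization M.toCoxeterSystem (n := k.natAbs) (Int.natAbs_ne_zero.2 hk) ?_
    rw [map_pow, map_pow, ← hΔ.eq_toArtin_garside M.toCoxeterSystem, ← pow_mul, mul_comm, pow_mul,
      ← conj_pow]
    refine pow_mem ?_ 2
    obtain ⟨n, rfl | rfl⟩ := Int.eq_nat_or_neg k
    · rwa [zpow_natCast] at h
    · rwa [zpow_neg, ← conj_inv, inv_mem_iff, zpow_natCast, ← Int.natAbs_natCast n,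
        ← Int.natAbs_neg] at h
  have h31 : (∃ R ⊆ Y, ∃ y ∈ stdSub M Y, ∃ x ∈ conjSet M X R, g = y * x) →
      (stdSub M X).map (MulAut.conj g).toMonoidHom ≤ stdSub M Y := by
    rintro ⟨R, hR, y, hy, x, hx, rfl⟩
    rw [Subgroup.map_le_iff_le_comap, stdSub, Subgroup.closure_le]
    rintro _ ⟨s, hs, rfl⟩
    have hmem : x * gen M s ∈ leftMul M R x := by
      rw [← show rightMul M X x = leftMul M R x from hx]
      exact ⟨s, hs, rfl⟩
    obtain ⟨r, hr, e⟩ := hmem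
    have e' : y * x * gen M s * (y * x)⁻¹ = y * gen M r * y⁻¹ := by
      rw [mul_assoc y x, ← e]
      group
    change y * x * gen M s * (y * x)⁻¹ ∈ stdSub M Y
    rw [e']
    exact mul_mem (mul_mem hy (Subgroup.subset_closure ⟨r, hR hr, rfl⟩)) (inv_mem hy)
  exact ⟨⟨h12, h31 ∘ h23⟩, ⟨h23 ∘ h12, h31⟩⟩

end ArtinTitsPaper
end
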